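/- arXiv:1407.0967 — 5 statements merged into one kernel-verified Lean document; each statement's English description precedes it below -/
import Mathlib

section
/- Let p > 5 be a prime. Then ∑_{k=1}^{p-1} ((−1)^k·f_k(−1)/k)·H_k ≡ −2·(−1/p)·E_{p-3} (mod p). -/
/-- The Franel polynomial `f n x = ∑_{k=0}^n (n choose k)² (2k choose n) xᵏ`. -/
def franelPoly (x : ℤ) (n : ℕ) : ℤ :=
  ∑ k ∈ Finset.range (n + 1), (n.choose k : ℤ) ^ 2 * ((2 * k).choose n : ℤ) * x ^ k

/-- The harmonic number `H_k = ∑_{j=1}^k 1/j`. -/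
def H (k : ℕ) : ℚ := ∑ j ∈ Finset.range k, 1 / ((j : ℚ) + 1)

/-- For rationals, `a ≡ b (mod p^m)` means the p-adic valuation of `a - b` is at least `m`. -/
def ratCongr (p m : ℕ) (a b : ℚ) : Prop :=
  a = b ∨ (m : ℤ) ≤ padicValRat p (a - b)

section Polylog

open Polynomial Finset

variable {K : Type*} [Field K]

/-- The finite polylogarithm `∑_{k=1}^{p-1} aᵏ / kᵈ`. -/
noncomputable def finitePolylog (p d : ℕ) (a : K) : K :=
  ∑ k ∈ Icc 1 (p - 1), ((k : K) ^ d)⁻¹ * a ^ k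

/-- The finite polylogarithm of a polynomial. -/
noncomputable def polylogPoly (p d : ℕ) (A : K[X]) : K[X] :=
  ∑ k ∈ Icc 1 (p - 1), C ((k : K) ^ d)⁻¹ * A ^ k

/-- The polynomial `Xᵖ · Li_d(1 - 1/X)`, where `Li_d` is the finite polylogarithm. -/
noncomputable def reflectedPolylog (K : Type*) [Field K] (p d : ℕ) : K[X] :=
  ∑ k ∈ Icc 1 (p - 1), C ((k : K) ^ d)⁻¹ * (X ^ (p - k) * (X - 1) ^ k)

/-- The polynomial `∑_{j=1}^n (n choose j) (-4)ʲ (X(1-X))ʲ / jᵈ`. -/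
noncomputable def binomialPolylog (K : Type*) [Field K] (n d : ℕ) : K[X] :=
  ∑ j ∈ Icc 1 n, C ((n.choose j : K) * (-4) ^ j * ((j : K) ^ d)⁻¹) * (X * (1 - X)) ^ j

lemma sum_Icc_one_even {M : Type*} [AddCommMonoid M] (f : ℕ → M) (n : ℕ) :
    ∑ k ∈ Icc 1 (2 * n), f k = ∑ i ∈ range n, (f (2 * i + 1) + f (2 * i + 2)) := by
  induction n with
  | zero => simp
  | succ n ih =>
    rw [show 2 * (n + 1) = 2 * n + 1 + 1 by ring, sum_Icc_succ_top (by lia),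
      sum_Icc_succ_top (by lia), ih, sum_range_succ, add_assoc]

lemma sum_Icc_one_eq_range {M : Type*} [AddCommMonoid M] (f : ℕ → M) (n : ℕ) :
    ∑ k ∈ Icc 1 n, f k = ∑ i ∈ range n, f (i + 1) := by
  induction n with
  | zero => simp
  | succ n ih => rw [sum_Icc_succ_top (by lia), ih, sum_range_succ]

lemma cast_ne_zero_of_mem_Icc {p : ℕ} (R : Type*) [AddGroupWithOne R] [CharP R p] {k : ℕ}
    (hk : k ∈ Icc 1 (p - 1)) : (k : R) ≠ 0 := by
  rw [mem_Icc] at hk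
  rw [Ne, CharP.cast_eq_zero_iff R p]
  exact fun h => by have := Nat.le_of_dvd (by lia) h; lia

lemma inv_pow_succ_mul {a : K} (ha : a ≠ 0) (d : ℕ) : (a ^ (d + 1))⁻¹ * a = (a ^ d)⁻¹ := by
  rw [pow_succ, mul_inv, mul_assoc, inv_mul_cancel₀ ha, mul_one]

/-- The duplication formula for finite polylogarithms. -/
lemma finitePolylog_sq {p n : ℕ} [CharP K p] (hn : p = 2 * n + 1) (d : ℕ) (h2 : (2 : K) ≠ 0)
    (x : K) :
    2 * finitePolylog p d (x ^ 2) =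
      2 ^ d * ((1 + x ^ p) * finitePolylog p d x + (1 - x ^ p) * finitePolylog p d (-x)) := by
  have hp : (2 * n + 1 : K) = 0 := by
    have := CharP.cast_eq_zero K p
    rw [hn] at this
    exact_mod_cast this
  have hsplit : finitePolylog p d (x ^ 2) =
      ∑ i ∈ range n, (((i + 1 : ℕ) : K) ^ d)⁻¹ * (x ^ 2) ^ (i + 1) +
      ∑ i ∈ range n, (((n + i + 1 : ℕ) : K) ^ d)⁻¹ * (x ^ 2) ^ (n + i + 1) := by
    rw [finitePolylog, sum_Icc_one_eq_range, hn, show 2 * n + 1 - 1 = n + n by lia,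
      sum_range_add]
  have hsub : p - 1 = 2 * n := by lia
  rw [hsplit, finitePolylog, finitePolylog, hsub, sum_Icc_one_even, sum_Icc_one_even,
    ← sum_add_distrib, mul_sum, mul_sum, mul_sum, ← sum_add_distrib, mul_sum]
  refine sum_congr rfl fun i _ => ?_
  have h1 : ((2 * i + 2 : ℕ) : K) = 2 * ((i + 1 : ℕ) : K) := by push_cast; ring
  have h3 : ((2 * i + 1 : ℕ) : K) = 2 * ((n + i + 1 : ℕ) : K) := by
    push_cast; linear_combination -hp
  have hneg1 : (-x) ^ (2 * i + 1) = - x ^ (2 * i + 1) := Odd.neg_pow ⟨i, rfl⟩ x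
  have hneg2 : (-x) ^ (2 * i + 2) = x ^ (2 * i + 2) := Even.neg_pow ⟨i + 1, by ring⟩ x
  have h2d : (2 : K) ^ d * (2 ^ d)⁻¹ = 1 := mul_inv_cancel₀ (pow_ne_zero _ h2)
  rw [hneg1, hneg2, h1, h3, mul_pow, mul_pow, mul_inv, mul_inv, ← pow_mul, ← pow_mul,
    show 2 * (n + i + 1) = p + (2 * i + 1) by lia, show 2 * (i + 1) = 2 * i + 2 by lia,
    pow_add x p]
  linear_combination (-2 * ((((i + 1 : ℕ) : K) ^ d)⁻¹ * x ^ (2 * i + 2)) -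
    2 * x ^ p * ((((n + i + 1 : ℕ) : K) ^ d)⁻¹ * x ^ (2 * i + 1))) * h2d

lemma finitePolylog_zero (p d : ℕ) : finitePolylog p d (0 : K) = 0 :=
  sum_eq_zero fun k hk => by simp [show k ≠ 0 by rw [mem_Icc] at hk; lia]

lemma finitePolylog_one {p n : ℕ} [CharP K p] (hn : p = 2 * n + 1) (h2 : (2 : K) ≠ 0)
    (h3 : (3 : K) ≠ 0) {d : ℕ} (hd : d = 1 ∨ d = 2) : finitePolylog p d (1 : K) = 0 := by
  have h := finitePolylog_sq hn d h2 (1 : K)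
  simp only [one_pow, sub_self, zero_mul, add_zero] at h
  rcases hd with rfl | rfl
  · refine (mul_eq_zero.mp (?_ : (2 : K) * finitePolylog p 1 1 = 0)).resolve_left h2
    linear_combination -h
  · refine (mul_eq_zero.mp (?_ : (2 * 3 : K) * finitePolylog p 2 1 = 0)).resolve_left
      (mul_ne_zero h2 h3)
    linear_combination -h

lemma finitePolylog_inv {p : ℕ} [CharP K p] {d : ℕ} (hd : Even d) {x : K} (hx : x ≠ 0) :
    x ^ p * finitePolylog p d x⁻¹ = finitePolylog p d x := by
  rw [finitePolylog, mul_sum, finitePolylog]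
  refine sum_nbij' (fun k => p - k) (fun k => p - k) ?_ ?_ ?_ ?_ ?_
  · intro k hk; rw [mem_Icc] at *; lia
  · intro k hk; rw [mem_Icc] at *; lia
  · intro k hk; rw [mem_Icc] at *; lia
  · intro k hk; rw [mem_Icc] at *; lia
  · intro k hk
    rw [mem_Icc] at hk
    have hkp : k ≤ p := by lia
    rw [Nat.cast_sub hkp, CharP.cast_eq_zero K p, zero_sub, hd.neg_pow, inv_pow]
    have : x ^ p = x ^ (p - k) * x ^ k := by rw [← pow_add, Nat.sub_add_cancel hkp]
    rw [this]
    field_simp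

lemma eval_polylogPoly (p d : ℕ) (A : K[X]) (x : K) :
    (polylogPoly p d A).eval x = finitePolylog p d (A.eval x) := by
  simp [polylogPoly, finitePolylog, eval_finsetSum]

lemma natDegree_polylogPoly_le (p d : ℕ) {A : K[X]} (hA : A.natDegree ≤ 1) :
    (polylogPoly p d A).natDegree ≤ p := by
  refine natDegree_sum_le_of_forall_le _ _ fun k hk => ?_
  rw [mem_Icc] at hk
  refine (natDegree_C_mul_le _ _).trans (natDegree_pow_le.trans ?_)
  nlinarith [Nat.mul_le_mul_left k hA, Nat.sub_le p 1]

lemma natDegree_one_sub_X_le : (1 - X : K[X]).natDegree ≤ 1 := by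
  compute_degree

lemma derivative_polylogPoly {p : ℕ} [CharP K p] (d : ℕ) (A : K[X]) :
    derivative (polylogPoly p (d + 1) A) * A = polylogPoly p d A * derivative A := by
  rw [polylogPoly, polylogPoly, derivative_sum, sum_mul, sum_mul]
  refine sum_congr rfl fun k hk => ?_
  have hc : C ((k : K) ^ (d + 1))⁻¹ * C (k : K) = C ((k : K) ^ d)⁻¹ := by
    rw [← C_mul, inv_pow_succ_mul (cast_ne_zero_of_mem_Icc K hk)]
  rw [mem_Icc] at hk
  obtain ⟨m, rfl⟩ : ∃ m, k = m + 1 := ⟨k - 1, by lia⟩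
  rw [derivative_C_mul, derivative_pow, ← hc, Nat.add_sub_cancel]
  ring

lemma polylogPoly_zero_mul {p : ℕ} (hp : 1 ≤ p) (A : K[X]) :
    polylogPoly p 0 A * (1 - A) = A - A ^ p := by
  obtain ⟨m, rfl⟩ : ∃ m, p = m + 1 := ⟨p - 1, by lia⟩
  simp only [polylogPoly, pow_zero, inv_one, map_one, one_mul, Nat.add_sub_cancel]
  clear hp
  induction m with
  | zero => simp
  | succ m ih => rw [sum_Icc_succ_top (by lia), add_mul, ih]; ring

lemma eval_reflectedPolylog (p d : ℕ) (x : K) :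
    (reflectedPolylog K p d).eval x =
      ∑ k ∈ Icc 1 (p - 1), ((k : K) ^ d)⁻¹ * (x ^ (p - k) * (x - 1) ^ k) := by
  simp [reflectedPolylog, eval_finsetSum]

lemma natDegree_reflectedPolylog_le (p d : ℕ) : (reflectedPolylog K p d).natDegree ≤ p := by
  refine natDegree_sum_le_of_forall_le _ _ fun k hk => ?_
  rw [mem_Icc] at hk
  refine (natDegree_C_mul_le _ _).trans (natDegree_mul_le.trans ?_)
  have h1 : (X - 1 : K[X]).natDegree ≤ 1 := by compute_degree
  have h2 : ((X - 1 : K[X]) ^ k).natDegree ≤ k :=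
    natDegree_pow_le.trans (by nlinarith [Nat.mul_le_mul_left k h1])
  rw [natDegree_X_pow]
  lia

lemma eval_zero_reflectedPolylog (p d : ℕ) : (reflectedPolylog K p d).eval 0 = 0 := by
  rw [eval_reflectedPolylog]
  refine sum_eq_zero fun k hk => ?_
  rw [mem_Icc] at hk
  rw [zero_pow (by lia)]
  ring

lemma eval_one_reflectedPolylog (p d : ℕ) : (reflectedPolylog K p d).eval 1 = 0 := by
  rw [eval_reflectedPolylog]
  refine sum_eq_zero fun k hk => ?_
  rw [mem_Icc] at hk
  rw [sub_self, zero_pow (show k ≠ 0 by lia)]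
  ring

lemma derivative_reflectedPolylog {p : ℕ} [CharP K p] (d : ℕ) :
    derivative (reflectedPolylog K p (d + 1)) * (X * (X - 1)) = reflectedPolylog K p d := by
  rw [reflectedPolylog, reflectedPolylog, derivative_sum, sum_mul]
  refine sum_congr rfl fun k hk => ?_
  have hc : C ((k : K) ^ (d + 1))⁻¹ * C (k : K) = C ((k : K) ^ d)⁻¹ := by
    rw [← C_mul, inv_pow_succ_mul (cast_ne_zero_of_mem_Icc K hk)]
  rw [mem_Icc] at hk
  obtain ⟨m, rfl⟩ : ∃ m, k = m + 1 := ⟨k - 1, by lia⟩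
  obtain ⟨l, hl⟩ : ∃ l, p - (m + 1) = l + 1 := ⟨p - (m + 1) - 1, by lia⟩
  have hcast : (C ((l + 1 : ℕ) : K) : K[X]) = -C ((m + 1 : ℕ) : K) := by
    rw [← C_neg, ← hl, Nat.cast_sub (by lia), CharP.cast_eq_zero K p, zero_sub]
  rw [derivative_C_mul, derivative_mul, derivative_pow, derivative_pow, hl, hcast, ← hc,
    Nat.add_sub_cancel, Nat.add_sub_cancel]
  simp only [derivative_X, derivative_sub, derivative_one]
  ring

lemma reflectedPolylog_zero {p : ℕ} [Fact p.Prime] [CharP K p] :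
    reflectedPolylog K p 0 = X - X ^ p := by
  have key : ∀ m l : ℕ, ∑ k ∈ Icc 1 m, (X ^ (m + l - k) * (X - 1) ^ k : K[X]) =
      X ^ (m + l) * (X - 1) - X ^ l * (X - 1) ^ (m + 1) := by
    intro m
    induction m with
    | zero => intro l; simp
    | succ m ih =>
      intro l
      rw [sum_Icc_succ_top (by lia), show m + 1 + l = m + (l + 1) by lia, ih,
        show m + (l + 1) - (m + 1) = l by lia]
      ring
  have hp := (Fact.out : p.Prime).one_le
  have h := key (p - 1) 1
  rw [Nat.sub_add_cancel hp] at h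
  simp only [reflectedPolylog, pow_zero, inv_one, map_one, one_mul]
  rw [h, sub_pow_char, one_pow]
  ring

lemma natDegree_binomialPolylog_le (n d : ℕ) :
    (binomialPolylog K n d).natDegree ≤ 2 * n + 1 := by
  refine natDegree_sum_le_of_forall_le _ _ fun j hj => ?_
  rw [mem_Icc] at hj
  refine (natDegree_C_mul_le _ _).trans (natDegree_pow_le.trans ?_)
  have : (X * (1 - X) : K[X]).natDegree ≤ 2 := by compute_degree
  nlinarith [Nat.mul_le_mul_left j this]

lemma eval_binomialPolylog (n d : ℕ) (x : K) :
    (binomialPolylog K n d).eval x =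
      ∑ j ∈ Icc 1 n, (n.choose j : K) * (-4) ^ j * ((j : K) ^ d)⁻¹ * (x * (1 - x)) ^ j := by
  simp [binomialPolylog, eval_finsetSum]

lemma eval_binomialPolylog_of_mul_eq_zero (n d : ℕ) {x : K} (hx : x * (1 - x) = 0) :
    (binomialPolylog K n d).eval x = 0 := by
  rw [eval_binomialPolylog]
  refine sum_eq_zero fun j hj => ?_
  rw [mem_Icc] at hj
  rw [hx, zero_pow (by lia), mul_zero]

lemma derivative_binomialPolylog {p n : ℕ} [CharP K p] (hn : p = 2 * n + 1) (d : ℕ) :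
    derivative (binomialPolylog K n (d + 1)) * (X * (1 - X)) =
      binomialPolylog K n d * (1 - 2 * X) := by
  rw [binomialPolylog, binomialPolylog, derivative_sum, sum_mul, sum_mul]
  refine sum_congr rfl fun j hj => ?_
  have hj' : j ∈ Icc 1 (p - 1) := by rw [mem_Icc] at *; lia
  have hc : C ((n.choose j : K) * (-4) ^ j * ((j : K) ^ (d + 1))⁻¹) * C (j : K) =
      C ((n.choose j : K) * (-4) ^ j * ((j : K) ^ d)⁻¹) := by
    rw [← C_mul, mul_assoc _ _ (j : K), inv_pow_succ_mul (cast_ne_zero_of_mem_Icc K hj')]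
  rw [mem_Icc] at hj
  obtain ⟨m, rfl⟩ : ∃ m, j = m + 1 := ⟨j - 1, by lia⟩
  rw [derivative_C_mul, derivative_pow, ← hc, Nat.add_sub_cancel, derivative_mul]
  simp only [derivative_X, derivative_sub, derivative_one]
  ring

lemma binomialPolylog_zero (n : ℕ) :
    binomialPolylog K n 0 = (1 - 2 * X) ^ (2 * n) - 1 := by
  have h : (1 - 2 * X : K[X]) ^ (2 * n) = (-4 * (X * (1 - X)) + 1) ^ n := by
    rw [pow_mul]; congr 1; ring
  rw [h, add_pow, sum_range_succ', binomialPolylog, sum_Icc_one_eq_range]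
  simp only [pow_zero, inv_one, mul_one, one_pow, Nat.choose_zero_right, Nat.cast_one,
    add_sub_cancel_right]
  refine sum_congr rfl fun i _ => ?_
  rw [mul_pow (-4 : K[X])]
  simp only [map_mul, map_pow, map_neg, map_natCast]
  rw [show (C (4 : K) : K[X]) = 4 from rfl]
  ring

lemma eq_zero_of_derivative_eq_zero {p : ℕ} [Fact p.Prime] [CharP K p] {f : K[X]}
    (hf : derivative f = 0) (hdeg : f.natDegree ≤ p) (h0 : f.eval 0 = 0) (h1 : f.eval 1 = 0) :
    f = 0 := by
  have hp := (Fact.out : p.Prime).pos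
  have hc0 : f.coeff 0 = 0 := by rwa [coeff_zero_eq_eval_zero]
  have hmid : ∀ k ∈ Icc 1 (p - 1), f.coeff k = 0 := by
    intro k hk
    have hne := cast_ne_zero_of_mem_Icc K hk
    rw [mem_Icc] at hk
    obtain ⟨m, rfl⟩ : ∃ m, k = m + 1 := ⟨k - 1, by lia⟩
    have h : (derivative f).coeff m = 0 := by rw [hf, coeff_zero]
    rw [coeff_derivative] at h
    exact (mul_eq_zero.mp h).resolve_right (by exact_mod_cast hne)
  have hlt : ∀ k < p, f.coeff k = 0 := by
    intro k hk
    rcases Nat.eq_zero_or_pos k with rfl | hk0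
    · exact hc0
    · exact hmid k (by rw [mem_Icc]; lia)
  have hcp : f.coeff p = 0 := by
    rw [eval_eq_sum_range' (Nat.lt_succ_of_le hdeg), sum_range_succ,
      sum_eq_zero fun k hk => by rw [hlt k (mem_range.mp hk), zero_mul]] at h1
    simpa using h1
  ext k
  rcases lt_trichotomy k p with hk | rfl | hk
  · rw [hlt k hk, coeff_zero]
  · rw [hcp, coeff_zero]
  · rw [coeff_eq_zero_of_natDegree_lt (hdeg.trans_lt hk), coeff_zero]

lemma eq_of_derivative_mul_eq {p : ℕ} [Fact p.Prime] [CharP K p] {f g : K[X]}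
    (hfg : derivative f * (X * (1 - X)) = derivative g * (X * (1 - X)))
    (hf : f.natDegree ≤ p) (hg : g.natDegree ≤ p)
    (h0 : f.eval 0 = g.eval 0) (h1 : f.eval 1 = g.eval 1) : f = g := by
  have hX : (X * (1 - X) : K[X]) ≠ 0 := by
    refine mul_ne_zero X_ne_zero fun h => ?_
    have := congrArg (eval 0) h
    simp at this
  refine sub_eq_zero.mp (eq_zero_of_derivative_eq_zero (p := p) ?_
    ((natDegree_sub_le _ _).trans (max_le hf hg)) (by rw [eval_sub, h0, sub_self])
    (by rw [eval_sub, h1, sub_self]))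
  rw [derivative_sub, mul_right_cancel₀ hX hfg, sub_self]

section Functional

variable {p n : ℕ} [Fact p.Prime] [CharP K p]

lemma polylogPoly_one_one_sub_X (hn : p = 2 * n + 1) (h2 : (2 : K) ≠ 0) (h3 : (3 : K) ≠ 0) :
    polylogPoly p 1 (1 - X : K[X]) = polylogPoly p 1 X := by
  refine eq_of_derivative_mul_eq (p := p) ?_
    (natDegree_polylogPoly_le _ _ natDegree_one_sub_X_le)
    (natDegree_polylogPoly_le _ _ natDegree_X_le) ?_ ?_
  · have a := derivative_polylogPoly (p := p) 0 (X : K[X])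
    have b := derivative_polylogPoly (p := p) 0 (1 - X : K[X])
    have a' := polylogPoly_zero_mul (p := p) (by lia) (X : K[X])
    have b' := polylogPoly_zero_mul (p := p) (by lia) (1 - X : K[X])
    rw [sub_pow_char, one_pow] at b'
    simp only [derivative_X, derivative_sub, derivative_one, zero_add] at a b
    linear_combination X * b - (1 - X) * a - a' - b'
  · simp [eval_polylogPoly, finitePolylog_zero, finitePolylog_one hn h2 h3]
  · simp [eval_polylogPoly, finitePolylog_zero, finitePolylog_one hn h2 h3]

lemma reflectedPolylog_one (hn : p = 2 * n + 1) (h2 : (2 : K) ≠ 0) (h3 : (3 : K) ≠ 0) :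
    reflectedPolylog K p 1 = -polylogPoly p 1 X := by
  refine eq_of_derivative_mul_eq (p := p) ?_ (natDegree_reflectedPolylog_le _ _)
    (by rw [natDegree_neg]; exact natDegree_polylogPoly_le _ _ natDegree_X_le) ?_ ?_
  · have a := derivative_polylogPoly (p := p) 0 (X : K[X])
    have a' := polylogPoly_zero_mul (p := p) (by lia) (X : K[X])
    have b := derivative_reflectedPolylog (K := K) (p := p) 0
    rw [reflectedPolylog_zero] at b
    simp only [derivative_X, derivative_neg, zero_add] at a b ⊢
    linear_combination (1 - X) * a + a' - b
  · simp [eval_zero_reflectedPolylog, eval_polylogPoly, finitePolylog_zero]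
  · simp [eval_one_reflectedPolylog, eval_polylogPoly, finitePolylog_one hn h2 h3]

lemma reflectedPolylog_two (hn : p = 2 * n + 1) (h2 : (2 : K) ≠ 0) (h3 : (3 : K) ≠ 0) :
    reflectedPolylog K p 2 = polylogPoly p 2 X - polylogPoly p 2 (1 - X) := by
  refine eq_of_derivative_mul_eq (p := p) ?_ (natDegree_reflectedPolylog_le _ _)
    ((natDegree_sub_le _ _).trans (max_le (natDegree_polylogPoly_le _ _ natDegree_X_le)
      (natDegree_polylogPoly_le _ _ natDegree_one_sub_X_le))) ?_ ?_
  · have a := derivative_polylogPoly (p := p) 1 (X : K[X])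
    have b := derivative_polylogPoly (p := p) 1 (1 - X : K[X])
    have c := derivative_reflectedPolylog (K := K) (p := p) 1
    rw [reflectedPolylog_one hn h2 h3] at c
    rw [polylogPoly_one_one_sub_X hn h2 h3] at b
    simp only [derivative_X, derivative_sub, derivative_one, Nat.reduceAdd] at a b c ⊢
    linear_combination X * b - (1 - X) * a - c
  · simp [eval_zero_reflectedPolylog, eval_polylogPoly, finitePolylog_zero,
      finitePolylog_one hn h2 h3]
  · simp [eval_one_reflectedPolylog, eval_polylogPoly, finitePolylog_zero,
      finitePolylog_one hn h2 h3]

lemma binomialPolylog_one (hn : p = 2 * n + 1) (h2 : (2 : K) ≠ 0) (h3 : (3 : K) ≠ 0) :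
    binomialPolylog K n 1 = 2 * polylogPoly p 1 X := by
  have hdeg := natDegree_binomialPolylog_le (K := K) n 1
  rw [← hn] at hdeg
  refine eq_of_derivative_mul_eq (p := p) ?_ hdeg
    ((natDegree_C_mul_le (2 : K) _).trans (natDegree_polylogPoly_le _ _ natDegree_X_le)) ?_ ?_
  · have a := derivative_polylogPoly (p := p) 0 (X : K[X])
    have a' := polylogPoly_zero_mul (p := p) (by lia) (X : K[X])
    have c := derivative_binomialPolylog (K := K) hn 0
    have hpow : (1 - 2 * X : K[X]) ^ (2 * n) * (1 - 2 * X) = 1 - 2 * X ^ p := by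
      rw [← pow_succ, ← hn, sub_pow_char, one_pow, mul_pow]
      congr 2
      rw [← one_add_one_eq_two, add_pow_char, one_pow]
    rw [binomialPolylog_zero] at c
    have hd : derivative (2 * polylogPoly p 1 X : K[X]) = 2 * derivative (polylogPoly p 1 X) :=
      derivative_C_mul (2 : K) _
    rw [hd]
    simp only [derivative_X, zero_add] at a c
    linear_combination c + hpow - 2 * (1 - X) * a - 2 * a'
  · simp [eval_binomialPolylog_of_mul_eq_zero, eval_polylogPoly, finitePolylog_zero]
  · simp [eval_binomialPolylog_of_mul_eq_zero, eval_polylogPoly, finitePolylog_one hn h2 h3]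

lemma binomialPolylog_two (hn : p = 2 * n + 1) (h2 : (2 : K) ≠ 0) (h3 : (3 : K) ≠ 0) :
    binomialPolylog K n 2 = 2 * (polylogPoly p 2 X + polylogPoly p 2 (1 - X)) := by
  have hdeg := natDegree_binomialPolylog_le (K := K) n 2
  rw [← hn] at hdeg
  refine eq_of_derivative_mul_eq (p := p) ?_ hdeg
    ((natDegree_C_mul_le (2 : K) _).trans ((natDegree_add_le _ _).trans
      (max_le (natDegree_polylogPoly_le _ _ natDegree_X_le)
        (natDegree_polylogPoly_le _ _ natDegree_one_sub_X_le)))) ?_ ?_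
  · have a := derivative_polylogPoly (p := p) 1 (X : K[X])
    have b := derivative_polylogPoly (p := p) 1 (1 - X : K[X])
    have c := derivative_binomialPolylog (K := K) hn 1
    rw [binomialPolylog_one hn h2 h3] at c
    rw [polylogPoly_one_one_sub_X hn h2 h3] at b
    have hd : derivative (2 * (polylogPoly p 2 X + polylogPoly p 2 (1 - X)) : K[X]) =
        2 * derivative (polylogPoly p 2 X + polylogPoly p 2 (1 - X)) :=
      derivative_C_mul (2 : K) _
    rw [hd]
    simp only [derivative_X, derivative_sub, derivative_add, derivative_one,
      Nat.reduceAdd] at a b c ⊢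
    linear_combination c - 2 * (1 - X) * a - 2 * X * b
  · simp [eval_binomialPolylog_of_mul_eq_zero, eval_polylogPoly, finitePolylog_zero,
      finitePolylog_one hn h2 h3]
  · simp [eval_binomialPolylog_of_mul_eq_zero, eval_polylogPoly, finitePolylog_zero,
      finitePolylog_one hn h2 h3]

/-- The finite dilogarithms of the golden ratio and of its conjugate sum to zero. -/
lemma finitePolylog_two_golden (hn : p = 2 * n + 1) (h2 : (2 : K) ≠ 0) (h3 : (3 : K) ≠ 0)
    (h5 : (5 : K) ≠ 0) {φ : K} (hφ : φ ^ 2 = φ + 1) :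
    finitePolylog p 2 φ + finitePolylog p 2 (1 - φ) = 0 := by
  have hφ0 : φ ≠ 0 := by rintro rfl; simp at hφ
  have hinv : φ⁻¹ = φ - 1 := inv_eq_of_mul_eq_one_right (by linear_combination hφ)
  set u := φ ^ p with hu
  have hu2 : u ^ 2 = u + 1 := by
    rw [hu, ← pow_mul, mul_comm, pow_mul, hφ, add_pow_char, one_pow]
  have hu0 : u ≠ 0 := pow_ne_zero _ hφ0
  have hodd : Odd p := ⟨n, hn⟩
  have e1 : u * finitePolylog p 2 (1 - φ) = -finitePolylog p 2 (-φ) := by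
    have := finitePolylog_inv (p := p) even_two (neg_ne_zero.mpr hφ0)
    rw [hodd.neg_pow, inv_neg, hinv, neg_sub] at this
    linear_combination -this
  have e2 : u ^ 2 * finitePolylog p 2 (φ⁻¹ ^ 2) = finitePolylog p 2 (φ ^ 2) := by
    have := finitePolylog_inv (p := p) even_two (pow_ne_zero 2 hφ0)
    rwa [← inv_pow, ← pow_mul, mul_comm 2 p, pow_mul] at this
  have e3 : finitePolylog p 2 (φ ^ 2) =
      2 * ((1 + u) * finitePolylog p 2 φ + (1 - u) * finitePolylog p 2 (-φ)) := by
    refine mul_left_cancel₀ h2 ?_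
    rw [finitePolylog_sq hn 2 h2]
    ring
  have e4 : u * finitePolylog p 2 (φ⁻¹ ^ 2) =
      finitePolylog p 2 φ - finitePolylog p 2 (1 - φ) := by
    have := congrArg (eval φ) (reflectedPolylog_two (K := K) hn h2 h3)
    rw [eval_sub, eval_polylogPoly, eval_polylogPoly, eval_reflectedPolylog] at this
    simp only [eval_X, eval_sub, eval_one] at this
    rw [← this, finitePolylog, mul_sum]
    refine sum_congr rfl fun k hk => ?_
    rw [mem_Icc] at hk
    have hk' : u = φ ^ (p - k) * φ ^ k := by
      rw [hu, ← pow_add, Nat.sub_add_cancel (by lia)]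
    have hone : φ ^ k * φ⁻¹ ^ k = 1 := by rw [← mul_pow, mul_inv_cancel₀ hφ0, one_pow]
    rw [hk', ← hinv, ← pow_mul, mul_comm 2 k, pow_mul, sq]
    linear_combination ((k : K) ^ 2)⁻¹ * φ ^ (p - k) * φ⁻¹ ^ k * hone
  have hu5 : 2 * u - 1 ≠ 0 := by
    intro h
    apply h5
    linear_combination (2 * u - 1) * h - 4 * hu2
  have key : (2 * u - 1) * (finitePolylog p 2 (-φ) - u * finitePolylog p 2 φ) = 0 := by
    linear_combination e1 + e2 + e3 - u * e4 - 2 * finitePolylog p 2 φ * hu2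
  have hb := (mul_eq_zero.mp key).resolve_left hu5
  refine (mul_eq_zero.mp (?_ : u * _ = 0)).resolve_left hu0
  linear_combination e1 - hb

end Functional

end Polylog

section HarmonicIdentity

open Finset

lemma alternating_sum_choose_succ (N : ℕ) (f : ℕ → ℚ) :
    ∑ i ∈ range (N + 2), (-1) ^ i * ((N + 1).choose i : ℚ) * f i =
      ∑ i ∈ range (N + 1), (-1) ^ i * (N.choose i : ℚ) * (f i - f (i + 1)) := by
  have h : ∑ i ∈ range (N + 1), (-1) ^ i * (N.choose i : ℚ) * f i =
      ∑ i ∈ range (N + 1), (-1) ^ (i + 1) * (N.choose (i + 1) : ℚ) * f (i + 1) + f 0 := by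
    have h' := sum_range_succ (fun i => (-1) ^ i * (N.choose i : ℚ) * f i) (N + 1)
    rw [sum_range_succ'] at h'
    simpa using h'.symm
  rw [sum_range_succ']
  simp only [mul_sub, sum_sub_distrib]
  rw [h]
  simp only [Nat.choose_succ_succ, Nat.cast_add, pow_zero, Nat.choose_zero_right, Nat.cast_one]
  rw [add_sub_right_comm, ← sum_sub_distrib, mul_one, one_mul]
  congr 1
  exact sum_congr rfl fun i _ => by ring

lemma alternating_sum_choose_mul_choose_eq_zero {N s : ℕ} (hs : s < N) (a : ℕ) :
    ∑ i ∈ range (N + 1), (-1) ^ i * (N.choose i : ℚ) * ((a + i).choose s : ℚ) = 0 := by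
  induction N generalizing s with
  | zero => lia
  | succ N ih =>
    rw [alternating_sum_choose_succ N (fun i => ((a + i).choose s : ℚ))]
    rcases s with _ | s
    · simp
    · rw [← neg_eq_zero, ← ih (show s < N by lia), ← sum_neg_distrib]
      refine sum_congr rfl fun i _ => ?_
      rw [← add_assoc, Nat.choose_succ_succ]
      push_cast
      ring

lemma alternating_sum_choose_mul_choose_self (N a : ℕ) :
    ∑ i ∈ range (N + 1), (-1) ^ i * (N.choose i : ℚ) * ((a + i).choose N : ℚ) = (-1) ^ N := by
  induction N with
  | zero => simp
  | succ N ih =>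
    rw [alternating_sum_choose_succ N (fun i => ((a + i).choose (N + 1) : ℚ)), pow_succ, ← ih,
      sum_mul]
    refine sum_congr rfl fun i _ => ?_
    rw [← add_assoc, Nat.choose_succ_succ]
    push_cast
    ring

lemma alternating_sum_choose_div (N a : ℕ) :
    ∑ i ∈ range (N + 1), (-1) ^ i * (N.choose i : ℚ) * (1 / ((a + i : ℕ) + 1 : ℚ)) =
      N.factorial * a.factorial / (a + N + 1).factorial := by
  induction N generalizing a with
  | zero =>
    have := Nat.factorial_ne_zero a
    simp [Nat.factorial_succ]
    field_simp
  | succ N ih =>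
    rw [alternating_sum_choose_succ N (fun i => 1 / ((a + i : ℕ) + 1 : ℚ))]
    simp only [mul_sub, sum_sub_distrib]
    have h := ih (a + 1)
    simp only [add_right_comm a 1, add_assoc a _ 1] at h
    simp only [add_assoc a _ 1] at ih ⊢
    rw [ih a, h]
    have h1 : (((N + 1 + 1) + a).factorial : ℚ) = (N + a + 2) * ((N + 1) + a).factorial := by
      rw [add_right_comm, Nat.factorial_succ]; push_cast; ring
    have h0 : (((N + 1) + a).factorial : ℚ) ≠ 0 := by
      exact_mod_cast Nat.factorial_ne_zero _
    have h2 : (N + a + 2 : ℚ) ≠ 0 := by positivity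
    simp only [add_comm a] at *
    rw [h1, Nat.factorial_succ N, Nat.add_comm 1 a, Nat.factorial_succ a]
    rw [add_right_comm N a 1]
    push_cast
    field_simp
    ring

lemma choose_div_succ (m b : ℕ) :
    (b.choose m : ℚ) / (b + 1) = (-1) ^ m * (1 / (b + 1)) +
      (-1) ^ m * ∑ r ∈ range m, (-1) ^ (r + 1) * ((b.choose r : ℚ) * (1 / (r + 1))) := by
  induction m with
  | zero => simp
  | succ m ih =>
    have h : ((b.choose (m + 1) : ℚ) + b.choose m) * (m + 1) = (b + 1) * b.choose m := by
      have := Nat.add_one_mul_choose_eq b m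
      rw [Nat.choose_succ_succ] at this
      have := congrArg (Nat.cast (R := ℚ)) this
      push_cast at this
      linear_combination -this
    have hb : (b + 1 : ℚ) ≠ 0 := by positivity
    have hm : (m + 1 : ℚ) ≠ 0 := by positivity
    have h' : (b.choose (m + 1) : ℚ) / (b + 1) =
        b.choose m * (1 / (m + 1)) - (b.choose m : ℚ) / (b + 1) := by
      field_simp
      linear_combination h
    have hsq : ((-1 : ℚ) ^ m) * (-1) ^ m = 1 := by rw [← mul_pow]; simp
    rw [h', ih, sum_range_succ]
    linear_combination -(b.choose m * (1 / (m + 1)) : ℚ) * hsq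

lemma alternating_sum_choose_mul_choose_div (N a : ℕ) :
    ∑ i ∈ range (N + 1), (-1) ^ i * (N.choose i : ℚ) *
        (((a + i).choose (N + 1) : ℚ) / ((a + i : ℕ) + 1)) =
      (-1) ^ N * (1 / (N + 1) - N.factorial * a.factorial / (a + N + 1).factorial) := by
  simp only [choose_div_succ, mul_add, sum_add_distrib, mul_sum]
  have h1 := alternating_sum_choose_div N a
  have h2 := alternating_sum_choose_mul_choose_self N a
  have h3 : ∀ r ∈ range N, ∑ i ∈ range (N + 1), (-1) ^ i * (N.choose i : ℚ) *
      ((-1) ^ (N + 1) * ((-1) ^ (r + 1) * (((a + i).choose r : ℚ) * (1 / (r + 1))))) = 0 := by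
    intro r hr
    rw [← mul_zero ((-1) ^ (N + 1) * (-1) ^ (r + 1) * (1 / (r + 1)) : ℚ),
      ← alternating_sum_choose_mul_choose_eq_zero (mem_range.mp hr) a, mul_sum]
    exact sum_congr rfl fun i _ => by ring
  have h4 : ∑ i ∈ range (N + 1), (-1) ^ i * (N.choose i : ℚ) *
      ((-1) ^ (N + 1) * ((-1) ^ (N + 1) * (((a + i).choose N : ℚ) * (1 / (N + 1))))) =
      (-1) ^ N * (1 / (N + 1)) := by
    rw [← h2, sum_mul]
    have hsq : ((-1 : ℚ) ^ (N + 1)) * (-1) ^ (N + 1) = 1 := by rw [← mul_pow]; simp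
    refine sum_congr rfl fun i _ => ?_
    linear_combination ((-1) ^ i * (N.choose i : ℚ) *
      (((a + i).choose N : ℚ) * (1 / (N + 1)))) * hsq
  have h5 : ∑ i ∈ range (N + 1), (-1) ^ i * (N.choose i : ℚ) *
      ((-1) ^ (N + 1) * (1 / ((a + i : ℕ) + 1))) =
      -(-1) ^ N * (N.factorial * a.factorial / (a + N + 1).factorial) := by
    rw [← h1, mul_sum]
    exact sum_congr rfl fun i _ => by ring
  rw [h5, sum_comm, sum_range_succ _ N, sum_eq_zero h3, zero_add, h4]
  ring

lemma H_succ (k : ℕ) : H (k + 1) = H k + 1 / ((k : ℚ) + 1) := by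
  rw [H, sum_range_succ, H]

lemma alternating_choose_step (m t : ℕ) :
    (-1) ^ (t + 1) * (m.choose (t + 1) : ℚ) * ((m + 1 + (t + 1)).choose (t + 1) : ℚ) =
      (-1) ^ t * (m.choose t : ℚ) * ((m + 1 + t).choose t : ℚ) +
      (-1) ^ (t + 1) * ((m + 1).choose (t + 1) : ℚ) * ((m + (t + 1)).choose (t + 1) : ℚ) := by
  have h1 := congrArg (Nat.cast (R := ℚ)) (Nat.add_one_mul_choose_eq m t)
  have h2 : ((m + 1 : ℕ) : ℚ) * ((m + 1 + t).choose t : ℚ) =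
      ((m + 1 + t).choose (t + 1) : ℚ) * (t + 1 : ℕ) := by
    have := Nat.choose_succ_right_eq (m + 1 + t) t
    rw [Nat.add_sub_cancel] at this
    have := congrArg (Nat.cast (R := ℚ)) this
    push_cast at this ⊢
    linear_combination -this
  have ht : ((t + 1 : ℕ) : ℚ) ≠ 0 := by positivity
  have h3 : ((m + 1 + t).choose t : ℚ) * ((m + 1).choose (t + 1) : ℚ) =
      m.choose t * ((m + 1 + t).choose (t + 1) : ℚ) := by
    refine mul_right_cancel₀ ht ?_
    push_cast at h1 h2 ⊢
    linear_combination (m.choose t : ℚ) * h2 - ((m + 1 + t).choose t : ℚ) * h1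
  rw [show m + 1 + (t + 1) = m + 1 + t + 1 by ring, show m + (t + 1) = m + 1 + t by ring,
    Nat.choose_succ_succ (m + 1 + t) t]
  rw [Nat.choose_succ_succ m t] at h3 ⊢
  push_cast at h3 ⊢
  rw [pow_succ]
  linear_combination (-(-1) ^ t) * h3

lemma alternating_sum_mul_H (m t : ℕ) :
    ∑ i ∈ range (t + 1), (-1) ^ i * ((m + 1).choose i : ℚ) * ((m + i).choose i : ℚ) *
        H (m + 1 + i) =
      (-1) ^ t * (m.choose t : ℚ) * ((m + 1 + t).choose t : ℚ) * H (m + 1 + t + 1) -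
      ∑ i ∈ range (t + 1), (-1) ^ i * (m.choose i : ℚ) *
        (((m + 1 + i).choose (m + 1) : ℚ) / ((m + 1 + i : ℕ) + 1)) := by
  have hsymm : ∀ i : ℕ, (m + 1 + i).choose (m + 1) = (m + 1 + i).choose i := fun i =>
    Nat.choose_symm_add
  simp only [hsymm]
  induction t with
  | zero => simp [H_succ]
  | succ t ih =>
    rw [sum_range_succ, ih, sum_range_succ _ (t + 1), H_succ (m + 1 + (t + 1)), mul_add,
      alternating_choose_step m t, ← add_assoc (m + 1) t 1]
    have := alternating_choose_step m t
    rw [← add_assoc (m + 1) t 1] at this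
    linear_combination (1 / (((m + 1 + t + 1 : ℕ) : ℚ) + 1)) * this

lemma alternating_sum_choose_mul_H (m : ℕ) :
    ∑ i ∈ range (m + 2), (-1) ^ i * ((m + 1).choose i : ℚ) * ((m + i).choose i : ℚ) *
        H (m + 1 + i) =
      (-1) ^ (m + 1) / (m + 1) * (1 - 1 / ((2 * (m + 1)).choose (m + 1) : ℚ)) := by
  rw [alternating_sum_mul_H m (m + 1), sum_range_succ, Nat.choose_succ_self,
    alternating_sum_choose_mul_choose_div]
  have hc : ((2 * (m + 1)).choose (m + 1) : ℚ) * (m + 1).factorial * (m + 1).factorial =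
      (m + 1 + m + 1).factorial := by
    have := Nat.choose_mul_factorial_mul_factorial (show m + 1 ≤ 2 * (m + 1) by lia)
    rw [show 2 * (m + 1) - (m + 1) = m + 1 by lia] at this
    rw [show m + 1 + m + 1 = 2 * (m + 1) by ring]
    exact_mod_cast this
  have h0 : ((m + 1).factorial : ℚ) ≠ 0 := by exact_mod_cast Nat.factorial_ne_zero _
  have hc0 : ((2 * (m + 1)).choose (m + 1) : ℚ) ≠ 0 := by
    exact_mod_cast (Nat.choose_pos (by lia)).ne'
  have hm : (m + 1 : ℚ) ≠ 0 := by positivity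
  have hf : ((m + 1).factorial : ℚ) = (m + 1) * m.factorial := by
    rw [Nat.factorial_succ]; push_cast; ring
  have hf0 : (m.factorial : ℚ) ≠ 0 := by exact_mod_cast Nat.factorial_ne_zero _
  rw [← hc, hf]
  push_cast
  field_simp
  ring

/-- The inner sum obtained by expanding the Franel polynomials and exchanging summations. -/
lemma sum_choose_sq_mul_H {j M : ℕ} (hj : 1 ≤ j) (hM : 2 * j ≤ M) :
    ∑ k ∈ Icc 1 M, (-1) ^ k * ((k.choose j : ℚ) ^ 2 * ((2 * j).choose k : ℚ)) / k * H k =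
      (((2 * j).choose j : ℚ) - 1) / j ^ 2 := by
  obtain ⟨m, rfl⟩ : ∃ m, j = m + 1 := ⟨j - 1, by lia⟩
  have hsub : (range (m + 2)).image (fun i => m + 1 + i) ⊆ Icc 1 M := by
    intro k hk
    rw [mem_image] at hk
    obtain ⟨i, hi, rfl⟩ := hk
    rw [mem_range] at hi
    rw [mem_Icc]
    lia
  rw [← sum_subset hsub, sum_image (fun a _ b _ h => by simpa using h)]
  · have hm : (m + 1 : ℚ) ≠ 0 := by positivity
    have hc0 : ((2 * (m + 1)).choose (m + 1) : ℚ) ≠ 0 := by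
      exact_mod_cast (Nat.choose_pos (by lia)).ne'
    have hterm : ∀ i ∈ range (m + 2),
        (-1) ^ (m + 1 + i) * (((m + 1 + i).choose (m + 1) : ℚ) ^ 2 *
        ((2 * (m + 1)).choose (m + 1 + i) : ℚ)) / (m + 1 + i : ℕ) * H (m + 1 + i) =
        (-1) ^ (m + 1) * ((2 * (m + 1)).choose (m + 1) : ℚ) / (m + 1) *
        ((-1) ^ i * ((m + 1).choose i : ℚ) * ((m + i).choose i : ℚ) * H (m + 1 + i)) := by
      intro i hi
      rw [mem_range] at hi
      have h1 := Nat.choose_mul (n := 2 * (m + 1)) (k := m + 1 + i) (s := m + 1)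
        (by lia)
      rw [show 2 * (m + 1) - (m + 1) = m + 1 by lia, Nat.add_sub_cancel_left] at h1
      have h2 := Nat.add_one_mul_choose_eq (m + i) m
      rw [Nat.choose_symm_add, show m + i + 1 = m + 1 + i by ring] at h2
      have h1' := congrArg (Nat.cast (R := ℚ)) h1
      have h2' := congrArg (Nat.cast (R := ℚ)) h2
      have hk : ((m + 1 + i : ℕ) : ℚ) ≠ 0 := by positivity
      push_cast at h1' h2' hk ⊢
      rw [pow_add (-1 : ℚ) (m + 1) i]
      field_simp
      linear_combination (H (m + 1 + i)) * ((m + 1) * ((m + 1 + i).choose (m + 1) : ℚ) * h1' -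
        ((2 * (m + 1)).choose (m + 1) : ℚ) * ((m + 1).choose i : ℚ) * h2')
    rw [sum_congr rfl hterm, ← mul_sum, alternating_sum_choose_mul_H]
    have hsq : ((-1 : ℚ) ^ (m + 1)) * (-1) ^ (m + 1) = 1 := by rw [← mul_pow]; simp
    push_cast
    field_simp
    linear_combination (((2 * (m + 1)).choose (m + 1) : ℚ) - 1) * hsq
  · intro k hk hk'
    rcases lt_or_ge k (m + 1) with h | h
    · simp [Nat.choose_eq_zero_of_lt h]
    · have : 2 * (m + 1) < k := by
        by_contra! hle
        exact hk' (mem_image.mpr ⟨k - (m + 1), by rw [mem_range]; lia, by lia⟩)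
      simp [Nat.choose_eq_zero_of_lt this]

end HarmonicIdentity

section EulerNumbers

open Polynomial Finset

variable {R : Type*} [CommRing R]

/-- The umbral functional: the linear map sending `Xᵏ` to `e k`. -/
noncomputable def umbral (e : ℕ → R) : R[X] →ₗ[R] R :=
  Polynomial.lsum fun k => LinearMap.mulRight R (e k)

lemma umbral_C_mul_X_pow (e : ℕ → R) (a : R) (k : ℕ) : umbral e (C a * X ^ k) = a * e k := by
  rw [umbral, lsum_apply, C_mul_X_pow_eq_monomial, sum_monomial_index _ _ (by simp)]
  simp

lemma umbral_X_pow (e : ℕ → R) (k : ℕ) : umbral e (X ^ k) = e k := by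
  simpa using umbral_C_mul_X_pow e 1 k

lemma umbral_C_mul (e : ℕ → R) (a : R) (f : R[X]) : umbral e (C a * f) = a * umbral e f := by
  rw [← smul_eq_C_mul, map_smul, smul_eq_mul]

variable {e : ℕ → R}

lemma umbral_comp_neg_X (hodd : ∀ n, Odd n → e n = 0) (f : R[X]) : umbral e (f.comp (-X)) = umbral e f := by
  induction f using Polynomial.induction_on' with
  | add f g hf hg => rw [add_comp, map_add, map_add, hf, hg]
  | monomial n a =>
    rw [← C_mul_X_pow_eq_monomial, mul_comp, C_comp, X_pow_comp, umbral_C_mul, umbral_C_mul]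
    rcases Nat.even_or_odd n with h | h
    · rw [h.neg_pow]
    · rw [h.neg_pow, map_neg, umbral_X_pow, hodd n h, neg_zero]

lemma umbral_X_sub_one_pow (hodd : ∀ n, Odd n → e n = 0) (m : ℕ) :
    umbral e ((X - 1) ^ m) = (-1) ^ m * umbral e ((X + 1) ^ m) := by
  rw [← umbral_comp_neg_X hodd ((X + 1) ^ m), ← umbral_C_mul]
  congr 1
  simp only [pow_comp, add_comp, X_comp, one_comp, map_pow, map_neg, map_one]
  rw [← mul_pow]
  congr 1
  ring

lemma umbral_X_add_one_pow (hodd : ∀ n, Odd n → e n = 0)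
    (hrec : ∀ n, 1 ≤ n → ∑ k ∈ range (n + 1), ((2 * n).choose (2 * k) : R) * e (2 * k) = 0)
    {n : ℕ} (hn : 1 ≤ n) : umbral e ((X + 1) ^ (2 * n)) = 0 := by
  have h : ∀ k, umbral e ((X : R[X]) ^ k * 1 ^ (2 * n - k) * ((2 * n).choose k : R[X])) =
      ((2 * n).choose k : R) * e k := by
    intro k
    rw [one_pow, mul_one, mul_comm, ← umbral_C_mul_X_pow e ((2 * n).choose k : R) k, map_natCast]
  rw [add_pow, map_sum, sum_congr rfl fun k _ => h k]
  refine Eq.trans ?_ (hrec n hn)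
  clear h
  have key : ∀ (g : ℕ → R), (∀ k, Odd k → g k = 0) → ∀ n,
      ∑ k ∈ range (2 * n + 1), g k = ∑ k ∈ range (n + 1), g (2 * k) := by
    intro g hg n
    induction n with
    | zero => simp
    | succ n ih =>
      rw [show 2 * (n + 1) + 1 = 2 * n + 1 + 1 + 1 by ring, sum_range_succ, sum_range_succ, ih,
        hg (2 * n + 1) ⟨n, rfl⟩, add_zero, sum_range_succ _ (n + 1)]
      rfl
  exact key (fun k => ((2 * n).choose k : R) * e k) (fun k hk => by rw [hodd k hk, mul_zero]) n

lemma umbral_comp_add_one_add_comp_sub_one (h0 : e 0 = 1) (hodd : ∀ n, Odd n → e n = 0)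
    (hrec : ∀ n, 1 ≤ n → ∑ k ∈ range (n + 1), ((2 * n).choose (2 * k) : R) * e (2 * k) = 0)
    (f : R[X]) :
    umbral e (f.comp (X + 1)) + umbral e (f.comp (X - 1)) = 2 * f.eval 0 := by
  induction f using Polynomial.induction_on' with
  | add f g hf hg =>
    rw [add_comp, add_comp, map_add, map_add, eval_add]
    linear_combination hf + hg
  | monomial n a =>
    rw [← C_mul_X_pow_eq_monomial]
    simp only [mul_comp, C_comp, X_pow_comp, umbral_C_mul, umbral_X_sub_one_pow hodd]
    rcases Nat.even_or_odd' n with ⟨k, rfl | rfl⟩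
    · rcases Nat.eq_zero_or_pos k with rfl | hk
      · have := umbral_X_pow e 0
        rw [h0] at this
        simp only [mul_zero, pow_zero] at this ⊢
        rw [this]
        simp
        ring
      · rw [umbral_X_add_one_pow hodd hrec hk]
        simp [hk.ne']
    · rw [Odd.neg_one_pow ⟨k, rfl⟩]
      simp

lemma umbral_X_add_C_pow (h0 : e 0 = 1) (hodd : ∀ n, Odd n → e n = 0)
    (hrec : ∀ n, 1 ≤ n → ∑ k ∈ range (n + 1), ((2 * n).choose (2 * k) : R) * e (2 * k) = 0)
    (m : ℕ) (y : R) :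
    umbral e ((X + C (y + 1)) ^ m) + umbral e ((X + C (y - 1)) ^ m) = 2 * y ^ m := by
  have h := umbral_comp_add_one_add_comp_sub_one h0 hodd hrec ((X + C y) ^ m)
  simp only [pow_comp, add_comp, X_comp, C_comp, eval_pow, eval_add, eval_X, eval_C,
    zero_add] at h
  rw [← h, map_add, map_sub, map_one]
  congr 3 <;> ring

lemma umbral_X_add_C_two_mul_pow (h0 : e 0 = 1) (hodd : ∀ n, Odd n → e n = 0)
    (hrec : ∀ n, 1 ≤ n → ∑ k ∈ range (n + 1), ((2 * n).choose (2 * k) : R) * e (2 * k) = 0)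
    (m r : ℕ) :
    (-1) ^ r * umbral e ((X + C (2 * r : R)) ^ m) =
      e m - 2 * ∑ i ∈ range r, (-1) ^ i * (2 * i + 1 : R) ^ m := by
  induction r with
  | zero => simp [umbral_X_pow]
  | succ r ih =>
    have h := umbral_X_add_C_pow h0 hodd hrec m (2 * r + 1 : R)
    rw [add_sub_cancel_right, show (2 * r + 1 + 1 : R) = 2 * (r + 1 : ℕ) by push_cast; ring] at h
    rw [sum_range_succ, pow_succ]
    linear_combination (-(-1) ^ r) * h + ih

end EulerNumbers

section EulerModPrime

open Finset Polynomial

/-- The alternating sum of inverse squares up to `(p - 1) / 2` modulo `p`. -/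
lemma sum_neg_one_pow_inv_sq {p n : ℕ} [Fact p.Prime] (hn : p = 2 * n + 1) (hp5 : 5 < p)
    {e : ℕ → ZMod p} (h0 : e 0 = 1) (hodd : ∀ n, Odd n → e n = 0)
    (hrec : ∀ n, 1 ≤ n →
      ∑ k ∈ range (n + 1), ((2 * n).choose (2 * k) : ZMod p) * e (2 * k) = 0) :
    ∑ j ∈ Icc 1 n, (-1) ^ j * ((j : ZMod p) ^ 2)⁻¹ = 2 * (-1) ^ n * e (p - 3) := by
  have hp : (2 * n : ZMod p) = -1 := by
    have := congrArg (Nat.cast (R := ZMod p)) hn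
    rw [CharP.cast_eq_zero (ZMod p) p] at this
    push_cast at this
    linear_combination -this
  have h2 : (2 : ZMod p) ≠ 0 := by
    intro h
    rw [h] at hp
    simp at hp
  have hA := umbral_X_add_C_two_mul_pow h0 hodd hrec (p - 3) n
  have hB : umbral e ((X + C (-1)) ^ (p - 3)) = 0 := by
    rw [C_neg, C_1, ← sub_eq_add_neg, umbral_X_sub_one_pow hodd,
      show p - 3 = 2 * (n - 1) by lia, umbral_X_add_one_pow hodd hrec (by lia), mul_zero]
  rw [hp, hB, mul_zero] at hA
  have hpow : ∀ x : ZMod p, x ≠ 0 → x ^ (p - 3) = (x ^ 2)⁻¹ := by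
    intro x hx
    refine eq_inv_of_mul_eq_one_left ?_
    rw [← pow_add, show p - 3 + 2 = p - 1 by lia, ZMod.pow_card_sub_one_eq_one hx]
  rw [← sum_range_reflect] at hA
  rw [sum_Icc_one_eq_range]
  have hterm : ∀ i ∈ range n,
      (-1) ^ (n - 1 - i) * (2 * ((n - 1 - i : ℕ) : ZMod p) + 1) ^ (p - 3) =
      (-1) ^ n * (4 : ZMod p)⁻¹ * ((-1) ^ (i + 1) * (((i + 1 : ℕ) : ZMod p) ^ 2)⁻¹) := by
    intro i hi
    rw [mem_range] at hi
    have hi0 : ((i + 1 : ℕ) : ZMod p) ≠ 0 :=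
      cast_ne_zero_of_mem_Icc (p := p) _ (by rw [mem_Icc]; lia)
    have hbase : 2 * ((n - 1 - i : ℕ) : ZMod p) + 1 = -(2 * ((i + 1 : ℕ) : ZMod p)) := by
      rw [Nat.sub_sub, Nat.cast_sub (by lia)]
      push_cast
      linear_combination hp
    have hsign : (-1 : ZMod p) ^ n = (-1) ^ (n - 1 - i) * (-1) ^ (i + 1) := by
      rw [← pow_add]; congr 1; lia
    have hsq : (-1 : ZMod p) ^ (i + 1) * (-1) ^ (i + 1) = 1 := by rw [← mul_pow]; simp
    rw [hbase, hpow _ (neg_ne_zero.mpr (mul_ne_zero h2 hi0)), neg_sq, mul_pow, mul_inv, hsign,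
      show (2 : ZMod p) ^ 2 = 4 by norm_num]
    linear_combination (-(-1) ^ (n - 1 - i) * (4 : ZMod p)⁻¹ *
      (((i + 1 : ℕ) : ZMod p) ^ 2)⁻¹) * hsq
  rw [sum_congr rfl hterm, ← mul_sum] at hA
  have h4 : (4 : ZMod p) * 4⁻¹ = 1 :=
    mul_inv_cancel₀ (by rw [show (4 : ZMod p) = 2 * 2 by norm_num]; exact mul_ne_zero h2 h2)
  have hsq : (-1 : ZMod p) ^ n * (-1) ^ n = 1 := by rw [← mul_pow]; simp
  set S := ∑ i ∈ range n, (-1) ^ (i + 1) * (((i + 1 : ℕ) : ZMod p) ^ 2)⁻¹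
  linear_combination -S * hsq - (-1) ^ n * (-1) ^ n * S * h4 + 2 * (-1) ^ n * hA

end EulerModPrime

section Reduction

open Finset

/-- The rational number `q` is `p`-integral with residue `z` modulo `p`. -/
def HasResidue (p : ℕ) [Fact p.Prime] (q : ℚ) (z : ZMod p) : Prop :=
  ∃ a b : ℤ, (b : ZMod p) ≠ 0 ∧ q * b = a ∧ z * b = a

namespace HasResidue

variable {p : ℕ} [Fact p.Prime] {q r : ℚ} {z w : ZMod p}

lemma intCast (a : ℤ) : HasResidue p a a :=
  ⟨a, 1, by simp, by simp, by simp⟩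

lemma natCast (a : ℕ) : HasResidue p a a :=
  ⟨a, 1, by simp, by simp, by simp⟩

lemma add (hq : HasResidue p q z) (hr : HasResidue p r w) : HasResidue p (q + r) (z + w) := by
  obtain ⟨a, b, hb, h1, h2⟩ := hq
  obtain ⟨c, d, hd, h3, h4⟩ := hr
  refine ⟨a * d + c * b, b * d, ?_, ?_, ?_⟩
  · push_cast; exact mul_ne_zero hb hd
  · push_cast; linear_combination (d : ℚ) * h1 + (b : ℚ) * h3
  · push_cast; linear_combination (d : ZMod p) * h2 + (b : ZMod p) * h4

lemma mul (hq : HasResidue p q z) (hr : HasResidue p r w) : HasResidue p (q * r) (z * w) := by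
  obtain ⟨a, b, hb, h1, h2⟩ := hq
  obtain ⟨c, d, hd, h3, h4⟩ := hr
  refine ⟨a * c, b * d, ?_, ?_, ?_⟩
  · push_cast; exact mul_ne_zero hb hd
  · push_cast; rw [← h1, ← h3]; ring
  · push_cast; rw [← h2, ← h4]; ring

lemma neg (hq : HasResidue p q z) : HasResidue p (-q) (-z) := by
  simpa using (intCast (p := p) (-1)).mul hq

lemma sub (hq : HasResidue p q z) (hr : HasResidue p r w) : HasResidue p (q - r) (z - w) := by
  simpa [sub_eq_add_neg] using hq.add hr.neg

lemma pow (hq : HasResidue p q z) (n : ℕ) : HasResidue p (q ^ n) (z ^ n) := by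
  induction n with
  | zero => simpa using natCast (p := p) 1
  | succ n ih => rw [pow_succ, pow_succ]; exact ih.mul hq

lemma inv_natCast {n : ℕ} (hn : (n : ZMod p) ≠ 0) :
    HasResidue p (n : ℚ)⁻¹ (n : ZMod p)⁻¹ := by
  have hn' : (n : ℚ) ≠ 0 := by
    intro h
    rw [Nat.cast_eq_zero] at h
    simp [h] at hn
  exact ⟨1, n, by simpa using hn, by simp [hn'], by simp [hn]⟩

lemma sum {ι : Type*} {s : Finset ι} {f : ι → ℚ} {g : ι → ZMod p}
    (h : ∀ i ∈ s, HasResidue p (f i) (g i)) : HasResidue p (∑ i ∈ s, f i) (∑ i ∈ s, g i) := by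
  classical
  induction s using Finset.induction_on with
  | empty => simpa using natCast (p := p) 0
  | insert a s ha ih =>
    rw [sum_insert ha, sum_insert ha]
    exact (h a (mem_insert_self a s)).add (ih fun i hi => h i (mem_insert_of_mem hi))

lemma unique (hz : HasResidue p q z) (hw : HasResidue p q w) : z = w := by
  obtain ⟨a, b, hb, h1, h2⟩ := hz
  obtain ⟨c, d, hd, h3, h4⟩ := hw
  have h : a * d = c * b := by
    have : (a * d : ℚ) = c * b := by rw [← h1, ← h3]; ring
    exact_mod_cast this
  have h' := congrArg (Int.cast (R := ZMod p)) h
  push_cast at h'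
  refine mul_right_cancel₀ (mul_ne_zero hb hd) ?_
  linear_combination (d : ZMod p) * h2 - (b : ZMod p) * h4 + h'

lemma ratCongr_of_eq (hq : HasResidue p q z) (hr : HasResidue p r z) : ratCongr p 1 q r := by
  by_cases hqr : q = r
  · exact Or.inl hqr
  refine Or.inr ?_
  have hsub := hq.sub hr
  rw [sub_self] at hsub
  have hne : q - r ≠ 0 := sub_ne_zero.mpr hqr
  obtain ⟨a, b, hb, h1, h2⟩ := hsub
  have hb0 : b ≠ 0 := by rintro rfl; simp at hb
  have hbq : (b : ℚ) ≠ 0 := by exact_mod_cast hb0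
  have ha0 : a ≠ 0 := by
    rintro rfl
    simp [hne, hb0] at h1
  rw [zero_mul, eq_comm, ZMod.intCast_zmod_eq_zero_iff_dvd] at h2
  rw [Ne, ZMod.intCast_zmod_eq_zero_iff_dvd] at hb
  have hval : padicValRat p (q - r) + padicValRat p b = padicValRat p a := by
    rw [← padicValRat.mul hne hbq, h1]
  rw [padicValRat.of_int, padicValRat.of_int, padicValInt.eq_zero_of_not_dvd hb] at hval
  have h1le : 1 ≤ padicValInt p a := by
    have := (padicValInt_dvd_iff (p := p) 1 a).mp (by simpa using h2)
    exact this.resolve_left ha0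
  push_cast at hval ⊢
  lia

end HasResidue

lemma hasResidue_H {p : ℕ} [Fact p.Prime] {k : ℕ} (hk : k < p) :
    HasResidue p (H k) (∑ j ∈ range k, ((j + 1 : ℕ) : ZMod p)⁻¹) := by
  refine HasResidue.sum fun j hj => ?_
  rw [mem_range] at hj
  have := HasResidue.inv_natCast (cast_ne_zero_of_mem_Icc (p := p) (ZMod p)
    (show j + 1 ∈ Icc 1 (p - 1) by rw [mem_Icc]; lia))
  rw [one_div]
  simpa using this

end Reduction

section Congruences

open Finset

lemma natCast_ne_zero_of_lt {p m : ℕ} (hm : 0 < m) (hmp : m < p) (R : Type*) [AddGroupWithOne R]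
    [CharP R p] : (m : R) ≠ 0 :=
  cast_ne_zero_of_mem_Icc (p := p) R (by rw [mem_Icc]; lia)

variable {p n : ℕ} [Fact p.Prime]

lemma neg_one_pow_mul_centralBinom (hn : p = 2 * n + 1) {j : ℕ} (hj : j ≤ n) :
    (-1) ^ j * ((2 * j).choose j : ZMod p) = 4 ^ j * (n.choose j : ZMod p) := by
  have hp : (2 * n : ZMod p) = -1 := by
    have := congrArg (Nat.cast (R := ZMod p)) hn
    rw [CharP.cast_eq_zero (ZMod p) p] at this
    push_cast at this
    linear_combination -this
  induction j with
  | zero => simp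
  | succ j ih =>
    have h1 := congrArg (Nat.cast (R := ZMod p)) (Nat.succ_mul_centralBinom_succ j)
    have h2 := congrArg (Nat.cast (R := ZMod p)) (Nat.choose_succ_right_eq n j)
    rw [Nat.centralBinom_eq_two_mul_choose, Nat.centralBinom_eq_two_mul_choose] at h1
    push_cast [Nat.cast_sub (show j ≤ n by lia)] at h1 h2
    have hne := natCast_ne_zero_of_lt (p := p) (Nat.succ_pos j) (by lia) (ZMod p)
    push_cast at hne
    refine mul_left_cancel₀ hne ?_
    rw [pow_succ, pow_succ]
    linear_combination (-(-1) ^ j) * h1 - 2 * (2 * j + 1) * ih (by lia) - 4 ^ j * 4 * h2 -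
      2 * 4 ^ j * (n.choose j : ZMod p) * hp

/-- `∑_{j=1}^{(p-1)/2} (-1)ʲ (2j choose j) / j²` vanishes modulo `p`. -/
lemma sum_neg_one_pow_mul_centralBinom_div_sq (hn : p = 2 * n + 1) (hp5 : 5 < p) :
    ∑ j ∈ Icc 1 n, (-1) ^ j * ((2 * j).choose j : ZMod p) * ((j : ZMod p) ^ 2)⁻¹ = 0 := by
  let K := AlgebraicClosure (ZMod p)
  have : CharP K p := charP_of_injective_algebraMap (algebraMap (ZMod p) K).injective p
  have h2 : (2 : K) ≠ 0 := by
    exact_mod_cast natCast_ne_zero_of_lt (p := p) (m := 2) (by lia) (by lia) K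
  have h3 : (3 : K) ≠ 0 := by
    exact_mod_cast natCast_ne_zero_of_lt (p := p) (m := 3) (by lia) (by lia) K
  have h5 : (5 : K) ≠ 0 := by
    exact_mod_cast natCast_ne_zero_of_lt (p := p) (m := 5) (by lia) (by lia) K
  obtain ⟨s, hs⟩ := IsAlgClosed.exists_pow_nat_eq (5 : K) (n := 2) (by lia)
  obtain ⟨φ, hφ⟩ : ∃ φ : K, φ ^ 2 = φ + 1 := by
    have hinv : (2 : K) * 2⁻¹ = 1 := mul_inv_cancel₀ h2
    refine ⟨(1 + s) * 2⁻¹, ?_⟩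
    linear_combination (2 : K)⁻¹ ^ 2 * hs + ((3 + s) * 2⁻¹ + 1) * hinv
  have hgold := finitePolylog_two_golden hn h2 h3 h5 hφ
  have heval := congrArg (Polynomial.eval φ) (binomialPolylog_two (K := K) hn h2 h3)
  rw [eval_binomialPolylog] at heval
  simp only [Polynomial.eval_mul, Polynomial.eval_add, eval_polylogPoly, Polynomial.eval_X,
    Polynomial.eval_sub, Polynomial.eval_one, hgold, mul_zero] at heval
  apply (algebraMap (ZMod p) K).injective
  rw [map_zero, ← heval, map_sum]
  refine sum_congr rfl fun j hj => ?_
  rw [mem_Icc] at hj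
  rw [neg_one_pow_mul_centralBinom hn hj.2]
  have hprod : φ * (1 - φ) = -1 := by linear_combination -hφ
  have h4 : (4 : K) ^ j = (-4) ^ j * (-1) ^ j := by rw [← mul_pow]; norm_num
  rw [hprod]
  simp only [map_mul, map_pow, map_inv₀, map_natCast, map_ofNat]
  rw [h4]
  ring

lemma exists_int_euler {E : ℕ → ℚ} (hE0 : E 0 = 1) (hEodd : ∀ n, Odd n → E n = 0)
    (hErec : ∀ n, 1 ≤ n →
      ∑ k ∈ range (n + 1), ((2 * n).choose (2 * k) : ℚ) * E (2 * k) = 0) (m : ℕ) :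
    ∃ a : ℤ, E m = a := by
  rcases Nat.even_or_odd' m with ⟨k, rfl | rfl⟩
  · induction k using Nat.strong_induction_on with
    | _ k ih =>
      rcases Nat.eq_zero_or_pos k with rfl | hk
      · exact ⟨1, by simpa using hE0⟩
      · have h := hErec k hk
        rw [sum_range_succ, Nat.choose_self, Nat.cast_one, one_mul] at h
        choose! a ha using ih
        refine ⟨-∑ i ∈ range k, ((2 * k).choose (2 * i) : ℤ) * a i, ?_⟩
        push_cast
        rw [eq_neg_of_add_eq_zero_right h]
        congr 1
        exact sum_congr rfl fun i hi => by rw [ha i (mem_range.mp hi)]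
  · exact ⟨0, by simpa using hEodd _ ⟨k, rfl⟩⟩

/-- The sum over `k` of the `j`-th terms of the Franel polynomials, modulo `p`. -/
lemma sum_choose_sq_mul_harmonic_mod (hn : p = 2 * n + 1) {h : ℕ → ZMod p}
    (hh : ∀ k < p, HasResidue p (H k) (h k)) {j : ℕ} (hj : j ∈ range p) :
    ∑ k ∈ Icc 1 (p - 1), (-1) ^ k * ((k.choose j : ZMod p) ^ 2 * ((2 * j).choose k : ZMod p)) *
        (k : ZMod p)⁻¹ * h k =
      if j ∈ Icc 1 n then (((2 * j).choose j : ZMod p) - 1) * ((j : ZMod p) ^ 2)⁻¹ else 0 := by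
  rw [mem_range] at hj
  split_ifs with hjn
  · rw [mem_Icc] at hjn
    have hid := sum_choose_sq_mul_H (M := p - 1) hjn.1 (by lia)
    refine HasResidue.unique (q := (((2 * j).choose j : ℚ) - 1) / j ^ 2) ?_ ?_
    · rw [← hid]
      refine HasResidue.sum fun k hk => ?_
      have hk' := cast_ne_zero_of_mem_Icc (p := p) (ZMod p) hk
      rw [mem_Icc] at hk
      rw [div_eq_mul_inv]
      have hneg : HasResidue p (-1) (-1) := by simpa using HasResidue.intCast (p := p) (-1)
      exact (((hneg.pow k).mul (((HasResidue.natCast _).pow 2).mul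
        (HasResidue.natCast _))).mul (HasResidue.inv_natCast hk')).mul (hh k (by lia))
    · rw [div_eq_mul_inv]
      have hj0 : ((j ^ 2 : ℕ) : ZMod p) ≠ 0 := by
        rw [Nat.cast_pow]
        exact pow_ne_zero _ (natCast_ne_zero_of_lt hjn.1 (by lia) _)
      have hinv := HasResidue.inv_natCast hj0
      push_cast at hinv
      have hone : HasResidue p 1 1 := by simpa using HasResidue.natCast (p := p) 1
      exact ((HasResidue.natCast _).sub hone).mul hinv
  · refine sum_eq_zero fun k hk => ?_
    rw [mem_Icc] at hk hjn
    rcases lt_or_ge k j with hkj | hkj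
    · simp [Nat.choose_eq_zero_of_lt hkj]
    · rcases Nat.eq_zero_or_pos j with rfl | hj0
      · simp [Nat.choose_eq_zero_of_lt hk.1]
      · rcases lt_or_ge (2 * j) k with hk2 | hk2
        · simp [Nat.choose_eq_zero_of_lt hk2]
        · have hdvd : p ∣ (2 * j).choose j :=
            (Fact.out : p.Prime).dvd_choose hj (by lia) (by lia)
          have hc := congrArg (Nat.cast (R := ZMod p)) (Nat.choose_mul (n := 2 * j) (s := j) hkj)
          push_cast at hc
          rw [(CharP.cast_eq_zero_iff (ZMod p) p _).mpr hdvd, zero_mul] at hc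
          linear_combination ((-1) ^ k * (k.choose j : ZMod p) * (k : ZMod p)⁻¹ * h k) * hc

lemma franelPoly_neg_one_eq_sum {k : ℕ} (hk : k < p) :
    ((franelPoly (-1) k : ℤ) : ZMod p) = ∑ j ∈ range p,
      (k.choose j : ZMod p) ^ 2 * ((2 * j).choose k : ZMod p) * (-1) ^ j := by
  rw [franelPoly, ← sum_subset (range_subset_range.mpr (show k + 1 ≤ p by lia))]
  · push_cast
    rfl
  · intro j _ hj
    rw [mem_range] at hj
    simp [Nat.choose_eq_zero_of_lt (show k < j by lia)]

end Congruences

theorem sum_franel_harmonic (p : ℕ) [Fact p.Prime] (hp5 : 5 < p)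
    (E : ℕ → ℚ) (hE0 : E 0 = 1) (hEodd : ∀ n, Odd n → E n = 0)
    (hErec : ∀ n, 1 ≤ n →
      ∑ k ∈ Finset.range (n + 1), ((2 * n).choose (2 * k) : ℚ) * E (2 * k) = 0) :
    ratCongr p 1
      (∑ k ∈ Finset.Icc 1 (p - 1),
        ((-1 : ℚ) ^ k * (franelPoly (-1) k : ℚ) / (k : ℚ)) * H k)
      (-2 * (legendreSym p (-1) : ℚ) * E (p - 3)) := by
  obtain ⟨n, hn⟩ : ∃ n, p = 2 * n + 1 :=
    (Fact.out : p.Prime).odd_of_ne_two (by lia)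
  choose e he using exists_int_euler hE0 hEodd hErec
  have he0 : e 0 = 1 := by
    have := he 0
    rw [hE0] at this
    exact_mod_cast this.symm
  have heodd : ∀ m, Odd m → e m = 0 := fun m hm => by
    have := he m
    rw [hEodd m hm] at this
    exact_mod_cast this.symm
  have herec : ∀ m, 1 ≤ m →
      ∑ k ∈ Finset.range (m + 1), ((2 * m).choose (2 * k) : ℤ) * e (2 * k) = 0 := fun m hm => by
    have := hErec m hm
    simp only [he] at this
    exact_mod_cast this
  have hEuler := sum_neg_one_pow_inv_sq (e := fun m => (e m : ZMod p)) hn hp5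
    (by simp [he0]) (fun m hm => by simp [heodd m hm]) (fun m hm => by
      have := congrArg (Int.cast (R := ZMod p)) (herec m hm)
      push_cast at this
      exact this)
  obtain ⟨h, hh⟩ : ∃ h : ℕ → ZMod p, ∀ k < p, HasResidue p (H k) (h k) :=
    ⟨_, fun k hk => hasResidue_H hk⟩
  have hneg : HasResidue p (-1) (-1) := by simpa using HasResidue.intCast (p := p) (-1)
  refine HasResidue.ratCongr_of_eq (z := -2 * (-1) ^ n * (e (p - 3) : ZMod p)) ?_ ?_
  · have hsum : HasResidue p
        (∑ k ∈ Finset.Icc 1 (p - 1), ((-1 : ℚ) ^ k * (franelPoly (-1) k : ℚ) / (k : ℚ)) * H k)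
        (∑ k ∈ Finset.Icc 1 (p - 1),
          ((-1) ^ k * ((franelPoly (-1) k : ℤ) : ZMod p) * (k : ZMod p)⁻¹) * h k) := by
      refine HasResidue.sum fun k hk => ?_
      have hk' := cast_ne_zero_of_mem_Icc (p := p) (ZMod p) hk
      rw [Finset.mem_Icc] at hk
      rw [div_eq_mul_inv]
      exact (((hneg.pow k).mul (HasResidue.intCast _)).mul
        (HasResidue.inv_natCast hk')).mul (hh k (by lia))
    convert hsum using 1
    have hswap : ∑ k ∈ Finset.Icc 1 (p - 1),
          ((-1) ^ k * ((franelPoly (-1) k : ℤ) : ZMod p) * (k : ZMod p)⁻¹) * h k =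
        ∑ j ∈ Finset.range p, (-1) ^ j * ∑ k ∈ Finset.Icc 1 (p - 1),
          (-1) ^ k * ((k.choose j : ZMod p) ^ 2 * ((2 * j).choose k : ZMod p)) *
            (k : ZMod p)⁻¹ * h k := by
      simp only [Finset.mul_sum]
      rw [Finset.sum_comm]
      refine Finset.sum_congr rfl fun k hk => ?_
      rw [Finset.mem_Icc] at hk
      rw [franelPoly_neg_one_eq_sum (show k < p by lia), Finset.mul_sum, Finset.sum_mul,
        Finset.sum_mul]
      exact Finset.sum_congr rfl fun j _ => by ring
    have hcentral := sum_neg_one_pow_mul_centralBinom_div_sq hn hp5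
    have hIcc : (Finset.range p).filter (fun j => j ∈ Finset.Icc 1 n) = Finset.Icc 1 n := by
      ext j
      simp only [Finset.mem_filter, Finset.mem_range, Finset.mem_Icc]
      lia
    rw [hswap, Finset.sum_congr rfl fun j hj => by rw [sum_choose_sq_mul_harmonic_mod hn hh hj]]
    simp only [mul_ite, mul_zero]
    rw [← Finset.sum_filter, hIcc]
    simp only [sub_mul, mul_sub, one_mul, Finset.sum_sub_distrib, ← mul_assoc]
    rw [hcentral, hEuler]
    ring
  · have hleg : ((legendreSym p (-1) : ℤ) : ZMod p) = (-1) ^ n := by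
      rw [legendreSym.eq_pow, show p / 2 = n by lia]
      simp
    have htwo : HasResidue p (-2) (-2) := by simpa using HasResidue.intCast (p := p) (-2)
    rw [← hleg, he]
    exact (htwo.mul (HasResidue.intCast _)).mul (HasResidue.intCast _)
end

section
/- Let p > 3 be a prime. Then ∑_{k=0}^{p-1} (3k+1)·f_k/8^k ≡ p² − 2p³·q_p(2) + 4p⁴·q_p(2)² (mod p⁵). -/
/-- The Franel numbers `f n = ∑_{k=0}^n (n choose k)³`. -/
def franel (n : ℕ) : ℤ := ∑ k ∈ Finset.range (n + 1), (n.choose k : ℤ) ^ 3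

/-- The Fermat quotient `q_p(a) = (a^{p-1} - 1)/p`. -/
def fermatQuot (p : ℕ) (a : ℤ) : ℚ := ((a : ℚ) ^ (p - 1) - 1) / (p : ℚ)

open Finset

theorem franel_recurrence (n : ℕ) :
    ((n : ℚ) + 2) ^ 2 * franel (n + 2) - (7 * n ^ 2 + 21 * n + 16) * franel (n + 1)
      - 8 * ((n : ℚ) + 1) ^ 2 * franel n = 0 := by
  have hn1 : (n : ℚ) + 1 ≠ 0 := by positivity
  have hn2 : (n : ℚ) + 2 ≠ 0 := by positivity
  have choose_one (k : ℕ) (hk : k ≤ n + 2) :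
      ((n + 1).choose k : ℚ) = ((n : ℚ) + 2 - k) * (n + 2).choose k / (n + 2) := by
    have h := Nat.choose_mul_succ_eq (n + 1) k
    have h' : ((n + 1).choose k : ℚ) * (n + 2) = (n + 2).choose k * ((n : ℚ) + 2 - k) := by
      have := congrArg (Nat.cast : ℕ → ℚ) h
      push_cast [Nat.cast_sub (show k ≤ n + 1 + 1 from hk)] at this
      linear_combination this
    field_simp
    linear_combination h'
  have choose_zero (k : ℕ) (hk : k ≤ n + 2) :
      (n.choose k : ℚ) =
        ((n : ℚ) + 1 - k) * ((n : ℚ) + 2 - k) * (n + 2).choose k / ((n + 1) * (n + 2)) := by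
    rcases hk.lt_or_eq with hk | rfl
    · have h := Nat.choose_mul_succ_eq n k
      have h' : (n.choose k : ℚ) * (n + 1) = (n + 1).choose k * ((n : ℚ) + 1 - k) := by
        have := congrArg (Nat.cast : ℕ → ℚ) h
        push_cast [Nat.cast_sub (show k ≤ n + 1 by omega)] at this
        linear_combination this
      rw [choose_one k hk.le] at h'
      field_simp at h' ⊢
      linear_combination h'
    · rw [Nat.choose_eq_zero_of_lt (by omega)]
      push_cast
      ring
  have hf2 : (franel (n + 2) : ℚ) = ∑ k ∈ range (n + 3), ((n + 2).choose k : ℚ) ^ 3 := by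
    simp [franel]
  have hf1 : (franel (n + 1) : ℚ) = ∑ k ∈ range (n + 3), ((n + 1).choose k : ℚ) ^ 3 := by
    rw [sum_range_succ, Nat.choose_succ_self]
    simp [franel]
  have hf0 : (franel n : ℚ) = ∑ k ∈ range (n + 3), (n.choose k : ℚ) ^ 3 := by
    rw [sum_range_succ, sum_range_succ, Nat.choose_succ_self,
      Nat.choose_eq_zero_of_lt (by omega : n < n + 2)]
    simp [franel]
  have key : ∀ K ≤ n + 3, ∑ k ∈ range K, (((n : ℚ) + 2) ^ 2 * ((n + 2).choose k : ℚ) ^ 3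
      - (7 * n ^ 2 + 21 * n + 16) * ((n + 1).choose k : ℚ) ^ 3
      - 8 * ((n : ℚ) + 1) ^ 2 * (n.choose k : ℚ) ^ 3)
      = (K : ℚ) ^ 3 * (4 * K ^ 3 - (30 + 18 * n) * K ^ 2 + (78 + 93 * n + 27 * n ^ 2) * K
          - (72 + 128 * n + 74 * n ^ 2 + 14 * n ^ 3)) * ((n + 2).choose K : ℚ) ^ 3
        / ((n + 1) * (n + 2) ^ 3) := by
    intro K hK
    induction K with
    | zero => simp
    | succ K ih =>
      rw [sum_range_succ, ih (by omega), choose_one K (by omega), choose_zero K (by omega)]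
      have h := congrArg (Nat.cast : ℕ → ℚ) (Nat.choose_succ_right_eq (n + 2) K)
      push_cast [Nat.cast_sub (show K ≤ n + 2 by omega)] at h
      have hc : ((n + 2).choose (K + 1) : ℚ) = (n + 2).choose K * (n + 2 - K) / (K + 1) := by
        rw [eq_div_iff (by positivity), h]
      rw [hc]
      have hK1 : (K : ℚ) + 1 ≠ 0 := by positivity
      push_cast
      field_simp
      ring
  have := key (n + 3) le_rfl
  rw [Nat.choose_succ_self] at this
  rw [hf2, hf1, hf0, mul_sum, mul_sum, mul_sum, ← sum_sub_distrib, ← sum_sub_distrib, this]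
  simp

/-- The summand `(n choose k) (n + 2k)! / (n! k!²) (-4)^(n-k)` of an alternative expression for
the Franel numbers. -/
def franelTerm (n k : ℕ) : ℚ :=
  n.choose k * (n + 2 * k).factorial / (n.factorial * k.factorial ^ 2) * (-4) ^ n / (-4) ^ k

theorem franelTerm_succ_left (n k : ℕ) (hk : k ≤ n + 1) :
    ((n : ℚ) + 1 - k) * franelTerm (n + 1) k = -4 * (n + 2 * k + 1) * franelTerm n k := by
  have h := congrArg (Nat.cast : ℕ → ℚ) (Nat.choose_mul_succ_eq n k)
  push_cast [Nat.cast_sub hk] at h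
  have hf : ((n + 1 + 2 * k).factorial : ℚ) = (n + 2 * k + 1) * (n + 2 * k).factorial := by
    rw [show n + 1 + 2 * k = n + 2 * k + 1 by ring, Nat.factorial_succ]
    push_cast
    ring
  have h1 : (n.factorial : ℚ) ≠ 0 := by positivity
  have h2 : (k.factorial : ℚ) ≠ 0 := by positivity
  have h3 : (n : ℚ) + 1 ≠ 0 := by positivity
  unfold franelTerm
  rw [hf, Nat.factorial_succ n, pow_succ (-4 : ℚ) n]
  push_cast
  generalize (-4 : ℚ) ^ n = a
  generalize (-4 : ℚ) ^ k = b
  field_simp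
  linear_combination a / b * h

theorem franelTerm_succ_right (n k : ℕ) (hk : k ≤ n) :
    -4 * ((k : ℚ) + 1) ^ 3 * franelTerm n (k + 1)
      = (n - k) * (n + 2 * k + 1) * (n + 2 * k + 2) * franelTerm n k := by
  have h := congrArg (Nat.cast : ℕ → ℚ) (Nat.choose_succ_right_eq n k)
  push_cast [Nat.cast_sub hk] at h
  have hf : ((n + 2 * (k + 1)).factorial : ℚ)
      = (n + 2 * k + 2) * (n + 2 * k + 1) * (n + 2 * k).factorial := by
    rw [show n + 2 * (k + 1) = n + 2 * k + 1 + 1 by ring, Nat.factorial_succ, Nat.factorial_succ]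
    push_cast
    ring
  have h1 : (n.factorial : ℚ) ≠ 0 := by positivity
  have h2 : (k.factorial : ℚ) ≠ 0 := by positivity
  have h3 : (k : ℚ) + 1 ≠ 0 := by positivity
  unfold franelTerm
  rw [hf, Nat.factorial_succ k, pow_succ (-4 : ℚ) k]
  push_cast
  generalize (-4 : ℚ) ^ n = a
  generalize (-4 : ℚ) ^ k = b
  field_simp
  linear_combination a / b * h

theorem franelTerm_eq_zero {n k : ℕ} (h : n < k) : franelTerm n k = 0 := by
  simp [franelTerm, Nat.choose_eq_zero_of_lt h]

theorem franelTerm_sum_recurrence (n : ℕ) :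
    ((n : ℚ) + 2) ^ 2 * ∑ k ∈ range (n + 3), franelTerm (n + 2) k
      - (7 * n ^ 2 + 21 * n + 16) * ∑ k ∈ range (n + 2), franelTerm (n + 1) k
      - 8 * ((n : ℚ) + 1) ^ 2 * ∑ k ∈ range (n + 1), franelTerm n k = 0 := by
  have e1 : ∑ k ∈ range (n + 2), franelTerm (n + 1) k
      = ∑ k ∈ range (n + 3), franelTerm (n + 1) k := by
    rw [sum_range_succ _ (n + 2), franelTerm_eq_zero (by omega), add_zero]
  have e0 : ∑ k ∈ range (n + 1), franelTerm n k = ∑ k ∈ range (n + 3), franelTerm n k := by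
    rw [sum_range_succ _ (n + 2), sum_range_succ _ (n + 1), franelTerm_eq_zero (by omega),
      franelTerm_eq_zero (by omega), add_zero, add_zero]
  have key : ∀ K ≤ n + 3, ∑ k ∈ range K, (((n : ℚ) + 2) ^ 2 * franelTerm (n + 2) k
      - (7 * n ^ 2 + 21 * n + 16) * franelTerm (n + 1) k
      - 8 * ((n : ℚ) + 1) ^ 2 * franelTerm n k)
      = -(K : ℚ) ^ 3 * (9 * n + 15) * franelTerm (n + 2) K / ((n + 2 * K + 1) * (n + 2 * K + 2)) := by
    intro K hK
    induction K with
    | zero => simp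
    | succ K ih =>
      rw [sum_range_succ, ih (by omega)]
      have p1 : (n : ℚ) + 2 * K + 1 ≠ 0 := by positivity
      have p2 : (n : ℚ) + 2 * K + 2 ≠ 0 := by positivity
      have p3 : (n : ℚ) + 2 * K + 3 ≠ 0 := by positivity
      have p4 : (n : ℚ) + 2 * K + 4 ≠ 0 := by positivity
      have r := franelTerm_succ_right (n + 2) K (by omega)
      have l1 := franelTerm_succ_left (n + 1) K (by omega)
      push_cast at r l1
      have v1 : franelTerm (n + 1) K
          = (n + 2 - K) * franelTerm (n + 2) K / (-4 * (n + 2 * K + 2)) := by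
        rw [eq_div_iff (by simpa using p2)]
        linear_combination -l1
      have v0 : franelTerm n K = (n + 1 - K) * (n + 2 - K) * franelTerm (n + 2) K
          / (16 * (n + 2 * K + 1) * (n + 2 * K + 2)) := by
        rcases (show K ≤ n + 2 by omega).lt_or_eq with h | rfl
        · have l0 := franelTerm_succ_left n K (by omega)
          rw [v1] at l0
          field_simp at l0 ⊢
          linear_combination l0
        · rw [franelTerm_eq_zero (by omega)]
          push_cast
          ring
      have vr : ((K : ℚ) + 1) ^ 3 * franelTerm (n + 2) (K + 1)
          = -(n + 2 - K) * (n + 2 * K + 3) * (n + 2 * K + 4) * franelTerm (n + 2) K / 4 := by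
        linear_combination -r / 4
      rw [v1, v0]
      push_cast
      rw [show -((K : ℚ) + 1) ^ 3 * (9 * n + 15) * franelTerm (n + 2) (K + 1)
        = -(9 * n + 15) * (((K : ℚ) + 1) ^ 3 * franelTerm (n + 2) (K + 1)) by ring, vr]
      have p3' : (n : ℚ) + 2 * (K + 1) + 1 ≠ 0 := by positivity
      have p4' : (n : ℚ) + 2 * (K + 1) + 2 ≠ 0 := by positivity
      field_simp
      ring
  rw [e1, e0, mul_sum, mul_sum, mul_sum, ← sum_sub_distrib, ← sum_sub_distrib, key _ le_rfl,
    franelTerm_eq_zero (by omega)]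
  simp

theorem franel_eq_sum (n : ℕ) : (franel n : ℚ) = ∑ k ∈ range (n + 1), franelTerm n k := by
  induction n using Nat.twoStepInduction with
  | zero => simp [franel, franelTerm]
  | one => norm_num [franel, franelTerm, sum_range_succ, Nat.factorial]
  | more n h0 h1 =>
    have hf := franel_recurrence n
    have hg := franelTerm_sum_recurrence n
    rw [h0, h1] at hf
    have hn : ((n : ℚ) + 2) ^ 2 ≠ 0 := by positivity
    refine mul_left_cancel₀ hn ?_
    linear_combination hf - hg

theorem sum_franel_eq (n : ℕ) :
    ∑ k ∈ range n, (3 * (k : ℚ) + 1) * (franel k : ℚ) / 8 ^ k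
      = -2 * (-1 / 2) ^ n * ∑ k ∈ range n, (n - k) * (franelTerm n k / (-4) ^ n) := by
  induction n with
  | zero => simp
  | succ n ih =>
    rw [sum_range_succ, ih, franel_eq_sum]
    have e : ∑ k ∈ range n, ((n : ℚ) - k) * (franelTerm n k / (-4) ^ n)
        = ∑ k ∈ range (n + 1), ((n : ℚ) - k) * (franelTerm n k / (-4) ^ n) := by
      rw [sum_range_succ]
      simp
    have h8 : (8 : ℚ) ^ n = (-1 / 2 : ℚ)⁻¹ ^ n * (-4) ^ n := by
      rw [← mul_pow]
      norm_num
    rw [e, h8, mul_sum, mul_sum, mul_sum, sum_div, ← sum_add_distrib]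
    refine sum_congr rfl fun k hk => ?_
    have hk' := mem_range.mp hk
    have l := franelTerm_succ_left n k (by omega)
    have l' : ((n : ℚ) + 1 - k) * (franelTerm (n + 1) k / (-4) ^ (n + 1))
        = (n + 2 * k + 1) * franelTerm n k / (-4) ^ n := by
      rw [pow_succ]
      field_simp
      linear_combination -l
    push_cast
    rw [l', pow_succ (-1 / 2 : ℚ), inv_pow]
    field_simp
    ring

/-- The rising factorial `a (a + 1) ⋯ (a + k - 1)`. -/
def risingFact (a : ℚ) (k : ℕ) : ℚ := ∏ i ∈ range k, (a + i)

@[simp] theorem risingFact_zero (a : ℚ) : risingFact a 0 = 1 := by simp [risingFact]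

theorem risingFact_succ (a : ℚ) (k : ℕ) :
    risingFact a (k + 1) = risingFact a k * (a + k) := prod_range_succ _ _

theorem risingFact_add (a : ℚ) (j k : ℕ) :
    risingFact a (j + k) = risingFact a j * risingFact (a + j) k := by
  rw [risingFact, prod_range_add, risingFact, risingFact]
  congr 1
  refine prod_congr rfl fun i _ => ?_
  push_cast
  ring

theorem risingFact_succ' (a : ℚ) (k : ℕ) :
    risingFact a (k + 1) = a * risingFact (a + 1) k := by
  rw [add_comm k 1, risingFact_add]
  simp [risingFact]

theorem risingFact_ne_zero {a : ℚ} (h : ∀ i : ℕ, a + i ≠ 0) (k : ℕ) : risingFact a k ≠ 0 :=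
  prod_ne_zero_iff.mpr fun i _ => h i

theorem risingFact_one (k : ℕ) : risingFact 1 k = k.factorial := by
  induction k with
  | zero => simp
  | succ k ih =>
    rw [risingFact_succ, ih, Nat.factorial_succ]
    push_cast
    ring

theorem risingFact_neg_natCast (N k : ℕ) :
    risingFact (-N) k = (-1) ^ k * k.factorial * N.choose k := by
  induction k with
  | zero => simp
  | succ k ih =>
    have h : (N.choose (k + 1) : ℚ) * (k + 1) = N.choose k * (N - k) := by
      rcases le_or_gt k N with hk | hk
      · have := congrArg (Nat.cast : ℕ → ℚ) (Nat.choose_succ_right_eq N k)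
        push_cast [Nat.cast_sub hk] at this
        exact this
      · simp [Nat.choose_eq_zero_of_lt hk, Nat.choose_eq_zero_of_lt (hk.trans (Nat.lt_succ_self k))]
    rw [risingFact_succ, ih, Nat.factorial_succ, pow_succ]
    push_cast
    linear_combination (-1) ^ k * (k.factorial : ℚ) * h

theorem risingFact_reflect (a : ℚ) (k : ℕ) :
    risingFact a k = (-1) ^ k * risingFact (1 - a - k) k := by
  rw [risingFact, ← prod_range_reflect, risingFact, ← card_range k, ← prod_const, card_range,
    ← prod_mul_distrib]
  refine prod_congr rfl fun i hi => ?_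
  have := mem_range.mp hi
  rw [Nat.sub_sub, Nat.cast_sub (by omega)]
  push_cast
  ring

theorem risingFact_sub (a : ℚ) {N j : ℕ} (hj : j ≤ N) :
    risingFact a (N - j) * ((-1) ^ j * risingFact (1 - a - N) j) = risingFact a N := by
  conv_rhs => rw [← Nat.sub_add_cancel hj, risingFact_add, risingFact_reflect _ j]
  rw [Nat.cast_sub hj]
  congr 3
  ring

/-- The Chu–Vandermonde identity. -/
theorem sum_choose_risingFact (N : ℕ) : ∀ {a d : ℚ}, (∀ i : ℕ, d + i ≠ 0) →
    ∑ k ∈ range (N + 1), (-1) ^ k * N.choose k * risingFact a k / risingFact d k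
      = risingFact (d - a) N / risingFact d N := by
  induction N with
  | zero => simp
  | succ N ih =>
    intro a d hd
    have hd1 : ∀ i : ℕ, d + 1 + i ≠ 0 := fun i => by
      have := hd (i + 1)
      push_cast at this
      rwa [add_assoc, add_comm (1 : ℚ)]
    have hd0 : d ≠ 0 := by simpa using hd 0
    have e : ∑ k ∈ range (N + 1 + 1),
          (-1) ^ k * ((N + 1).choose k : ℚ) * risingFact a k / risingFact d k
        = ∑ k ∈ range (N + 1), (-1) ^ k * (N.choose k : ℚ) * risingFact a k / risingFact d k
          - a / d * ∑ k ∈ range (N + 1), (-1) ^ k * (N.choose k : ℚ) * risingFact (a + 1) k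
            / risingFact (d + 1) k := by
      have z : ∑ k ∈ range (N + 1), (-1) ^ k * (N.choose k : ℚ) * risingFact a k / risingFact d k
          = ∑ k ∈ range (N + 1 + 1), (-1) ^ k * (N.choose k : ℚ) * risingFact a k
            / risingFact d k := by
        rw [sum_range_succ _ (N + 1), Nat.choose_succ_self]
        simp
      rw [z, sum_range_succ', sum_range_succ' _ (N + 1), mul_sum, add_sub_right_comm,
        ← sum_sub_distrib]
      congr 1
      · refine sum_congr rfl fun k _ => ?_
        rw [Nat.choose_succ_succ, risingFact_succ', risingFact_succ' d, pow_succ]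
        have := risingFact_ne_zero hd1 k
        push_cast
        field_simp
        ring
      · simp
    rw [e, ih hd, ih hd1, show d + 1 - (a + 1) = d - a by ring, risingFact_succ (d - a)]
    have h1 := risingFact_ne_zero hd N
    have h2 := risingFact_ne_zero hd1 N
    have h3 := risingFact_succ d N
    have h4 := risingFact_succ' d N
    have h5 := hd N
    have h6 : risingFact (d + 1) N = risingFact d N * (d + N) / d := by
      rw [eq_div_iff hd0]
      linear_combination h3 - h4
    rw [h3, h6]
    field_simp
    ring

/-- A transformation of terminating `₃F₂` series at unit argument. -/
theorem sum_choose_risingFact_transform (N : ℕ) {a b d e : ℚ} (hd : ∀ i : ℕ, d + i ≠ 0)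
    (he : ∀ i : ℕ, e + i ≠ 0) :
    ∑ k ∈ range (N + 1), (-1) ^ k * N.choose k * risingFact a k * risingFact b k
        / (risingFact d k * risingFact e k)
      = ∑ j ∈ range (N + 1), N.choose j * risingFact a j * risingFact (e - b) j
        * risingFact (d - a) (N - j) / (risingFact e j * risingFact d N) := by
  have expand (k : ℕ) (hk : k ∈ range (N + 1)) :
      (-1) ^ k * (N.choose k : ℚ) * risingFact a k * risingFact b k
        / (risingFact d k * risingFact e k)
      = ∑ j ∈ range (N + 1), (-1) ^ k * (N.choose k : ℚ) * risingFact a k / risingFact d k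
        * ((-1) ^ j * k.choose j * risingFact (e - b) j / risingFact e j) := by
    have hv := sum_choose_risingFact k (a := e - b) he
    rw [sub_sub_cancel] at hv
    have hk' := mem_range.mp hk
    rw [← mul_sum, show N + 1 = k + 1 + (N - k) by omega, sum_range_add, hv]
    rw [sum_eq_zero (s := range (N - k))]
    · rw [add_zero, div_mul_div_comm]
    · intro i _
      rw [Nat.choose_eq_zero_of_lt (by omega)]
      simp
  rw [sum_congr rfl expand, sum_comm]
  refine sum_congr rfl fun j hj => ?_
  have hj' := mem_range.mp hj
  have hdj : ∀ i : ℕ, d + j + i ≠ 0 := fun i => by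
    have := hd (j + i)
    push_cast at this
    rwa [add_assoc]
  have hv := sum_choose_risingFact (N - j) (a := a + j) hdj
  rw [add_sub_add_right_eq_sub] at hv
  have split : risingFact d N = risingFact d j * risingFact (d + j) (N - j) := by
    rw [← risingFact_add, Nat.add_sub_cancel' (by omega)]
  rw [show N + 1 = j + (N - j + 1) by omega, sum_range_add, sum_eq_zero (s := range j), zero_add]
  · have h1 := risingFact_ne_zero hd j
    have h2 := risingFact_ne_zero hdj (N - j)
    have h3 := risingFact_ne_zero he j
    trans (N.choose j : ℚ) * risingFact a j * risingFact (e - b) j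
      / (risingFact e j * risingFact d j) * ∑ k ∈ range (N - j + 1), (-1) ^ k * (N - j).choose k
        * risingFact (a + j) k / risingFact (d + j) k
    · rw [mul_sum]
      refine sum_congr rfl fun i hi => ?_
      have hi' := mem_range.mp hi
      have hc := congrArg (Nat.cast : ℕ → ℚ)
        (Nat.choose_mul (n := N) (k := j + i) (s := j) (by omega))
      push_cast at hc
      rw [Nat.add_sub_cancel_left] at hc
      have h4 := risingFact_ne_zero hdj i
      have hs : ((-1 : ℚ)) ^ j * (-1) ^ j = 1 := by
        rw [← mul_pow]
        simp
      rw [risingFact_add, risingFact_add, pow_add]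
      field_simp
      linear_combination risingFact a j * risingFact (e - b) j * risingFact (a + j) i
        * ((-1) ^ j * (-1) ^ j * hc + (N.choose j : ℚ) * (N - j).choose i * hs)
    · rw [hv, split]
      field_simp
  · intro k hk
    rw [Nat.choose_eq_zero_of_lt (mem_range.mp hk)]
    simp

theorem half_sub_add_ne_zero (m i : ℕ) : (3 / 2 - m + i : ℚ) ≠ 0 := by
  intro h
  have h' : (3 : ℚ) + 2 * i = 2 * m := by linear_combination 2 * h
  have : 3 + 2 * i = 2 * m := by exact_mod_cast h'
  omega

theorem natCast_succ_add_ne_zero (m i : ℕ) : (m + 1 + i : ℚ) ≠ 0 := by positivity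

theorem risingFact_three_halves (m : ℕ) :
    risingFact (3 / 2) m * (4 ^ m * m.factorial) = (2 * m + 1).factorial := by
  induction m with
  | zero => simp
  | succ m ih =>
    rw [risingFact_succ, show 2 * (m + 1) + 1 = 2 * m + 1 + 1 + 1 by ring,
      Nat.factorial_succ (2 * m + 1 + 1), Nat.factorial_succ (2 * m + 1), Nat.factorial_succ m,
      pow_succ]
    push_cast
    rw [← ih]
    ring

theorem factorial_add_two_mul (m k : ℕ) :
    ((2 * m + 1 + 2 * k).factorial : ℚ)
      = (2 * m + 1).factorial * 4 ^ k * risingFact (m + 1) k * risingFact (m + 3 / 2) k := by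
  induction k with
  | zero => simp
  | succ k ih =>
    rw [show 2 * m + 1 + 2 * (k + 1) = 2 * m + 1 + 2 * k + 1 + 1 by ring, Nat.factorial_succ,
      Nat.factorial_succ, risingFact_succ, risingFact_succ, pow_succ]
    push_cast
    rw [ih]
    ring

theorem natCast_sub_mul_franelTerm (m k : ℕ) (hk : k ≤ 2 * m) :
    (((2 * m + 1 : ℕ) : ℚ) - k) * (franelTerm (2 * m + 1) k / (-4) ^ (2 * m + 1))
      = (2 * m + 1) * ((-1) ^ k * (2 * m).choose k * risingFact (m + 3 / 2) k
        * risingFact (m + 1) k / (risingFact 1 k * risingFact 1 k)) := by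
  have h := congrArg (Nat.cast : ℕ → ℚ) (Nat.choose_mul_succ_eq (2 * m) k)
  push_cast [Nat.cast_sub (show k ≤ 2 * m + 1 by omega)] at h
  have h1 : ((2 * m + 1).factorial : ℚ) ≠ 0 := by positivity
  have h2 : (k.factorial : ℚ) ≠ 0 := by positivity
  have hs : (-1 : ℚ) ^ k * (-1) ^ k = 1 := by
    rw [← mul_pow]
    simp
  have h4 : (-4 : ℚ) ^ k = (-1) ^ k * 4 ^ k := by
    rw [← mul_pow]
    norm_num
  have hn : (-4 : ℚ) ^ (2 * m + 1) ≠ 0 := pow_ne_zero _ (by norm_num)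
  have hs' : (-1 : ℚ) ^ k ≠ 0 := by simp
  rw [franelTerm, factorial_add_two_mul, risingFact_one, h4]
  generalize (-4 : ℚ) ^ (2 * m + 1) = a at *
  generalize (-1 : ℚ) ^ k = s at *
  generalize risingFact (m + 1) k = x
  generalize risingFact (m + 3 / 2) k = y
  push_cast
  field_simp
  linear_combination x * y * (-h - (2 * m + 1) * (2 * m).choose k * hs)

theorem sum_choose_risingFact_eq (m : ℕ) :
    ∑ k ∈ range (2 * m + 1), (-1) ^ k * ((2 * m).choose k : ℚ) * risingFact (m + 3 / 2) k
        * risingFact (m + 1) k / (risingFact 1 k * risingFact 1 k)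
      = (2 * m + 1) * (-1) ^ m * (2 * m).choose m / 4 ^ m
        * ∑ k ∈ range (m + 1), (-1) ^ k * (m.choose k : ℚ) * risingFact (m + 3 / 2) k
          * risingFact (2 * m + 1) k / (k.factorial * risingFact (m + 1) k) := by
  have hd : ∀ i : ℕ, (1 : ℚ) + i ≠ 0 := fun i => by positivity
  have hh := half_sub_add_ne_zero m
  have hm := natCast_succ_add_ne_zero m
  rw [sum_choose_risingFact_transform _ hd hd, show 2 * m + 1 = m + 1 + m by ring, sum_range_add,
    sum_eq_zero (s := range m), add_zero]
  swap
  · intro i _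
    rw [show (1 : ℚ) - (m + 1) = -m by ring, risingFact_neg_natCast m,
      Nat.choose_eq_zero_of_lt (show m < m + 1 + i by omega)]
    simp
  have first : ∀ j ∈ range (m + 1), ((2 * m).choose j : ℚ) * risingFact (m + 3 / 2) j
      * risingFact (1 - (m + 1)) j * risingFact (1 - (m + 3 / 2)) (2 * m - j)
        / (risingFact 1 j * risingFact 1 (2 * m))
      = risingFact (-m - 1 / 2) (2 * m) / (2 * m).factorial
        * ((-1) ^ j * m.choose j * risingFact (m + 3 / 2) j * risingFact (-(2 * m : ℕ)) j
          / (risingFact (3 / 2 - m) j * risingFact 1 j)) := by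
    intro j hj
    have hj' := mem_range.mp hj
    have hs := risingFact_sub (1 - (m + 3 / 2)) (show j ≤ 2 * m by omega)
    rw [show (1 : ℚ) - (1 - (m + 3 / 2)) - (2 * m : ℕ) = 3 / 2 - m by push_cast; ring] at hs
    rw [show (-m - 1 / 2 : ℚ) = 1 - (m + 3 / 2) by ring, ← hs,
      show (1 : ℚ) - (m + 1) = -m by ring, risingFact_neg_natCast m, risingFact_neg_natCast,
      risingFact_one, risingFact_one]
    have h1 := risingFact_ne_zero hh j
    have hsq : ((-1 : ℚ) ^ j) ^ 2 = 1 := by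
      rw [← pow_mul, mul_comm j, pow_mul]
      simp
    generalize risingFact (3 / 2 - m) j = x at *
    field_simp
    rw [hsq, mul_one]
  rw [sum_congr rfl first, ← mul_sum, sum_choose_risingFact_transform _ hh hd]
  have second : ∀ j ∈ range (m + 1), (m.choose j : ℚ) * risingFact (m + 3 / 2) j
      * risingFact (1 - -(2 * m : ℕ)) j * risingFact (3 / 2 - m - (m + 3 / 2)) (m - j)
        / (risingFact 1 j * risingFact (3 / 2 - m) m)
      = risingFact (-(2 * m : ℕ)) m / risingFact (3 / 2 - m) m
        * ((-1) ^ j * (m.choose j : ℚ) * risingFact (m + 3 / 2) j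
          * risingFact (2 * m + 1) j / (j.factorial * risingFact (m + 1) j)) := by
    intro j hj
    have hj' := mem_range.mp hj
    have hs := risingFact_sub (-(2 * m : ℕ)) (show j ≤ m by omega)
    rw [show (1 : ℚ) - -(2 * m : ℕ) - m = m + 1 by push_cast; ring] at hs
    rw [← hs, show (3 / 2 - m - (m + 3 / 2) : ℚ) = -(2 * m : ℕ) by push_cast; ring,
      show (1 : ℚ) - -(2 * m : ℕ) = 2 * m + 1 by push_cast; ring, risingFact_one]
    have h1 := risingFact_ne_zero hm j
    have h2 := risingFact_ne_zero hh m
    field_simp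
    rw [← pow_mul, mul_comm j, pow_mul]
    simp
  rw [sum_congr rfl second, ← mul_sum, ← mul_assoc]
  congr 1
  have r1 : risingFact (-m - 1 / 2) (2 * m) = risingFact (3 / 2 - m) (2 * m) := by
    have e1 := risingFact_add (-m - 1 / 2) 2 (2 * m)
    have e2 := risingFact_add (-m - 1 / 2) (2 * m) 2
    rw [add_comm 2, e2] at e1
    have h2 : ∀ a : ℚ, risingFact a 2 = a * (a + 1) := fun a => by
      simp [risingFact, prod_range_succ]
    rw [h2, h2] at e1
    push_cast at e1
    have hne : (m - 1 / 2 : ℚ) * (m + 1 / 2) ≠ 0 := by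
      refine mul_ne_zero ?_ (by positivity)
      intro h
      have h' : (2 : ℚ) * m = 1 := by linear_combination 2 * h
      have : 2 * m = 1 := by exact_mod_cast h'
      omega
    rw [show (-m - 1 / 2 + 2 : ℚ) = 3 / 2 - m by ring] at e1
    refine mul_right_cancel₀ hne ?_
    linear_combination e1
  have r2 : risingFact (3 / 2 - m) (2 * m)
      = risingFact (3 / 2 - m) m * risingFact (3 / 2) m := by
    rw [two_mul, risingFact_add]
    congr 2
    ring
  have r3 := risingFact_three_halves m
  have hc := congrArg (Nat.cast : ℕ → ℚ)
    (Nat.choose_mul_factorial_mul_factorial (show m ≤ 2 * m by omega))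
  rw [show 2 * m - m = m by omega] at hc
  push_cast [Nat.factorial_succ] at hc r3
  have h2 := risingFact_ne_zero hh m
  have h3 : ((2 * m).factorial : ℚ) ≠ 0 := by positivity
  have h4 : (m.factorial : ℚ) ≠ 0 := by positivity
  have r4 : risingFact (3 / 2) m = (2 * m + 1) * (2 * m).factorial / (4 ^ m * m.factorial) := by
    rw [eq_div_iff (by positivity), r3]
  rw [r1, r2, r4, risingFact_neg_natCast]
  generalize risingFact (3 / 2 - m) m = x at *
  field_simp

theorem sum_franel_odd (m : ℕ) :
    ∑ k ∈ range (2 * m + 1), (3 * (k : ℚ) + 1) * (franel k : ℚ) / 8 ^ k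
      = (2 * m + 1) ^ 2 * (-1) ^ m * (2 * m).choose m / 16 ^ m
        * ∑ k ∈ range (m + 1), (-1) ^ k * (m.choose k : ℚ) * risingFact (m + 3 / 2) k
          * risingFact (2 * m + 1) k / (k.factorial * risingFact (m + 1) k) := by
  have h : (-2 : ℚ) * (-1 / 2) ^ (2 * m + 1) = 1 / 4 ^ m := by
    rw [pow_succ, pow_mul, ← one_div_pow]
    ring
  rw [sum_franel_eq, h, sum_congr rfl fun k hk =>
    natCast_sub_mul_franelTerm m k (Nat.lt_succ_iff.mp (mem_range.mp hk)), ← mul_sum,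
    sum_choose_risingFact_eq, show (16 : ℚ) = 4 * 4 by norm_num, mul_pow]
  field_simp

/-- The ring of `p`-integral rational numbers. -/
def padicIntegers (p : ℕ) [Fact p.Prime] : Subring ℚ where
  carrier := {x | padicNorm p x ≤ 1}
  mul_mem' {a b} ha hb := by
    simp only [Set.mem_ofPred_eq, padicNorm.mul] at *
    exact mul_le_one₀ ha (padicNorm.nonneg b) hb
  one_mem' := by simp
  add_mem' {a b} ha hb := padicNorm.nonarchimedean.trans (max_le ha hb)
  zero_mem' := by simp
  neg_mem' {a} ha := by simpa using ha

/-- Congruence of rational numbers modulo `p ^ e`. -/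
def PadicModEq (p : ℕ) [Fact p.Prime] (e : ℕ) (a b : ℚ) : Prop :=
  ∃ c ∈ padicIntegers p, a - b = p ^ e * c

section PadicModEq

variable {p : ℕ} [Fact p.Prime]

theorem inv_natCast_mem_padicIntegers {n : ℕ} (h : ¬ p ∣ n) : (n : ℚ)⁻¹ ∈ padicIntegers p := by
  change padicNorm p _ ≤ 1
  rw [inv_eq_one_div, padicNorm.div, (padicNorm.nat_eq_one_iff n).mpr h]
  simp

theorem inv_natCast_mem_of_lt {n : ℕ} (h0 : 0 < n) (h : n < p) : (n : ℚ)⁻¹ ∈ padicIntegers p :=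
  inv_natCast_mem_padicIntegers fun hd => absurd (Nat.le_of_dvd h0 hd) (by omega)

namespace PadicModEq

variable {e : ℕ} {a b c d : ℚ}

theorem refl (a : ℚ) : PadicModEq p e a a := ⟨0, zero_mem _, by simp⟩

theorem symm (h : PadicModEq p e a b) : PadicModEq p e b a := by
  obtain ⟨x, hx, h⟩ := h
  exact ⟨-x, neg_mem hx, by linear_combination -h⟩

theorem trans (h : PadicModEq p e a b) (h' : PadicModEq p e b c) : PadicModEq p e a c := by
  obtain ⟨x, hx, h⟩ := h
  obtain ⟨y, hy, h'⟩ := h'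
  exact ⟨x + y, add_mem hx hy, by linear_combination h + h'⟩

theorem add (h : PadicModEq p e a b) (h' : PadicModEq p e c d) :
    PadicModEq p e (a + c) (b + d) := by
  obtain ⟨x, hx, h⟩ := h
  obtain ⟨y, hy, h'⟩ := h'
  exact ⟨x + y, add_mem hx hy, by linear_combination h + h'⟩

theorem mul (h : PadicModEq p e a b) (h' : PadicModEq p e c d) (hb : b ∈ padicIntegers p)
    (hd : d ∈ padicIntegers p) : PadicModEq p e (a * c) (b * d) := by
  obtain ⟨x, hx, h⟩ := h
  obtain ⟨y, hy, h'⟩ := h'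
  refine ⟨x * d + b * y + p ^ e * x * y, ?_, ?_⟩
  · exact add_mem (add_mem (mul_mem hx hd) (mul_mem hb hy))
      (mul_mem (mul_mem (pow_mem (natCast_mem _ p) e) hx) hy)
  · rw [sub_eq_iff_eq_add] at h h'
    rw [h, h']
    ring

theorem mul_left (h : PadicModEq p e a b) (hc : c ∈ padicIntegers p) :
    PadicModEq p e (c * a) (c * b) := by
  obtain ⟨x, hx, h⟩ := h
  exact ⟨c * x, mul_mem hc hx, by linear_combination c * h⟩

theorem sub (h : PadicModEq p e a b) (h' : PadicModEq p e c d) :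
    PadicModEq p e (a - c) (b - d) := by
  obtain ⟨x, hx, h⟩ := h
  obtain ⟨y, hy, h'⟩ := h'
  exact ⟨x - y, sub_mem hx hy, by linear_combination h - h'⟩

theorem pow_mul (h : PadicModEq p e a b) (i : ℕ) :
    PadicModEq p (e + i) (p ^ i * a) (p ^ i * b) := by
  obtain ⟨x, hx, h⟩ := h
  exact ⟨x, hx, by rw [pow_add]; linear_combination (p : ℚ) ^ i * h⟩

theorem mono {i : ℕ} (h : PadicModEq p e a b) (hi : i ≤ e) : PadicModEq p i a b := by
  obtain ⟨x, hx, h⟩ := h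
  refine ⟨p ^ (e - i) * x, mul_mem (pow_mem (natCast_mem _ p) _) hx, ?_⟩
  rw [h, ← mul_assoc, ← pow_add, Nat.add_sub_cancel' hi]

theorem sum {ι : Type*} {s : Finset ι} {f g : ι → ℚ} (h : ∀ i ∈ s, PadicModEq p e (f i) (g i)) :
    PadicModEq p e (∑ i ∈ s, f i) (∑ i ∈ s, g i) := by
  choose! x hx h using h
  exact ⟨∑ i ∈ s, x i, sum_mem hx, by rw [← sum_sub_distrib, mul_sum, sum_congr rfl h]⟩

theorem inv_sub {a : ℚ} (ha : a⁻¹ ∈ padicIntegers p) (hb : (p - a)⁻¹ ∈ padicIntegers p)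
    (h0 : a ≠ 0) (h1 : p - a ≠ 0) : PadicModEq p 1 (p - a)⁻¹ (-a⁻¹) :=
  ⟨a⁻¹ * (p - a)⁻¹, mul_mem ha hb, by field_simp; ring⟩

theorem to_ratCongr (h : PadicModEq p e a b) : ratCongr p e a b := by
  obtain ⟨x, hx, h⟩ := h
  by_cases hab : a = b
  · exact Or.inl hab
  · right
    have hp : (p : ℚ) ≠ 0 := by exact_mod_cast (Fact.out : p.Prime).ne_zero
    have hx0 : x ≠ 0 := by
      rintro rfl
      exact hab (sub_eq_zero.mp (by simpa using h))
    have hv : 0 ≤ padicValRat p x := by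
      have hx' : padicNorm p x ≤ 1 := hx
      rw [padicNorm.eq_zpow_of_nonzero hx0] at hx'
      have h1 : (1 : ℚ) < p := by exact_mod_cast (Fact.out : p.Prime).one_lt
      have := (zpow_le_one_iff_right₀ h1).mp hx'
      omega
    rw [h, padicValRat.mul (pow_ne_zero _ hp) hx0, padicValRat.pow,
      padicValRat.self (Fact.out : p.Prime).one_lt]
    omega

end PadicModEq

end PadicModEq

theorem sum_range_two_mul (f : ℕ → ℚ) (m : ℕ) :
    ∑ i ∈ range (2 * m), f i = ∑ i ∈ range m, f (2 * i) + ∑ i ∈ range m, f (2 * i + 1) := by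
  induction m with
  | zero => simp
  | succ m ih =>
    rw [show 2 * (m + 1) = 2 * m + 1 + 1 by ring, sum_range_succ, sum_range_succ, ih,
      sum_range_succ, sum_range_succ]
    ring

/-- The second order harmonic numbers. -/
def harmonicTwo (n : ℕ) : ℚ := ∑ i ∈ range n, (((i + 1 : ℕ) : ℚ)⁻¹) ^ 2

/-- The sums of the reciprocals of the first odd numbers. -/
def oddHarmonic (n : ℕ) : ℚ := ∑ i ∈ range n, (((2 * i + 1 : ℕ) : ℚ)⁻¹)

theorem harmonicTwo_succ (n : ℕ) :
    harmonicTwo (n + 1) = harmonicTwo n + (((n + 1 : ℕ) : ℚ)⁻¹) ^ 2 := sum_range_succ _ _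

theorem oddHarmonic_succ (n : ℕ) :
    oddHarmonic (n + 1) = oddHarmonic n + ((2 * n + 1 : ℕ) : ℚ)⁻¹ := sum_range_succ _ _

theorem harmonic_two_mul (n : ℕ) : harmonic (2 * n) = oddHarmonic n + 2⁻¹ * harmonic n := by
  rw [harmonic, sum_range_two_mul, oddHarmonic, harmonic, mul_sum]
  congr 1
  refine sum_congr rfl fun i _ => ?_
  push_cast
  rw [← mul_inv]
  ring

theorem sum_harmonic_mul_inv (n : ℕ) :
    ∑ i ∈ range n, harmonic i * ((i + 1 : ℕ) : ℚ)⁻¹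
      = 2⁻¹ * (harmonic n ^ 2 - harmonicTwo n) := by
  induction n with
  | zero => simp [harmonicTwo]
  | succ n ih =>
    rw [sum_range_succ, ih, harmonic_succ, harmonicTwo_succ]
    ring

section HalfPrime

variable {p m : ℕ} [Fact p.Prime]

theorem inv_two_mem (hpm : p = 2 * m + 1) : (2 : ℚ)⁻¹ ∈ padicIntegers p := by
  have hp := (Fact.out : p.Prime).two_le
  exact_mod_cast inv_natCast_mem_of_lt (n := 2) (p := p) (by omega) (by omega)

theorem harmonic_mem (hpm : p = 2 * m + 1) {k : ℕ} (hk : k ≤ 2 * m) :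
    harmonic k ∈ padicIntegers p :=
  sum_mem fun i hi => by
    have := mem_range.mp hi
    exact inv_natCast_mem_of_lt (by omega) (by omega)

theorem harmonicTwo_mem (hpm : p = 2 * m + 1) {k : ℕ} (hk : k ≤ 2 * m) :
    harmonicTwo k ∈ padicIntegers p :=
  sum_mem fun i hi => by
    have := mem_range.mp hi
    exact pow_mem (inv_natCast_mem_of_lt (by omega) (by omega)) 2

theorem oddHarmonic_mem (hpm : p = 2 * m + 1) {k : ℕ} (hk : k ≤ m) :
    oddHarmonic k ∈ padicIntegers p :=
  sum_mem fun i hi => by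
    have := mem_range.mp hi
    exact inv_natCast_mem_of_lt (by omega) (by omega)

theorem inv_sub_modEq {a b : ℕ} (ha : 0 < a) (hb : 0 < b) (h : a + b = p) :
    PadicModEq p 1 (b : ℚ)⁻¹ (-(a : ℚ)⁻¹) := by
  have e : (b : ℚ) = p - a := by
    rw [← h]
    push_cast
    ring
  rw [e]
  refine PadicModEq.inv_sub (inv_natCast_mem_of_lt ha (by omega)) ?_ (by positivity) ?_
  · rw [← e]
    exact inv_natCast_mem_of_lt hb (by omega)
  · rw [← e]
    positivity

theorem PadicModEq.sq {e : ℕ} {a b : ℚ} (h : PadicModEq p e a b) (hb : b ∈ padicIntegers p) :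
    PadicModEq p e (a ^ 2) (b ^ 2) := by
  rw [pow_two, pow_two]
  exact h.mul h hb hb

theorem harmonicTwo_two_mul_modEq (hpm : p = 2 * m + 1) :
    PadicModEq p 1 (harmonicTwo (2 * m)) (2 * harmonicTwo m) := by
  have h : harmonicTwo (2 * m)
      = harmonicTwo m + ∑ i ∈ range m, (((m + (m - 1 - i) + 1 : ℕ) : ℚ)⁻¹) ^ 2 := by
    have e : ∑ i ∈ range m, (((m + i + 1 : ℕ) : ℚ)⁻¹) ^ 2
        = ∑ i ∈ range m, (((m + (m - 1 - i) + 1 : ℕ) : ℚ)⁻¹) ^ 2 :=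
      (sum_range_reflect (fun i => (((m + i + 1 : ℕ) : ℚ)⁻¹) ^ 2) m).symm
    rw [harmonicTwo, two_mul, sum_range_add, e]
    rfl
  rw [h, two_mul]
  refine (PadicModEq.refl _).add (PadicModEq.sum fun i hi => ?_)
  have hi' := mem_range.mp hi
  rw [← neg_sq (((i + 1 : ℕ) : ℚ)⁻¹)]
  exact (inv_sub_modEq (by omega) (by omega) (by omega)).sq
    (neg_mem (inv_natCast_mem_of_lt (by omega) (by omega)))

theorem harmonicTwo_modEq_zero (hp3 : 3 < p) (hpm : p = 2 * m + 1) :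
    PadicModEq p 1 (harmonicTwo m) 0 := by
  have h : harmonicTwo (2 * m)
      = ∑ i ∈ range m, (((2 * (m - 1 - i) + 1 : ℕ) : ℚ)⁻¹) ^ 2
        + ∑ i ∈ range m, (2⁻¹ * ((i + 1 : ℕ) : ℚ)⁻¹) ^ 2 := by
    rw [harmonicTwo, sum_range_two_mul,
      sum_range_reflect (fun i => (((2 * i + 1 : ℕ) : ℚ)⁻¹) ^ 2)]
    congr 1
    refine sum_congr rfl fun i _ => ?_
    rw [← mul_inv]
    push_cast
    ring
  have h2 : PadicModEq p 1 (harmonicTwo (2 * m)) (2⁻¹ * harmonicTwo m) := by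
    have e : 2⁻¹ * harmonicTwo m = ∑ i ∈ range m, (-(2⁻¹ * ((i + 1 : ℕ) : ℚ)⁻¹)) ^ 2
        + ∑ i ∈ range m, (2⁻¹ * ((i + 1 : ℕ) : ℚ)⁻¹) ^ 2 := by
      rw [harmonicTwo, ← sum_add_distrib, mul_sum]
      refine sum_congr rfl fun i _ => ?_
      ring
    rw [h, e]
    refine PadicModEq.add (PadicModEq.sum fun i hi => ?_) (PadicModEq.refl _)
    have hi' := mem_range.mp hi
    rw [show (2⁻¹ * ((i + 1 : ℕ) : ℚ)⁻¹) = ((2 * (i + 1) : ℕ) : ℚ)⁻¹ by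
      rw [← mul_inv]; push_cast; rfl]
    exact (inv_sub_modEq (by omega) (by omega) (by omega)).sq
      (neg_mem (inv_natCast_mem_of_lt (by omega) (by omega)))
  have h3 := ((harmonicTwo_two_mul_modEq hpm).symm.trans h2).sub
    (PadicModEq.refl (2⁻¹ * harmonicTwo m))
  have hthird : (3 : ℚ)⁻¹ ∈ padicIntegers p := by
    exact_mod_cast inv_natCast_mem_of_lt (n := 3) (p := p) (by omega) (by omega)
  have h4 := h3.mul_left (mul_mem (ofNat_mem _ 2) hthird)
  rw [sub_self, mul_zero] at h4
  convert h4 using 1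
  ring

theorem harmonic_two_mul_modEq_zero (hp3 : 3 < p) (hpm : p = 2 * m + 1) :
    PadicModEq p 2 (harmonic (2 * m)) 0 := by
  have h : harmonic (2 * m) = (p : ℚ) ^ 1 *
      ∑ i ∈ range m, ((i + 1 : ℕ) : ℚ)⁻¹ * ((m + (m - 1 - i) + 1 : ℕ) : ℚ)⁻¹ := by
    have e : ∑ i ∈ range m, ((m + i + 1 : ℕ) : ℚ)⁻¹
        = ∑ i ∈ range m, ((m + (m - 1 - i) + 1 : ℕ) : ℚ)⁻¹ :=
      (sum_range_reflect (fun i => ((m + i + 1 : ℕ) : ℚ)⁻¹) m).symm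
    rw [harmonic, two_mul, sum_range_add, e, ← sum_add_distrib, mul_sum]
    refine sum_congr rfl fun i hi => ?_
    have hi' := mem_range.mp hi
    have hc : (p : ℚ) = (i + 1 : ℕ) + (m + (m - 1 - i) + 1 : ℕ) := by
      rw [← Nat.cast_add]
      congr 1
      omega
    have h1 : ((i + 1 : ℕ) : ℚ) ≠ 0 := by positivity
    have h2 : ((m + (m - 1 - i) + 1 : ℕ) : ℚ) ≠ 0 := by positivity
    rw [hc]
    generalize ((i + 1 : ℕ) : ℚ) = x at *
    generalize ((m + (m - 1 - i) + 1 : ℕ) : ℚ) = y at *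
    field_simp
    ring
  have hs : PadicModEq p 1
      (∑ i ∈ range m, ((i + 1 : ℕ) : ℚ)⁻¹ * ((m + (m - 1 - i) + 1 : ℕ) : ℚ)⁻¹)
      (∑ i ∈ range m, ((i + 1 : ℕ) : ℚ)⁻¹ * -((i + 1 : ℕ) : ℚ)⁻¹) := by
    refine PadicModEq.sum fun i hi => ?_
    have hi' := mem_range.mp hi
    exact (inv_sub_modEq (by omega) (by omega) (by omega)).mul_left
      (inv_natCast_mem_of_lt (by omega) (by omega))
  have e : ∑ i ∈ range m, ((i + 1 : ℕ) : ℚ)⁻¹ * -((i + 1 : ℕ) : ℚ)⁻¹ = 0 - harmonicTwo m := by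
    rw [harmonicTwo, zero_sub, ← sum_neg_distrib]
    exact sum_congr rfl fun i _ => by ring
  rw [e] at hs
  have := (hs.trans ((PadicModEq.refl 0).sub (harmonicTwo_modEq_zero hp3 hpm))).pow_mul 1
  rwa [← h, sub_zero, mul_zero] at this

theorem sum_oddHarmonic_mul_inv_modEq_zero (hp3 : 3 < p) (hpm : p = 2 * m + 1) :
    PadicModEq p 1 (∑ k ∈ range m, oddHarmonic (k + 1) * ((k + 1 : ℕ) : ℚ)⁻¹) 0 := by
  set S := ∑ k ∈ range m, oddHarmonic (k + 1) * ((k + 1 : ℕ) : ℚ)⁻¹ with hS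
  have h1 : S = ∑ k ∈ range m, ∑ a ∈ range (k + 1),
      ((2 * a + 1 : ℕ) : ℚ)⁻¹ * ((2 * (k - a) + 1 : ℕ) : ℚ)⁻¹ := by
    refine sum_congr rfl fun k _ => ?_
    have e : ∑ a ∈ range (k + 1), ((2 * (k - a) + 1 : ℕ) : ℚ)⁻¹ = oddHarmonic (k + 1) := by
      rw [oddHarmonic, ← sum_range_reflect]
      refine sum_congr rfl fun a ha => ?_
      have ha' := mem_range.mp ha
      rw [show k - (k + 1 - 1 - a) = a by omega]
    have e2 : oddHarmonic (k + 1) * ((k + 1 : ℕ) : ℚ)⁻¹ = (∑ a ∈ range (k + 1),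
        (((2 * a + 1 : ℕ) : ℚ)⁻¹ + ((2 * (k - a) + 1 : ℕ) : ℚ)⁻¹))
          * (2⁻¹ * ((k + 1 : ℕ) : ℚ)⁻¹) := by
      rw [sum_add_distrib, e, ← oddHarmonic]
      ring
    rw [e2, sum_mul]
    refine sum_congr rfl fun a ha => ?_
    have ha' := mem_range.mp ha
    have hc : 2 * ((k + 1 : ℕ) : ℚ) = (2 * a + 1 : ℕ) + (2 * (k - a) + 1 : ℕ) := by
      rw [← Nat.cast_add, ← Nat.cast_ofNat, ← Nat.cast_mul]
      congr 1
      omega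
    have h1 : ((2 * a + 1 : ℕ) : ℚ) ≠ 0 := by positivity
    have h2 : ((2 * (k - a) + 1 : ℕ) : ℚ) ≠ 0 := by positivity
    have h3 : ((2 * a + 1 : ℕ) : ℚ) + (2 * (k - a) + 1 : ℕ) ≠ 0 := by positivity
    rw [← mul_inv, hc]
    generalize ((2 * a + 1 : ℕ) : ℚ) = x at *
    generalize ((2 * (k - a) + 1 : ℕ) : ℚ) = y at *
    field_simp
    ring
  have h2 : S = ∑ a ∈ range m, ∑ k ∈ Ico a m,
      ((2 * a + 1 : ℕ) : ℚ)⁻¹ * ((k + 1 : ℕ) : ℚ)⁻¹ := by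
    rw [hS, sum_congr rfl fun k _ => by rw [oddHarmonic, sum_mul]]
    refine sum_comm' fun k a => ?_
    simp only [mem_range, mem_Ico]
    omega
  have h3 : S = ∑ a ∈ range m, ∑ k ∈ Ico a m,
      ((2 * a + 1 : ℕ) : ℚ)⁻¹ * ((2 * (m - 1 - k) + 1 : ℕ) : ℚ)⁻¹ := by
    rw [h1]
    trans ∑ a ∈ range m, ∑ k ∈ Ico a m,
      ((2 * a + 1 : ℕ) : ℚ)⁻¹ * ((2 * (k - a) + 1 : ℕ) : ℚ)⁻¹
    · refine sum_comm' fun k a => ?_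
      simp only [mem_range, mem_Ico]
      omega
    · refine sum_congr rfl fun a ha => ?_
      have ha' := mem_range.mp ha
      refine sum_nbij' (fun k => m - 1 + a - k) (fun k => m - 1 + a - k) ?_ ?_ ?_ ?_ ?_ <;>
        intro k hk <;> rw [mem_Ico] at hk
      · rw [mem_Ico]
        omega
      · rw [mem_Ico]
        omega
      · omega
      · omega
      · rw [show m - 1 - (m - 1 + a - k) = k - a by omega]
  have h4 : PadicModEq p 1 S (-(2⁻¹ * S)) := by
    have e : -(2⁻¹ * S) = ∑ a ∈ range m, ∑ k ∈ Ico a m,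
        ((2 * a + 1 : ℕ) : ℚ)⁻¹ * -((2 * (k + 1) : ℕ) : ℚ)⁻¹ := by
      rw [h2, mul_sum, ← sum_neg_distrib]
      refine sum_congr rfl fun a _ => ?_
      rw [mul_sum, ← sum_neg_distrib]
      refine sum_congr rfl fun k _ => ?_
      rw [Nat.cast_mul 2 (k + 1), mul_inv]
      push_cast
      ring
    rw [e]
    nth_rw 1 [h3]
    refine PadicModEq.sum fun a ha => PadicModEq.sum fun k hk => ?_
    have ha' := mem_range.mp ha
    have hk' := mem_Ico.mp hk
    exact (inv_sub_modEq (by omega) (by omega) (by omega)).mul_left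
      (inv_natCast_mem_of_lt (by omega) (by omega))
  have hthird : (3 : ℚ)⁻¹ ∈ padicIntegers p := by
    exact_mod_cast inv_natCast_mem_of_lt (n := 3) (p := p) (by omega) (by omega)
  have h5 := (h4.add (PadicModEq.refl (2⁻¹ * S))).mul_left (mul_mem (ofNat_mem _ 2) hthird)
  rw [neg_add_cancel, mul_zero] at h5
  convert h5 using 1
  ring

end HalfPrime

theorem natCast_succ_mul_choose_eq (n k : ℕ) :
    ((n + 1).choose (k + 1) : ℚ) = (n + 1) * (((k + 1 : ℕ) : ℚ)⁻¹ * n.choose k) := by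
  have h : ((n + 1 : ℕ) : ℚ) * n.choose k = (n + 1).choose (k + 1) * (k + 1 : ℕ) := by
    exact_mod_cast Nat.add_one_mul_choose_eq n k
  have h0 : ((k + 1 : ℕ) : ℚ) ≠ 0 := by positivity
  rw [mul_left_comm, ← Nat.cast_succ, h]
  field_simp

theorem two_mul_two_pow_sub_one_eq {p m : ℕ} (hpm : p = 2 * m + 1) :
    2 * ((2 : ℚ) ^ (2 * m) - 1)
      = p ^ 1 * ∑ j ∈ range (2 * m), ((j + 1 : ℕ) : ℚ)⁻¹ * (2 * m).choose j := by
  have h : (2 : ℚ) ^ (2 * m + 1)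
      = ∑ j ∈ range (2 * m + 1 + 1), ((2 * m + 1).choose j : ℚ) := by
    exact_mod_cast (Nat.sum_range_choose (2 * m + 1)).symm
  rw [sum_range_succ, sum_range_succ', Nat.choose_self, Nat.choose_zero_right] at h
  rw [mul_sub, mul_comm, ← pow_succ, h, mul_sum, hpm]
  have e : ∀ j ∈ range (2 * m), ((2 * m + 1).choose (j + 1) : ℚ)
      = (2 * m + 1 : ℕ) ^ 1 * (((j + 1 : ℕ) : ℚ)⁻¹ * (2 * m).choose j) := fun j _ => by
    rw [natCast_succ_mul_choose_eq, pow_one, Nat.cast_succ (2 * m)]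
  rw [sum_congr rfl e]
  push_cast
  ring

section HalfPrimeExpansions

variable {p m : ℕ} [Fact p.Prime]

theorem neg_one_pow_mul_choose_modEq (hpm : p = 2 * m + 1) {k : ℕ} (hk : k ≤ 2 * m) :
    PadicModEq p 3 ((-1) ^ k * ((2 * m).choose k : ℚ))
      (1 - p * harmonic k + p ^ 2 * (2⁻¹ * (harmonic k ^ 2 - harmonicTwo k))) := by
  induction k with
  | zero => simpa [harmonicTwo] using PadicModEq.refl (1 : ℚ)
  | succ k ih =>
    have hH := harmonic_mem hpm (show k ≤ 2 * m by omega)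
    have hH2 := harmonicTwo_mem hpm (show k ≤ 2 * m by omega)
    have ha : ((k + 1 : ℕ) : ℚ)⁻¹ ∈ padicIntegers p := inv_natCast_mem_of_lt (by omega) (by omega)
    have h2 := inv_two_mem hpm
    have hp : (p : ℚ) ∈ padicIntegers p := natCast_mem _ p
    have hc : (-1) ^ (k + 1) * ((2 * m).choose (k + 1) : ℚ)
        = (1 - p * ((k + 1 : ℕ) : ℚ)⁻¹) * ((-1) ^ k * ((2 * m).choose k : ℚ)) := by
      have h : ((2 * m).choose (k + 1) : ℚ) * (k + 1 : ℕ) = (2 * m).choose k * (2 * m - k) := by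
        have := Nat.choose_succ_right_eq (2 * m) k
        rw [← Nat.cast_mul, this, Nat.cast_mul, Nat.cast_sub (by omega)]
        push_cast
        ring
      have h0 : ((k + 1 : ℕ) : ℚ) ≠ 0 := by positivity
      rw [hpm]
      field_simp
      rw [pow_succ]
      push_cast at h ⊢
      linear_combination -(-1) ^ k * h
    rw [hc]
    refine ((ih (by omega)).mul_left
      (sub_mem (one_mem _) (mul_mem hp ha))).trans ⟨-((k + 1 : ℕ) : ℚ)⁻¹ *
        (2⁻¹ * (harmonic k ^ 2 - harmonicTwo k)), ?_, ?_⟩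
    · exact mul_mem (neg_mem ha) (mul_mem h2 (sub_mem (pow_mem hH 2) hH2))
    · rw [harmonic_succ, harmonicTwo_succ]
      ring

theorem neg_one_pow_mul_choose_modEq_sq (hpm : p = 2 * m + 1) {k : ℕ} (hk : k ≤ 2 * m) :
    PadicModEq p 2 ((-1) ^ k * ((2 * m).choose k : ℚ)) (1 - p * harmonic k) :=
  ((neg_one_pow_mul_choose_modEq hpm hk).mono (by omega)).trans
    ⟨2⁻¹ * (harmonic k ^ 2 - harmonicTwo k),
      mul_mem (inv_two_mem hpm) (sub_mem (pow_mem (harmonic_mem hpm hk) 2)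
        (harmonicTwo_mem hpm hk)), by ring⟩

theorem central_choose_modEq (hp3 : 3 < p) (hpm : p = 2 * m + 1) :
    PadicModEq p 3 ((-1) ^ m * ((2 * m).choose m : ℚ))
      (1 - p * harmonic m + p ^ 2 * (2⁻¹ * harmonic m ^ 2)) := by
  have h := ((harmonicTwo_modEq_zero hp3 hpm).mul_left (inv_two_mem hpm)).pow_mul 2
  refine (neg_one_pow_mul_choose_modEq hpm (by omega)).trans ?_
  convert (PadicModEq.refl (1 - p * harmonic m + p ^ 2 * (2⁻¹ * harmonic m ^ 2))).sub h using 1 <;>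
    ring

theorem sum_alternating_inv (m : ℕ) :
    ∑ j ∈ range (2 * m), (-1) ^ j * ((j + 1 : ℕ) : ℚ)⁻¹ = harmonic (2 * m) - harmonic m := by
  have h : ∑ i ∈ range m, (-1) ^ (2 * i + 1) * ((2 * i + 1 + 1 : ℕ) : ℚ)⁻¹
      = -(2⁻¹ * harmonic m) := by
    rw [harmonic, mul_sum, ← sum_neg_distrib]
    refine sum_congr rfl fun i _ => ?_
    rw [pow_succ, pow_mul, ← mul_inv]
    push_cast
    ring
  rw [sum_range_two_mul, h, harmonic_two_mul, oddHarmonic]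
  simp only [pow_mul, neg_one_sq, one_pow, one_mul]
  ring

theorem sum_harmonic_odd_mul_inv (m : ℕ) :
    ∑ i ∈ range m, harmonic (2 * i + 1) * ((2 * i + 1 + 1 : ℕ) : ℚ)⁻¹
      = 2⁻¹ * ∑ k ∈ range m, oddHarmonic (k + 1) * ((k + 1 : ℕ) : ℚ)⁻¹
        + 2⁻¹ ^ 3 * (harmonic m ^ 2 - harmonicTwo m) := by
  have h : (2⁻¹ : ℚ) ^ 3 * (harmonic m ^ 2 - harmonicTwo m)
      = 2⁻¹ ^ 2 * (2⁻¹ * (harmonic m ^ 2 - harmonicTwo m)) := by ring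
  rw [h, ← sum_harmonic_mul_inv, mul_sum, mul_sum, ← sum_add_distrib]
  refine sum_congr rfl fun i _ => ?_
  have e : ((2 * i + 1 + 1 : ℕ) : ℚ)⁻¹ = 2⁻¹ * ((i + 1 : ℕ) : ℚ)⁻¹ := by
    rw [← mul_inv]
    push_cast
    ring
  rw [harmonic_succ, harmonic_two_mul, oddHarmonic_succ, e]
  ring

theorem sum_alternating_harmonic_mul_inv (m : ℕ) :
    ∑ j ∈ range (2 * m), (-1) ^ j * (harmonic j * ((j + 1 : ℕ) : ℚ)⁻¹)
      = 2⁻¹ * (harmonic (2 * m) ^ 2 - harmonicTwo (2 * m))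
        - ∑ k ∈ range m, oddHarmonic (k + 1) * ((k + 1 : ℕ) : ℚ)⁻¹
        - 2⁻¹ ^ 2 * (harmonic m ^ 2 - harmonicTwo m) := by
  have h := sum_harmonic_mul_inv (2 * m)
  rw [sum_range_two_mul] at h
  have h' := sum_harmonic_odd_mul_inv m
  rw [sum_range_two_mul]
  simp only [pow_succ (-1 : ℚ) (2 * _), pow_mul, neg_one_sq, one_pow, one_mul, neg_mul,
    sum_neg_distrib]
  linear_combination h - 2 * h'

theorem sum_alternating_harmonic_mul_inv_modEq (hp3 : 3 < p) (hpm : p = 2 * m + 1) :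
    PadicModEq p 1 (∑ j ∈ range (2 * m), (-1) ^ j * (harmonic j * ((j + 1 : ℕ) : ℚ)⁻¹))
      (-(2⁻¹ ^ 2 * harmonic m ^ 2)) := by
  have h2 := inv_two_mem hpm
  have hH2 := harmonicTwo_modEq_zero hp3 hpm
  have h1 := (((harmonic_two_mul_modEq_zero hp3 hpm).mono (i := 1) (by omega)).sq
    (zero_mem _)).sub ((harmonicTwo_two_mul_modEq hpm).trans (hH2.mul_left (ofNat_mem _ 2)))
  have h := ((h1.mul_left h2).sub (sum_oddHarmonic_mul_inv_modEq_zero hp3 hpm)).sub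
    (((PadicModEq.refl (harmonic m ^ 2)).sub hH2).mul_left (pow_mem h2 2))
  rw [sum_alternating_harmonic_mul_inv]
  convert h using 1
  ring

theorem two_mul_two_pow_sub_one_modEq (hp3 : 3 < p) (hpm : p = 2 * m + 1) :
    PadicModEq p 3 (2 * ((2 : ℚ) ^ (2 * m) - 1))
      (-(p * harmonic m) + p ^ 2 * (2⁻¹ ^ 2 * harmonic m ^ 2)) := by
  have h : PadicModEq p 2 (∑ j ∈ range (2 * m), ((j + 1 : ℕ) : ℚ)⁻¹ * (2 * m).choose j)
      (∑ j ∈ range (2 * m), ((j + 1 : ℕ) : ℚ)⁻¹ * ((-1) ^ j * (1 - p * harmonic j))) := by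
    refine PadicModEq.sum fun j hj => PadicModEq.mul_left ?_ ?_
    · have hj' := mem_range.mp hj
      have := (neg_one_pow_mul_choose_modEq_sq hpm (show j ≤ 2 * m by omega)).mul_left
        (c := (-1) ^ j) (pow_mem (neg_mem (one_mem _)) j)
      rwa [← mul_assoc, ← mul_pow, neg_one_mul, neg_neg, one_pow, one_mul] at this
    · have hj' := mem_range.mp hj
      exact inv_natCast_mem_of_lt (by omega) (by omega)
  have e : ∑ j ∈ range (2 * m), ((j + 1 : ℕ) : ℚ)⁻¹ * ((-1) ^ j * (1 - p * harmonic j))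
      = harmonic (2 * m) - harmonic m
        - p ^ 1 * ∑ j ∈ range (2 * m), (-1) ^ j * (harmonic j * ((j + 1 : ℕ) : ℚ)⁻¹) := by
    rw [← sum_alternating_inv, mul_sum, ← sum_sub_distrib]
    exact sum_congr rfl fun j _ => by ring
  rw [e] at h
  have h' := (h.trans (((harmonic_two_mul_modEq_zero hp3 hpm).sub (PadicModEq.refl _)).sub
    ((sum_alternating_harmonic_mul_inv_modEq hp3 hpm).pow_mul 1))).pow_mul 1
  rw [← two_mul_two_pow_sub_one_eq hpm] at h'
  convert h' using 1
  ring

/-- The summand of the terminating series that remains after factoring the weighted Franel sum. -/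
def reducedTerm (m k : ℕ) : ℚ :=
  (-1) ^ k * (m.choose k : ℚ) * risingFact (m + 3 / 2) k
    * risingFact (2 * m + 1) k / (k.factorial * risingFact (m + 1) k)

theorem reducedTerm_succ {k : ℕ} (hk : k ≤ m) :
    reducedTerm m (k + 1) = ((k + 1 : ℕ) : ℚ)⁻¹ * ((2 * m + 1 + k) *
      ((((2 * k + 1 : ℕ) : ℚ) - (2 * m + 1 : ℕ)) * ((2 * k + 1 : ℕ) + (2 * m + 1 : ℕ) : ℚ)⁻¹ *
        (1 + (2 * m + 1 : ℕ) * (2⁻¹ * ((k + 1 : ℕ) : ℚ)⁻¹))) * reducedTerm m k) := by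
  have h : ((m.choose (k + 1) : ℕ) : ℚ) = m.choose k * (m - k) * (k + 1 : ℚ)⁻¹ := by
    have h := Nat.choose_succ_right_eq m k
    have h' : (m.choose (k + 1) : ℚ) * (k + 1) = m.choose k * (m - k) := by
      rw [← Nat.cast_sub hk]
      exact_mod_cast h
    rw [← h']
    field_simp
  have h1 : (k.factorial : ℚ) ≠ 0 := by positivity
  have h2 : risingFact (m + 1) k ≠ 0 := risingFact_ne_zero (natCast_succ_add_ne_zero m) k
  have h3 := natCast_succ_add_ne_zero m k
  rw [reducedTerm, reducedTerm, risingFact_succ, risingFact_succ, risingFact_succ,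
    Nat.factorial_succ, h, pow_succ]
  push_cast
  have h4 : (2 * k + 1 + (2 * m + 1) : ℚ) ≠ 0 := by positivity
  have h5 : (k + 1 : ℚ) ≠ 0 := by positivity
  field_simp
  ring

theorem one_add_mul_modEq {a b x y : ℚ} (ha : PadicModEq p 2 a (1 + p * x))
    (hb : PadicModEq p 2 b (1 + p * y)) (hx : x ∈ padicIntegers p) (hy : y ∈ padicIntegers p) :
    PadicModEq p 2 (a * b) (1 + p * (x + y)) := by
  have hp : (p : ℚ) ∈ padicIntegers p := natCast_mem _ p
  exact (ha.mul hb (add_mem (one_mem _) (mul_mem hp hx))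
    (add_mem (one_mem _) (mul_mem hp hy))).trans ⟨x * y, mul_mem hx hy, by ring⟩

theorem sub_mul_inv_add_modEq {q : ℕ} (h0 : 0 < q) (hq : q < p) :
    PadicModEq p 2 (((q : ℚ) - p) * (q + p : ℚ)⁻¹) (1 + p * (-2 * (q : ℚ)⁻¹)) := by
  have h1 : ((q + p : ℕ) : ℚ)⁻¹ ∈ padicIntegers p := inv_natCast_mem_padicIntegers fun h =>
    absurd (Nat.le_of_dvd h0 ((Nat.dvd_add_left dvd_rfl).mp h)) (by omega)
  have h2 := inv_natCast_mem_of_lt h0 hq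
  have h3 : (q : ℚ) ≠ 0 := by positivity
  have h4 : (q + p : ℚ) ≠ 0 := by positivity
  refine ⟨2 * (q : ℚ)⁻¹ * ((q + p : ℕ) : ℚ)⁻¹, mul_mem (mul_mem (ofNat_mem _ 2) h2) h1, ?_⟩
  push_cast
  field_simp
  ring

/-- The coefficient of `p` in the normalised summand `reducedTerm m (k + 1)`. -/
def reducedCoeff (k : ℕ) : ℚ :=
  -2 * oddHarmonic (k + 1) + 2⁻¹ * harmonic (k + 1) + harmonic k

theorem reducedCoeff_mem (hpm : p = 2 * m + 1) {k : ℕ} (hk : k < m) :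
    reducedCoeff k ∈ padicIntegers p :=
  add_mem (add_mem (mul_mem (neg_mem (ofNat_mem _ 2)) (oddHarmonic_mem hpm (by omega)))
    (mul_mem (inv_two_mem hpm) (harmonic_mem hpm (by omega)))) (harmonic_mem hpm (by omega))

theorem exists_reducedTerm_eq (hpm : p = 2 * m + 1) {k : ℕ} (hk : k < m) :
    ∃ v, reducedTerm m (k + 1) = p ^ 1 * (((k + 1 : ℕ) : ℚ)⁻¹ * v) ∧
      PadicModEq p 2 v (1 + p * reducedCoeff k) := by
  have h2 := inv_two_mem hpm
  have hinv : ((k + 1 : ℕ) : ℚ)⁻¹ ∈ padicIntegers p := inv_natCast_mem_of_lt (by omega) (by omega)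
  have hq : ((2 * k + 1 : ℕ) : ℚ)⁻¹ ∈ padicIntegers p :=
    inv_natCast_mem_of_lt (by omega) (by omega)
  have hfac := one_add_mul_modEq (sub_mul_inv_add_modEq (show 0 < 2 * k + 1 by omega)
    (show 2 * k + 1 < p by omega)) (PadicModEq.refl (1 + p * (2⁻¹ * ((k + 1 : ℕ) : ℚ)⁻¹)))
    (mul_mem (neg_mem (ofNat_mem _ 2)) hq) (mul_mem h2 hinv)
  have hterm := reducedTerm_succ hk.le
  rw [← hpm] at hterm
  have hpQ : (p : ℚ) = 2 * m + 1 := by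
    rw [hpm]
    push_cast
    rfl
  rw [← hpQ] at hterm
  cases k with
  | zero =>
    have hc : reducedCoeff 0 = -2 * ((2 * 0 + 1 : ℕ) : ℚ)⁻¹ + 2⁻¹ * ((0 + 1 : ℕ) : ℚ)⁻¹ := by
      simp [reducedCoeff, oddHarmonic, harmonic]
    rw [hc]
    refine ⟨_, ?_, hfac⟩
    rw [hterm]
    simp [reducedTerm]
  | succ k =>
    obtain ⟨v, hv, hmod⟩ := exists_reducedTerm_eq hpm (show k < m by omega)
    have hinv' : ((k + 1 : ℕ) : ℚ)⁻¹ ∈ padicIntegers p :=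
      inv_natCast_mem_of_lt (by omega) (by omega)
    have hstep := one_add_mul_modEq (one_add_mul_modEq hfac
      (PadicModEq.refl (1 + p * ((k + 1 : ℕ) : ℚ)⁻¹))
      (add_mem (mul_mem (neg_mem (ofNat_mem _ 2)) hq) (mul_mem h2 hinv)) hinv') hmod
      (add_mem (add_mem (mul_mem (neg_mem (ofNat_mem _ 2)) hq) (mul_mem h2 hinv)) hinv')
      (reducedCoeff_mem hpm (by omega))
    have hc : reducedCoeff (k + 1) = -2 * ((2 * (k + 1) + 1 : ℕ) : ℚ)⁻¹
        + 2⁻¹ * ((k + 1 + 1 : ℕ) : ℚ)⁻¹ + ((k + 1 : ℕ) : ℚ)⁻¹ + reducedCoeff k := by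
      rw [reducedCoeff, reducedCoeff, oddHarmonic_succ (k + 1), harmonic_succ (k + 1),
        harmonic_succ k]
      ring
    rw [hc]
    refine ⟨_, ?_, hstep⟩
    have h0 : ((k + 1 : ℕ) : ℚ) ≠ 0 := by positivity
    have h : (p : ℚ) + (k + 1 : ℕ) = (1 + p * ((k + 1 : ℕ) : ℚ)⁻¹) * (k + 1 : ℕ) := by
      field_simp
      ring
    rw [hterm, hv, h]
    field_simp

theorem sum_reducedCoeff_mul_inv (m : ℕ) :
    ∑ k ∈ range m, reducedCoeff k * ((k + 1 : ℕ) : ℚ)⁻¹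
      = -2 * ∑ k ∈ range m, oddHarmonic (k + 1) * ((k + 1 : ℕ) : ℚ)⁻¹
        + 2⁻¹ ^ 2 * (3 * harmonic m ^ 2 - harmonicTwo m) := by
  have h : (2⁻¹ : ℚ) ^ 2 * (3 * harmonic m ^ 2 - harmonicTwo m)
      = 2⁻¹ * 3 * (2⁻¹ * (harmonic m ^ 2 - harmonicTwo m)) + 2⁻¹ * harmonicTwo m := by ring
  rw [h, ← sum_harmonic_mul_inv, harmonicTwo, mul_sum, mul_sum, mul_sum, ← sum_add_distrib,
    ← sum_add_distrib]
  refine sum_congr rfl fun k _ => ?_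
  rw [reducedCoeff, harmonic_succ]
  ring

theorem sum_reducedTerm_modEq (hp3 : 3 < p) (hpm : p = 2 * m + 1) :
    PadicModEq p 3 (∑ k ∈ range (m + 1), reducedTerm m k)
      (1 + p * harmonic m + p ^ 2 * (3 * 2⁻¹ ^ 2 * harmonic m ^ 2)) := by
  have hs : PadicModEq p 3 (∑ k ∈ range m, reducedTerm m (k + 1))
      (∑ k ∈ range m, p ^ 1 * (((k + 1 : ℕ) : ℚ)⁻¹ * (1 + p * reducedCoeff k))) := by
    refine PadicModEq.sum fun k hk => ?_
    have hk' := mem_range.mp hk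
    obtain ⟨v, hv, hmod⟩ := exists_reducedTerm_eq hpm hk'
    rw [hv]
    exact (hmod.mul_left (inv_natCast_mem_of_lt (by omega) (by omega))).pow_mul 1
  have e : ∑ k ∈ range m, (p : ℚ) ^ 1 * (((k + 1 : ℕ) : ℚ)⁻¹ * (1 + p * reducedCoeff k))
      = p * harmonic m + p ^ 2 * ∑ k ∈ range m, reducedCoeff k * ((k + 1 : ℕ) : ℚ)⁻¹ := by
    rw [harmonic, mul_sum, mul_sum, ← sum_add_distrib]
    exact sum_congr rfl fun k _ => by ring
  have hw := (((sum_oddHarmonic_mul_inv_modEq_zero hp3 hpm).mul_left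
    (neg_mem (ofNat_mem _ 2))).add (((PadicModEq.refl (3 * harmonic m ^ 2)).sub
      (harmonicTwo_modEq_zero hp3 hpm)).mul_left (pow_mem (inv_two_mem hpm) 2))).pow_mul 2
  rw [← sum_reducedCoeff_mul_inv] at hw
  rw [e] at hs
  have h := (hs.trans ((PadicModEq.refl _).add hw)).add (PadicModEq.refl 1)
  rw [sum_range_succ']
  convert h using 1
  · simp [reducedTerm]
  · ring

theorem central_choose_mul_sum_modEq (hp3 : 3 < p) (hpm : p = 2 * m + 1) :
    PadicModEq p 3
      ((-1) ^ m * ((2 * m).choose m : ℚ) * ∑ k ∈ range (m + 1), reducedTerm m k)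
      ((1 + ((2 : ℚ) ^ (2 * m) - 1)) ^ 2 *
        (1 - 2 * ((2 : ℚ) ^ (2 * m) - 1) + 4 * ((2 : ℚ) ^ (2 * m) - 1) ^ 2)) := by
  have hH := harmonic_mem hpm (show m ≤ 2 * m by omega)
  have h2 := inv_two_mem hpm
  have hp : (p : ℚ) ∈ padicIntegers p := natCast_mem _ p
  have hM := central_choose_modEq hp3 hpm
  have hU := sum_reducedTerm_modEq hp3 hpm
  have hx := (two_mul_two_pow_sub_one_modEq hp3 hpm).mul_left h2
  rw [inv_mul_cancel_left₀ two_ne_zero] at hx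
  generalize (2 : ℚ) ^ (2 * m) - 1 = x at hx
  generalize harmonic m = H at hH hM hU hx
  set Y := -(2⁻¹ * H) + p * (2⁻¹ ^ 3 * H ^ 2) with hY
  have hYm : Y ∈ padicIntegers p := add_mem (neg_mem (mul_mem h2 hH))
    (mul_mem hp (mul_mem (pow_mem h2 3) (pow_mem hH 2)))
  have hX : PadicModEq p 3 x (p * Y) := by
    convert hx using 1
    ring
  have hXm : p * Y ∈ padicIntegers p := mul_mem hp hYm
  have hR := (((PadicModEq.refl 1).add hX).sq (add_mem (one_mem _) hXm)).mul
    (((PadicModEq.refl 1).sub (hX.mul_left (ofNat_mem _ 2))).add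
      ((hX.sq hXm).mul_left (ofNat_mem _ 4)))
    (pow_mem (add_mem (one_mem _) hXm) 2)
    (add_mem (sub_mem (one_mem _) (mul_mem (ofNat_mem _ 2) hXm))
      (mul_mem (ofNat_mem _ 4) (pow_mem hXm 2)))
  have hL := hM.mul hU
    (add_mem (sub_mem (one_mem _) (mul_mem hp hH))
      (mul_mem (pow_mem hp 2) (mul_mem h2 (pow_mem hH 2))))
    (add_mem (add_mem (one_mem _) (mul_mem hp hH))
      (mul_mem (pow_mem hp 2) (mul_mem (mul_mem (ofNat_mem _ 3) (pow_mem h2 2)) (pow_mem hH 2))))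
  refine (hL.trans ⟨-(2⁻¹ ^ 2 * H ^ 3) + 3 * 2⁻¹ ^ 3 * p * H ^ 4 + 2⁻¹ ^ 3 * H ^ 3
    - 2⁻¹ ^ 6 * p * H ^ 4 - 6 * Y ^ 3 - 4 * p * Y ^ 4, ?_, ?_⟩).trans hR.symm
  · exact sub_mem (sub_mem (sub_mem (add_mem (add_mem
      (neg_mem (mul_mem (pow_mem h2 2) (pow_mem hH 3)))
      (mul_mem (mul_mem (mul_mem (ofNat_mem _ 3) (pow_mem h2 3)) hp) (pow_mem hH 4)))
      (mul_mem (pow_mem h2 3) (pow_mem hH 3)))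
      (mul_mem (mul_mem (pow_mem h2 6) hp) (pow_mem hH 4)))
      (mul_mem (ofNat_mem _ 6) (pow_mem hYm 3)))
      (mul_mem (mul_mem (ofNat_mem _ 4) hp) (pow_mem hYm 4))
  · rw [hY]
    ring

theorem sum_franel_div_eight_pow_modEq (hp3 : 3 < p) (hpm : p = 2 * m + 1) :
    PadicModEq p 5 (∑ k ∈ range p, (3 * (k : ℚ) + 1) * (franel k : ℚ) / 8 ^ k)
      (p ^ 2 * (1 - 2 * ((2 : ℚ) ^ (2 * m) - 1) + 4 * ((2 : ℚ) ^ (2 * m) - 1) ^ 2)) := by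
  have h := ((central_choose_mul_sum_modEq hp3 hpm).mul_left
    (pow_mem (inv_two_mem hpm) (4 * m))).pow_mul 2
  have hpQ : (p : ℚ) = 2 * m + 1 := by
    rw [hpm]
    push_cast
    rfl
  have h16 : (16 : ℚ) ^ m = 2 ^ (4 * m) := by
    rw [pow_mul]
    norm_num
  have h2 : (2 : ℚ) ^ (4 * m) ≠ 0 := by positivity
  convert h using 1
  · rw [congrArg range hpm, sum_franel_odd, h16, hpQ, inv_pow]
    simp only [reducedTerm]
    field_simp
  · have e : (2 : ℚ)⁻¹ ^ (4 * m) * (1 + ((2 : ℚ) ^ (2 * m) - 1)) ^ 2 = 1 := by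
      rw [add_sub_cancel, ← pow_mul, show 2 * m * 2 = 4 * m by ring, ← mul_pow]
      norm_num
    rw [← mul_assoc (2⁻¹ ^ (4 * m)), e, one_mul]

end HalfPrimeExpansions

theorem sum_franel_div_8pow (p : ℕ) (hp : p.Prime) (hp3 : 3 < p) :
    ratCongr p 5
      (∑ k ∈ Finset.range p, (3 * (k : ℚ) + 1) * (franel k : ℚ) / 8 ^ k)
      ((p : ℚ) ^ 2 - 2 * (p : ℚ) ^ 3 * fermatQuot p 2
        + 4 * (p : ℚ) ^ 4 * fermatQuot p 2 ^ 2) := by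
  have : Fact p.Prime := ⟨hp⟩
  obtain ⟨m, hm⟩ := hp.odd_of_ne_two (by omega)
  have h0 : (p : ℚ) ≠ 0 := by exact_mod_cast hp.ne_zero
  have hq : p * fermatQuot p 2 = (2 : ℚ) ^ (2 * m) - 1 := by
    rw [fermatQuot, mul_div_cancel₀ _ h0, show p - 1 = 2 * m by omega]
    norm_cast
  have h := (sum_franel_div_eight_pow_modEq hp3 hm).to_ratCongr
  rw [← hq] at h
  convert h using 1
  ring
end

section
/- Let (x_k)_{k≥0} be a sequence in a commutative ring, and define X_n = ∑_{k=0}^n (n choose k)(n+k choose k)·x_k and y_n = ∑_{k=0}^n (n choose k)·x_k for all n ∈ ℕ. Then: (a) X_n = ∑_{k=0}^n (n choose k)(n+k choose k)·(−1)^{n−k}·y_k for every n ∈ ℕ; (b) for every positive integer n, ∑_{k=0}^{n-1} (2k+1)·X_k = (−1)^{n−1}·n·∑_{k=0}^{n-1} (n−1 choose k)(n+k choose k)·(−1)^k·y_k; and (c) for every positive integer n, ∑_{k=0}^{n-1} (2k+1)·(−1)^k·X_k = (−1)^{n−1}·n·∑_{k=0}^{n-1} (n−1 choose k)(n+k choose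 k)·x_k. -/
open Finset in
theorem sum_neg_one_pow_mul_choose_mul_choose_add (m j a : ℕ) :
    ∑ i ∈ range (m + 1), (-1 : ℤ) ^ (m - i) * (m.choose i : ℤ) * ((a + i).choose (m + j) : ℤ)
      = (a.choose j : ℤ) := by
  have h := congrFun (fwdDiff_iter_choose j m) a
  rw [fwdDiff_iter_eq_sum_shift] at h
  simpa using h

open Finset in
theorem sum_choose_mul_choose_mul_neg_one_pow_mul_choose {R : Type*} [CommRing R] {n j : ℕ}
    (hj : j ≤ n) :
    ∑ k ∈ range (n + 1),
        (n.choose k : R) * ((n + k).choose k : R) * (-1 : R) ^ (n - k) * (k.choose j : R)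
      = (n.choose j : R) * ((n + j).choose j : R) := by
  have key : ∑ k ∈ range (n + 1),
        (n.choose k : ℤ) * ((n + k).choose k : ℤ) * (-1 : ℤ) ^ (n - k) * (k.choose j : ℤ)
      = (n.choose j : ℤ) * ((n + j).choose j : ℤ) := by
    obtain ⟨m, rfl⟩ := Nat.exists_eq_add_of_le hj
    rw [add_assoc, sum_range_add, sum_eq_zero, zero_add,
      ← sum_neg_one_pow_mul_choose_mul_choose_add m j (j + m + j), mul_sum]
    · refine sum_congr rfl fun i hi ↦ ?_
      have hi' : i ≤ m := Nat.lt_succ_iff.mp (mem_range.mp hi)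
      have h1 : (j + m).choose (j + i) * (j + i).choose j = (j + m).choose j * m.choose i := by
        simpa using Nat.choose_mul (n := j + m) (k := j + i) (s := j) (by omega)
      have h2 : (j + m + (j + i)).choose (j + i) = (j + m + j + i).choose (m + j) := by
        rw [← Nat.choose_symm_add, add_assoc (j + m), add_comm m j]
      have h3 : j + m - (j + i) = m - i := by omega
      have h1' : ((j + m).choose (j + i) : ℤ) * ((j + i).choose j : ℤ)
          = ((j + m).choose j : ℤ) * (m.choose i : ℤ) := mod_cast h1
      rw [h2, h3]
      linear_combination ((j + m + j + i).choose (m + j) : ℤ) * (-1) ^ (m - i) * h1'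
    · intro k hk
      rw [Nat.choose_eq_zero_of_lt (mem_range.mp hk)]
      simp
  exact_mod_cast congrArg (Int.cast : ℤ → R) key

theorem succ_mul_choose_mul_choose_add (n j : ℕ) :
    (n + 2) * (n + 1).choose j * (n + 2 + j).choose j + (n + 1) * n.choose j * (n + 1 + j).choose j
      = (2 * (n + 1) + 1) * ((n + 1).choose j * (n + 1 + j).choose j) := by
  rcases lt_or_ge (n + 1) j with h | h
  · rw [Nat.choose_eq_zero_of_lt h, Nat.choose_eq_zero_of_lt (by omega : n < j)]
    simp
  · have h1 := Nat.choose_mul_succ_eq n j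
    have h2 := Nat.choose_mul_succ_eq (n + 1 + j) j
    obtain ⟨d, hd⟩ := Nat.exists_eq_add_of_le h
    rw [show n + 1 - j = d by omega] at h1
    rw [show n + 1 + j + 1 - j = n + 2 by omega, show n + 1 + j + 1 = n + 2 + j by ring] at h2
    zify at *
    linear_combination ((n + 1).choose j : ℤ) * (-h2) + ((n + 1 + j).choose j : ℤ) * h1
      - ((n + 1).choose j : ℤ) * ((n + 1 + j).choose j : ℤ) * hd

open Finset in
theorem sum_two_mul_add_one_mul_neg_one_pow_mul_choose {R : Type*} [CommRing R] (n j : ℕ) :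
    ∑ k ∈ range (n + 1),
        (2 * (k : R) + 1) * (-1 : R) ^ k * ((k.choose j : R) * ((k + j).choose j : R))
      = (-1 : R) ^ n * ((n + 1 : ℕ) : R) * ((n.choose j : R) * ((n + 1 + j).choose j : R)) := by
  induction n with
  | zero => cases j <;> simp
  | succ n ih =>
    have h := congrArg (Nat.cast : ℕ → R) (succ_mul_choose_mul_choose_add n j)
    rw [sum_range_succ, ih]
    push_cast at h ⊢
    rw [show n + 1 + 1 = n + 2 from rfl]
    linear_combination (-1 : R) ^ n * h

open Finset in
theorem sum_two_mul_add_one_mul_neg_one_pow_mul_legendre {R : Type*} [CommRing R] (x X : ℕ → R)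
    (hX : ∀ n, X n = ∑ k ∈ range (n + 1), (n.choose k : R) * ((n + k).choose k : R) * x k)
    {n : ℕ} (hn : 0 < n) :
    ∑ k ∈ range n, (2 * (k : R) + 1) * (-1 : R) ^ k * X k
      = (-1 : R) ^ (n - 1) * (n : R) * ∑ k ∈ range n,
          ((n - 1).choose k : R) * ((n + k).choose k : R) * x k := by
  obtain ⟨n, rfl⟩ := Nat.exists_eq_add_of_le' hn
  have hX' : ∀ k ∈ range (n + 1), X k
      = ∑ j ∈ range (n + 1), (k.choose j : R) * ((k + j).choose j : R) * x j := by
    intro k hk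
    rw [hX]
    refine sum_subset (range_mono (Nat.succ_le_of_lt (mem_range.mp hk))) fun j _ hj ↦ ?_
    rw [Nat.choose_eq_zero_of_lt (by simpa using hj)]
    simp
  rw [sum_congr rfl fun k hk ↦ by rw [hX' k hk, mul_sum], sum_comm, mul_sum]
  refine sum_congr rfl fun j _ ↦ ?_
  have h := sum_two_mul_add_one_mul_neg_one_pow_mul_choose (R := R) n j
  simp only [← mul_assoc] at h ⊢
  rw [← sum_mul, h, Nat.add_sub_cancel]

open Finset in
theorem legendre_eq_sum_neg_one_pow {R : Type*} [CommRing R] (x y : ℕ → R)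
    (hy : ∀ n, y n = ∑ k ∈ range (n + 1), (n.choose k : R) * x k) (n : ℕ) :
    ∑ k ∈ range (n + 1), (n.choose k : R) * ((n + k).choose k : R) * x k
      = ∑ k ∈ range (n + 1),
          (n.choose k : R) * ((n + k).choose k : R) * (-1 : R) ^ (n - k) * y k := by
  have hy' : ∀ k ∈ range (n + 1), y k = ∑ j ∈ range (n + 1), (k.choose j : R) * x j := by
    intro k hk
    rw [hy]
    refine sum_subset (range_mono (Nat.succ_le_of_lt (mem_range.mp hk))) fun j _ hj ↦ ?_
    rw [Nat.choose_eq_zero_of_lt (by simpa using hj)]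
    simp
  symm
  rw [sum_congr rfl fun k hk ↦ by rw [hy' k hk, mul_sum], sum_comm]
  refine sum_congr rfl fun j hj ↦ ?_
  rw [← sum_choose_mul_choose_mul_neg_one_pow_mul_choose (Nat.lt_succ_iff.mp (mem_range.mp hj)),
    sum_mul]
  simp only [mul_assoc]

theorem legendre_transform_identities {R : Type*} [CommRing R] (x X y : ℕ → R)
    (hX : ∀ n, X n = ∑ k ∈ Finset.range (n + 1),
      (n.choose k : R) * ((n + k).choose k : R) * x k)
    (hy : ∀ n, y n = ∑ k ∈ Finset.range (n + 1), (n.choose k : R) * x k) :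
    (∀ n, X n = ∑ k ∈ Finset.range (n + 1),
        (n.choose k : R) * ((n + k).choose k : R) * (-1 : R) ^ (n - k) * y k)
    ∧ (∀ n : ℕ, 0 < n → ∑ k ∈ Finset.range n, (2 * (k : R) + 1) * X k
        = (-1 : R) ^ (n - 1) * (n : R) * ∑ k ∈ Finset.range n,
            ((n - 1).choose k : R) * ((n + k).choose k : R) * (-1 : R) ^ k * y k)
    ∧ (∀ n : ℕ, 0 < n → ∑ k ∈ Finset.range n, (2 * (k : R) + 1) * (-1 : R) ^ k * X k
        = (-1 : R) ^ (n - 1) * (n : R) * ∑ k ∈ Finset.range n,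
            ((n - 1).choose k : R) * ((n + k).choose k : R) * x k) := by
  have ha : ∀ n, X n = ∑ k ∈ Finset.range (n + 1),
      (n.choose k : R) * ((n + k).choose k : R) * (-1 : R) ^ (n - k) * y k := fun n ↦
    (hX n).trans (legendre_eq_sum_neg_one_pow x y hy n)
  refine ⟨ha, fun n hn ↦ ?_, fun n hn ↦
    sum_two_mul_add_one_mul_neg_one_pow_mul_legendre x X hX hn⟩
  have hsq : ∀ k : ℕ, (-1 : R) ^ k * (-1) ^ k = 1 := fun k ↦ by
    rw [← mul_pow]
    simp
  have h := sum_two_mul_add_one_mul_neg_one_pow_mul_legendre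
    (fun k ↦ (-1 : R) ^ k * y k) (fun k ↦ (-1 : R) ^ k * X k) (fun m ↦ by
      rw [ha, Finset.mul_sum]
      refine Finset.sum_congr rfl fun k hk ↦ ?_
      obtain ⟨d, rfl⟩ := Nat.exists_eq_add_of_le (Nat.lt_succ_iff.mp (Finset.mem_range.mp hk))
      rw [Nat.add_sub_cancel_left, pow_add]
      linear_combination ((k + d).choose k : R) * ((k + d + k).choose k : R) * (-1) ^ k * y k
        * hsq d) hn
  simp only [← mul_assoc] at h ⊢
  rw [← h]
  refine Finset.sum_congr rfl fun k _ ↦ ?_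
  rw [mul_assoc (2 * (k : R) + 1), hsq, mul_one]
end

section
/- Let p be an odd prime. Then for every integer x: ∑_{k=0}^{p-1} A_k(x) ≡ p·∑_{k=0}^{p-1} (−1)^k·f_k(x)/(2k+1) (mod p²), and ∑_{k=0}^{p-1} (−1)^k·A_k(x) ≡ p·∑_{k=0}^{p-1} g_k(x)/(2k+1) (mod p²). -/
/-- `g n x = ∑_{k=0}^n (n choose k)² (2k choose k) xᵏ`. -/
def g (x : ℤ) (n : ℕ) : ℤ :=
  ∑ k ∈ Finset.range (n + 1), (n.choose k : ℤ) ^ 2 * ((2 * k).choose k : ℤ) * x ^ k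

/-- The Apéry polynomial `A n x = ∑_{k=0}^n (n choose k)² (n+k choose k)² xᵏ`. -/
def aperyPoly (x : ℤ) (n : ℕ) : ℤ :=
  ∑ k ∈ Finset.range (n + 1), (n.choose k : ℤ) ^ 2 * ((n + k).choose k : ℤ) ^ 2 * x ^ k

open Finset

theorem sum_range_mul_choose_eq_shift {M : Type*} [NonAssocSemiring M] (j d : ℕ) (F : ℕ → M) :
    ∑ k ∈ range (j + d + 1), F k * (k.choose j : M) =
      ∑ i ∈ range (d + 1), F (j + i) * ((j + i).choose j : M) := by
  rw [add_assoc, sum_range_add, sum_eq_zero, zero_add]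
  intro k hk
  rw [Nat.choose_eq_zero_of_lt (mem_range.mp hk), Nat.cast_zero, mul_zero]

theorem choose_mul_choose_shift (j d i : ℕ) :
    (j + d).choose (j + i) * (j + i).choose j = (j + d).choose j * d.choose i := by
  simpa using Nat.choose_mul (n := j + d) (k := j + i) (s := j) (by omega)

/-- The `d`-th finite difference of `x ↦ x.choose (d + s)`. -/
theorem sum_alternating_choose_mul_choose_add (d a s : ℕ) :
    ∑ i ∈ range (d + 1), (-1 : ℤ) ^ (d + i) * (d.choose i : ℤ) * ((a + i).choose (d + s) : ℤ) =
      (a.choose s : ℤ) := by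
  rw [← congrFun (fwdDiff_iter_choose s d) a, fwdDiff_iter_eq_sum_shift]
  refine sum_congr rfl fun i hi => ?_
  have hid : i ≤ d := Nat.lt_succ_iff.mp (mem_range.mp hi)
  have hsign : (-1 : ℤ) ^ (d + i) = (-1) ^ (d - i) := by
    rw [show d + i = d - i + 2 * i by omega, pow_add, pow_mul]
    simp
  rw [hsign, smul_eq_mul, smul_eq_mul, mul_one]

theorem sum_alternating_choose_mul_choose_mul_choose_add (j d s : ℕ) :
    ∑ k ∈ range (j + d + 1), (-1 : ℤ) ^ (j + d + k) * ((j + d).choose k : ℤ) *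
        ((j + d + k).choose (d + s) : ℤ) * (k.choose j : ℤ) =
      ((j + d).choose j : ℤ) * ((j + d + j).choose s : ℤ) := by
  rw [sum_range_mul_choose_eq_shift,
    ← sum_alternating_choose_mul_choose_add d (j + d + j) s, mul_sum]
  refine sum_congr rfl fun i _ => ?_
  have h : ((j + d).choose (j + i) : ℤ) * ((j + i).choose j : ℤ) =
      ((j + d).choose j : ℤ) * (d.choose i : ℤ) := by
    exact_mod_cast choose_mul_choose_shift j d i
  have hsign : (-1 : ℤ) ^ (j + d + (j + i)) = (-1) ^ (d + i) := by
    rw [show j + d + (j + i) = 2 * j + (d + i) by omega, pow_add, pow_mul]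
    simp
  rw [hsign, ← add_assoc (j + d) j i]
  linear_combination (-1 : ℤ) ^ (d + i) * ((j + d + j + i).choose (d + s) : ℤ) * h

theorem sum_choose_mul_choose_self (d j : ℕ) :
    ∑ i ∈ range (d + 1), d.choose i * j.choose i = (j + d).choose j := by
  rw [Nat.choose_symm_add, Nat.add_choose_eq, Nat.sum_antidiagonal_eq_sum_range_succ_mk]
  refine sum_congr rfl fun i hi => ?_
  rw [Nat.choose_symm (Nat.lt_succ_iff.mp (mem_range.mp hi)), mul_comm]

theorem choose_mul_choose_add_eq (n k : ℕ) :
    (n + k).choose (2 * k) * (2 * k).choose k = n.choose k * (n + k).choose k := by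
  rw [Nat.choose_mul (by omega), two_mul, Nat.add_sub_cancel, Nat.add_sub_cancel, mul_comm]

theorem g_eq_sum_range {k n : ℕ} (hkn : k ≤ n) (x : ℤ) :
    g x k = ∑ j ∈ range (n + 1), (k.choose j : ℤ) ^ 2 * ((2 * j).choose j : ℤ) * x ^ j := by
  refine sum_subset (range_mono (by omega)) fun j _ hj => ?_
  rw [Nat.choose_eq_zero_of_lt (by simpa using hj)]
  simp

theorem franelPoly_eq_sum_range {k n : ℕ} (hkn : k ≤ n) (x : ℤ) :
    franelPoly x k =
      ∑ j ∈ range (n + 1), (k.choose j : ℤ) ^ 2 * ((2 * j).choose k : ℤ) * x ^ j := by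
  refine sum_subset (range_mono (by omega)) fun j _ hj => ?_
  rw [Nat.choose_eq_zero_of_lt (by simpa using hj)]
  simp

theorem sum_choose_mul_choose_sq_mul_choose (j d : ℕ) :
    ∑ l ∈ range (j + d + 1), (j + d).choose l * l.choose j * (2 * j).choose l * l.choose j =
      (j + d).choose j ^ 2 * (2 * j).choose j := by
  have := sum_range_mul_choose_eq_shift (M := ℕ) j d
    fun l => (j + d).choose l * l.choose j * (2 * j).choose l
  simp only [Nat.cast_id] at this
  rw [this, sq, mul_right_comm, ← sum_choose_mul_choose_self d j, mul_sum,
    sum_choose_mul_choose_self]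
  refine sum_congr rfl fun i _ => ?_
  rw [choose_mul_choose_shift, two_mul, mul_assoc _ ((j + j).choose (j + i)),
    choose_mul_choose_shift]
  ring

theorem g_eq_sum_choose_mul_franelPoly (x : ℤ) (n : ℕ) :
    g x n = ∑ l ∈ range (n + 1), (n.choose l : ℤ) * franelPoly x l := by
  have hf : ∀ l ∈ range (n + 1), (n.choose l : ℤ) * franelPoly x l = ∑ j ∈ range (n + 1),
      (n.choose l : ℤ) * ((l.choose j : ℤ) ^ 2 * ((2 * j).choose l : ℤ) * x ^ j) := fun l hl => by
    rw [franelPoly_eq_sum_range (Nat.lt_succ_iff.mp (mem_range.mp hl)), mul_sum]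
  rw [sum_congr rfl hf, sum_comm, g]
  refine sum_congr rfl fun j hj => ?_
  obtain ⟨d, rfl⟩ := Nat.exists_eq_add_of_le (Nat.lt_succ_iff.mp (mem_range.mp hj))
  have h := congrArg (Nat.cast : ℕ → ℤ) (sum_choose_mul_choose_sq_mul_choose j d)
  push_cast at h
  rw [← h, sum_mul]
  exact sum_congr rfl fun l _ => by ring

theorem aperyPoly_eq_sum_g (x : ℤ) (n : ℕ) :
    aperyPoly x n = ∑ k ∈ range (n + 1),
      (-1 : ℤ) ^ (n + k) * (n.choose k : ℤ) * ((n + k).choose k : ℤ) * g x k := by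
  have hg : ∀ k ∈ range (n + 1),
      (-1 : ℤ) ^ (n + k) * (n.choose k : ℤ) * ((n + k).choose k : ℤ) * g x k =
        ∑ j ∈ range (n + 1), (-1 : ℤ) ^ (n + k) * (n.choose k : ℤ) * ((n + k).choose k : ℤ) *
          ((k.choose j : ℤ) ^ 2 * ((2 * j).choose j : ℤ) * x ^ j) := fun k hk => by
    rw [g_eq_sum_range (Nat.lt_succ_iff.mp (mem_range.mp hk)), mul_sum]
  rw [sum_congr rfl hg, sum_comm, aperyPoly]
  refine sum_congr rfl fun j hj => ?_
  obtain ⟨d, hd⟩ := Nat.exists_eq_add_of_le (Nat.lt_succ_iff.mp (mem_range.mp hj))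
  have halt := sum_alternating_choose_mul_choose_mul_choose_add j d (2 * j)
  rw [show d + 2 * j = j + d + j by ring, ← hd] at halt
  have hc : ((n + j).choose (2 * j) : ℤ) * ((2 * j).choose j : ℤ) =
      (n.choose j : ℤ) * ((n + j).choose j : ℤ) := by
    exact_mod_cast choose_mul_choose_add_eq n j
  have hterm : ∀ k ∈ range (n + 1),
      (-1 : ℤ) ^ (n + k) * (n.choose k : ℤ) * ((n + k).choose k : ℤ) *
          ((k.choose j : ℤ) ^ 2 * ((2 * j).choose j : ℤ) * x ^ j) =
        (-1 : ℤ) ^ (n + k) * (n.choose k : ℤ) * ((n + k).choose (n + j) : ℤ) * (k.choose j : ℤ) *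
          (((n + j).choose j : ℤ) * ((2 * j).choose j : ℤ) * x ^ j) := fun k _ => by
    have h : ((n + k).choose (n + j) : ℤ) * ((n + j).choose j : ℤ) =
        ((n + k).choose k : ℤ) * (k.choose j : ℤ) := by
      rw [← Nat.choose_symm_add (a := n) (b := j), ← Nat.choose_symm_add (a := n) (b := k)]
      have := Nat.choose_mul (n := n + k) (k := n + j) (s := n) (by omega)
      rw [Nat.add_sub_cancel_left, Nat.add_sub_cancel_left] at this
      exact_mod_cast this
    linear_combination (-(-1 : ℤ) ^ (n + k) * (n.choose k : ℤ) * (k.choose j : ℤ) *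
      ((2 * j).choose j : ℤ) * x ^ j) * h
  rw [sum_congr rfl hterm, ← sum_mul, halt]
  linear_combination (-(n.choose j : ℤ) * ((n + j).choose j : ℤ) * x ^ j) * hc

theorem aperyPoly_eq_sum_franelPoly (x : ℤ) (n : ℕ) :
    aperyPoly x n = ∑ l ∈ range (n + 1),
      (n.choose l : ℤ) * ((n + l).choose l : ℤ) * franelPoly x l := by
  have hg : ∀ k ∈ range (n + 1),
      (-1 : ℤ) ^ (n + k) * (n.choose k : ℤ) * ((n + k).choose k : ℤ) * g x k =
        ∑ l ∈ range (n + 1), (-1 : ℤ) ^ (n + k) * (n.choose k : ℤ) * ((n + k).choose n : ℤ) *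
          (k.choose l : ℤ) * franelPoly x l := fun k hk => by
    rw [g_eq_sum_choose_mul_franelPoly, mul_sum, Nat.choose_symm_add]
    rw [sum_subset (range_mono (Nat.succ_le_of_lt (mem_range.mp hk)))]
    · exact sum_congr rfl fun l _ => by ring
    · intro l _ hl
      rw [Nat.choose_eq_zero_of_lt (n := k) (k := l) (by simpa using hl)]
      simp
  rw [aperyPoly_eq_sum_g, sum_congr rfl hg, sum_comm]
  refine sum_congr rfl fun l hl => ?_
  obtain ⟨d, hd⟩ := Nat.exists_eq_add_of_le (Nat.lt_succ_iff.mp (mem_range.mp hl))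
  have halt := sum_alternating_choose_mul_choose_mul_choose_add l d l
  rw [add_comm d l, ← hd] at halt
  rw [← sum_mul, halt]

theorem sum_choose_add_two_mul (p k : ℕ) :
    ∑ n ∈ range p, (n + k).choose (2 * k) = (p + k).choose (2 * k + 1) := by
  induction p with
  | zero => rw [sum_range_zero, Nat.choose_eq_zero_of_lt (by omega)]
  | succ p ih => rw [sum_range_succ, ih, add_right_comm p 1 k, Nat.choose_succ_succ', add_comm]

theorem sum_choose_mul_choose_add (p k : ℕ) :
    ∑ n ∈ range p, n.choose k * (n + k).choose k =
      (p + k).choose (2 * k + 1) * (2 * k).choose k := by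
  rw [← sum_choose_add_two_mul, sum_mul]
  exact sum_congr rfl fun n _ => (choose_mul_choose_add_eq n k).symm

theorem two_mul_add_one_mul_sum_choose_mul_choose_add {p : ℕ} (hp : 0 < p) (k : ℕ) :
    (2 * k + 1) * ∑ n ∈ range p, n.choose k * (n + k).choose k =
      p * ((p - 1).choose k * (p + k).choose k) := by
  obtain ⟨m, rfl⟩ := Nat.exists_eq_add_of_le' hp
  have h1 := Nat.choose_succ_right_eq (m + 1 + k) (2 * k)
  have h2 := choose_mul_choose_add_eq (m + 1) k
  have h3 := Nat.choose_mul_succ_eq m k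
  rw [show m + 1 + k - 2 * k = m + 1 - k by omega] at h1
  rw [sum_choose_mul_choose_add, Nat.add_sub_cancel]
  linear_combination (2 * k).choose k * h1 + (m + 1 - k) * h2 - (m + 1 + k).choose k * h3

theorem sq_dvd_choose_mul_choose_add_sub_neg_one_pow {p : ℕ} (hp : p.Prime) {k : ℕ} (hk : k < p) :
    ((p : ℤ) ^ 2) ∣ ((p - 1).choose k : ℤ) * ((p + k).choose k : ℤ) - (-1) ^ k := by
  induction k with
  | zero => simp
  | succ k ih =>
    have h1 : ((p - 1).choose (k + 1) : ℤ) * (k + 1) = ((p - 1).choose k : ℤ) * (p - (k + 1)) := by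
      have := congrArg (Nat.cast : ℕ → ℤ) (Nat.choose_succ_right_eq (p - 1) k)
      rw [show p - 1 - k = p - (k + 1) by omega] at this
      push_cast [Nat.cast_sub hk.le] at this
      exact this
    have h2 : ((p + (k + 1)).choose (k + 1) : ℤ) * (k + 1) =
        ((p + k).choose k : ℤ) * (p + (k + 1)) := by
      have := congrArg (Nat.cast : ℕ → ℤ) (Nat.add_one_mul_choose_eq (p + k) k)
      push_cast at this
      rw [← add_assoc p k 1]
      linear_combination -this
    have hcop : IsCoprime ((p : ℤ) ^ 2) ((k + 1 : ℤ) ^ 2) := by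
      have := Nat.coprime_of_lt_prime (Nat.succ_ne_zero k) hk hp
      exact_mod_cast (Nat.isCoprime_iff_coprime.mpr this).pow (m := 2) (n := 2)
    refine hcop.dvd_of_dvd_mul_right ?_
    obtain ⟨c, hc⟩ := ih (by omega)
    refine ⟨((p - 1).choose k : ℤ) * ((p + k).choose k : ℤ) - (k + 1) ^ 2 * c, ?_⟩
    rw [pow_succ]
    linear_combination ((p + (k + 1)).choose (k + 1) : ℤ) * (k + 1) * h1 +
      ((p - 1).choose k : ℤ) * (p - (k + 1)) * h2 - (k + 1 : ℤ) ^ 2 * hc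

theorem ratCongr_of_padicNorm_sub_le {p m : ℕ} [Fact p.Prime] {a b : ℚ}
    (h : padicNorm p (a - b) ≤ (p : ℚ) ^ (-(m : ℤ))) : ratCongr p m a b := by
  by_cases hab : a - b = 0
  · exact Or.inl (sub_eq_zero.mp hab)
  · refine Or.inr ?_
    have hp : (1 : ℚ) < p := by exact_mod_cast (Fact.out : p.Prime).one_lt
    rw [padicNorm.eq_zpow_of_nonzero hab, zpow_le_zpow_iff_right₀ hp] at h
    omega

theorem padicNorm_prime_div_two_mul_add_one_le_one {p k : ℕ} [hp : Fact p.Prime] (hk : k < p) :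
    padicNorm p ((p : ℚ) / (2 * (k : ℚ) + 1)) ≤ 1 := by
  have hcast : (2 * (k : ℚ) + 1) = ((2 * k + 1 : ℕ) : ℚ) := by push_cast; ring
  by_cases hdvd : p ∣ 2 * k + 1
  · obtain ⟨c, hc⟩ := hdvd
    have hp0 : 0 < p := hp.out.pos
    have hc1 : c = 1 := by
      have hlt : p * c < p * 2 := by omega
      have hlt := Nat.lt_of_mul_lt_mul_left hlt
      rcases Nat.eq_zero_or_pos c with rfl | _
      · omega
      · omega
    rw [hcast, hc, hc1, mul_one, div_self (by exact_mod_cast hp0.ne'), padicNorm.one]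
  · rw [hcast, padicNorm.div, (padicNorm.nat_eq_one_iff (2 * k + 1)).mpr hdvd, div_one]
    exact padicNorm.of_nat p

theorem ratCongr_sum_sum_choose_mul_choose_add {p : ℕ} (hp : p.Prime) (F : ℕ → ℤ) :
    ratCongr p 2
      ((∑ n ∈ range p, ∑ k ∈ range (n + 1),
        (n.choose k : ℤ) * ((n + k).choose k : ℤ) * F k : ℤ) : ℚ)
      ((p : ℚ) * ∑ k ∈ range p, (-1 : ℚ) ^ k * (F k : ℚ) / (2 * (k : ℚ) + 1)) := by
  have : Fact p.Prime := ⟨hp⟩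
  have hswap : ∑ n ∈ range p, ∑ k ∈ range (n + 1),
      (n.choose k : ℤ) * ((n + k).choose k : ℤ) * F k =
        ∑ k ∈ range p, ((∑ n ∈ range p, n.choose k * (n + k).choose k : ℕ) : ℤ) * F k := by
    have hext : ∀ n ∈ range p, ∑ k ∈ range (n + 1),
        (n.choose k : ℤ) * ((n + k).choose k : ℤ) * F k =
          ∑ k ∈ range p, (n.choose k : ℤ) * ((n + k).choose k : ℤ) * F k := fun n hn => by
      refine sum_subset (range_mono (Nat.succ_le_of_lt (mem_range.mp hn))) fun k _ hk => ?_
      rw [Nat.choose_eq_zero_of_lt (by simpa using hk)]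
      simp
    rw [sum_congr rfl hext, sum_comm]
    exact sum_congr rfl fun k _ => by rw [← sum_mul]; push_cast; rfl
  apply ratCongr_of_padicNorm_sub_le
  rw [hswap, mul_sum, Int.cast_sum, ← sum_sub_distrib]
  refine padicNorm.sum_le' (fun k hk => ?_) (by positivity)
  have hk := mem_range.mp hk
  have hT := congrArg (Nat.cast : ℕ → ℚ) (two_mul_add_one_mul_sum_choose_mul_choose_add hp.pos k)
  have hdvd := (sq_dvd_choose_mul_choose_add_sub_neg_one_pow hp hk).mul_right (F k)
  have hk0 : (2 * (k : ℚ) + 1) ≠ 0 := by positivity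
  rw [← Nat.cast_pow, padicNorm.dvd_iff_norm_le] at hdvd
  generalize (∑ n ∈ range p, n.choose k * (n + k).choose k : ℕ) = T at hT ⊢
  push_cast at hT hdvd ⊢
  have hfac : (T : ℚ) * F k - p * ((-1) ^ k * F k / (2 * k + 1)) =
      p / (2 * k + 1) * ((((p - 1).choose k : ℚ) * ((p + k).choose k : ℚ) - (-1) ^ k) * F k) := by
    field_simp
    linear_combination (F k : ℚ) * hT
  rw [hfac, padicNorm.mul]
  exact (mul_le_of_le_one_left (padicNorm.nonneg _)
    (padicNorm_prime_div_two_mul_add_one_le_one hk)).trans hdvd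

theorem sum_apery_congr (p : ℕ) (hp : p.Prime) (hodd : Odd p) (x : ℤ) :
    ratCongr p 2 (∑ k ∈ Finset.range p, (aperyPoly x k : ℚ))
      ((p : ℚ) * ∑ k ∈ Finset.range p,
        (-1 : ℚ) ^ k * (franelPoly x k : ℚ) / (2 * (k : ℚ) + 1))
    ∧ ratCongr p 2 (∑ k ∈ Finset.range p, (-1 : ℚ) ^ k * (aperyPoly x k : ℚ))
      ((p : ℚ) * ∑ k ∈ Finset.range p, (g x k : ℚ) / (2 * (k : ℚ) + 1)) := by
  have h1 := ratCongr_sum_sum_choose_mul_choose_add hp (franelPoly x)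
  have h2 := ratCongr_sum_sum_choose_mul_choose_add hp fun k => (-1) ^ k * g x k
  simp only [← aperyPoly_eq_sum_franelPoly] at h1
  have hA : ∀ n, ∑ k ∈ Finset.range (n + 1),
      (n.choose k : ℤ) * ((n + k).choose k : ℤ) * ((-1) ^ k * g x k) =
        (-1) ^ n * aperyPoly x n := fun n => by
    rw [aperyPoly_eq_sum_g, Finset.mul_sum]
    refine Finset.sum_congr rfl fun k _ => ?_
    have : (-1 : ℤ) ^ n * (-1) ^ n = 1 := by rw [← mul_pow]; simp
    rw [pow_add]
    linear_combination (-(-1 : ℤ) ^ k * n.choose k * (n + k).choose k * g x k) * this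
  have hsq : ∀ k : ℕ, (-1 : ℚ) ^ k * ((-1) ^ k * (g x k : ℚ)) = g x k := fun k => by
    rw [← mul_assoc, ← mul_pow]; simp
  simp only [hA] at h2
  push_cast at h1 h2
  simp only [hsq] at h2
  exact ⟨h1, h2⟩
end

section
/- Let p > 3 be a prime. Then ∑_{k=0}^{p-1} (2k+1)³·(−1)^k·A_k ≡ −(p/3)·(p/3) (mod p³), i.e., the sum is congruent to −(1/3)·p·ε modulo p³, where ε = 1 if p ≡ 1 (mod 3) and ε = −1 if p ≡ 2 (mod 3). -/
/-- The Apéry numbers `A n = ∑_{k=0}^n (n choose k)² (n+k choose k)²`. -/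
def apery (n : ℕ) : ℤ :=
  ∑ k ∈ Finset.range (n + 1), (n.choose k : ℤ) ^ 2 * ((n + k).choose k : ℤ) ^ 2

namespace Apery

open Finset

/-- The product `(n choose k) (n+k choose k)`, up to sign a coefficient of the `n`-th shifted
Legendre polynomial. -/
def legendreCoeff (n k : ℕ) : ℤ := n.choose k * (n + k).choose k

/-- The coefficients in the expansion of `(n choose m)² (n+m choose m)²` in terms of
`legendreCoeff n (m + k)`. -/
def sqCoeff (m k : ℕ) : ℤ := m.centralBinom * legendreCoeff m k

/-- The quadratic character modulo `3`, as a function on `ℕ`. -/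
def chi (k : ℕ) : ℤ := if k % 3 = 0 then 0 else if k % 3 = 1 then 1 else -1

lemma choose_succ_mul (n k : ℕ) : (n.choose (k + 1) : ℤ) * (k + 1) = n.choose k * (n - k) := by
  rcases le_or_gt k n with h | h
  · have := Nat.choose_succ_right_eq n k
    zify [h] at this
    exact this
  · simp [Nat.choose_eq_zero_of_lt h, Nat.choose_eq_zero_of_lt (h.trans (Nat.lt_succ_self k))]

lemma succ_choose_mul (n k : ℕ) :
    ((n + 1).choose k : ℤ) * (n + 1 - k) = n.choose k * (n + 1) := by
  rcases le_or_gt k (n + 1) with h | h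
  · have := Nat.choose_mul_succ_eq n k
    zify [h] at this
    exact this.symm
  · simp [Nat.choose_eq_zero_of_lt h, Nat.choose_eq_zero_of_lt ((Nat.lt_succ_self n).trans h)]

lemma descFactorial_succ_cast (n k : ℕ) :
    (n.descFactorial (k + 1) : ℤ) = (n - k) * n.descFactorial k := by
  rcases le_or_gt k n with h | h
  · rw [Nat.descFactorial_succ]
    push_cast [h]
    rfl
  · simp [Nat.descFactorial_eq_zero_iff_lt.2 h]

lemma legendreCoeff_eq_zero {n k : ℕ} (h : n < k) : legendreCoeff n k = 0 := by
  simp [legendreCoeff, Nat.choose_eq_zero_of_lt h]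

lemma sq_mul_legendreCoeff_succ_right (n k : ℕ) :
    ((k : ℤ) + 1) ^ 2 * legendreCoeff n (k + 1) =
      (n - k) * (n + k + 1) * legendreCoeff n k := by
  have h1 := choose_succ_mul n k
  have h2 : ((n : ℤ) + k + 1) * (n + k).choose k = (n + (k + 1)).choose (k + 1) * (k + 1) := by
    exact_mod_cast Nat.add_one_mul_choose_eq (n + k) k
  unfold legendreCoeff
  linear_combination ((n + (k + 1)).choose (k + 1) : ℤ) * (k + 1) * h1 -
    (n.choose k : ℤ) * (n - k) * h2

lemma mul_legendreCoeff_succ_left (n k : ℕ) :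
    ((n : ℤ) + 1 - k) * legendreCoeff (n + 1) k = (n + 1 + k) * legendreCoeff n k := by
  have h1 := succ_choose_mul n k
  have h2 := succ_choose_mul (n + k) k
  have h3 : n + 1 + k = n + k + 1 := by ring
  have hn : (n : ℤ) + 1 ≠ 0 := by positivity
  unfold legendreCoeff
  rw [h3]
  push_cast at h2
  apply mul_left_cancel₀ hn
  linear_combination ((n + k + 1).choose k : ℤ) * (n + 1) * h1 + (n.choose k : ℤ) * (n + 1) * h2

section Linearization

/-- Coefficients of the linearization of `P a * P b`, where
`P k = ∏ j < k, (X - j * (j + 1))`. -/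
def linCoeff (a b k : ℕ) : ℤ :=
  b.choose k * (a + b).descFactorial (b - k) * a.descFactorial (b - k)

lemma linCoeff_succ_zero (a b : ℕ) :
    linCoeff a (b + 1) 0 = ((a : ℤ) - b) * (a + b + 1) * linCoeff a b 0 := by
  simp only [linCoeff, Nat.choose_zero_right, Nat.sub_zero, descFactorial_succ_cast a b,
    ← add_assoc, Nat.succ_descFactorial_succ]
  push_cast
  ring

lemma linCoeff_succ_succ (a b k : ℕ) (hk : k ≤ b) :
    linCoeff a (b + 1) (k + 1) =
      linCoeff a b k + ((a : ℤ) + k + 1 - b) * (a + k + b + 2) * linCoeff a b (k + 1) := by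
  rcases hk.eq_or_lt with rfl | hk
  · simp [linCoeff]
  · obtain ⟨r, rfl⟩ := Nat.exists_eq_add_of_lt hk
    have h1 : k + r + 1 + 1 - (k + 1) = r + 1 := by omega
    have h2 : k + r + 1 - k = r + 1 := by omega
    have h3 : k + r + 1 - (k + 1) = r := by omega
    have h4 := choose_succ_mul (k + r + 1) k
    simp only [linCoeff, h1, h2, h3]
    rw [← add_assoc a, Nat.succ_descFactorial_succ, descFactorial_succ_cast a,
      descFactorial_succ_cast, Nat.choose_succ_succ']
    push_cast at h4 ⊢
    linear_combination (-((a : ℤ) - r) * (a + (k + r + 1)).descFactorial r *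
      a.descFactorial r) * h4

lemma linearization {X : ℤ} {P : ℕ → ℤ} (h0 : P 0 = 1)
    (hP : ∀ k : ℕ, P (k + 1) = (X - k * (k + 1)) * P k) (a b : ℕ) :
    P a * P b = ∑ k ∈ range (b + 1), linCoeff a b k * P (a + k) := by
  induction b with
  | zero => simp [h0, linCoeff]
  | succ b ih =>
    have hlast : linCoeff a b (b + 1) = 0 := by simp [linCoeff]
    have key : ∑ k ∈ range (b + 1), ((a : ℤ) + k - b) * (a + k + b + 1) * linCoeff a b k *
          P (a + k) = ((a : ℤ) - b) * (a + b + 1) * linCoeff a b 0 * P a +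
        ∑ k ∈ range (b + 1), ((a : ℤ) + k + 1 - b) * (a + k + b + 2) * linCoeff a b (k + 1) *
          P (a + (k + 1)) := by
      have := sum_range_succ (fun k : ℕ => ((a : ℤ) + k - b) * (a + k + b + 1) *
        linCoeff a b k * P (a + k)) (b + 1)
      rw [hlast, sum_range_succ'] at this
      simp only [mul_zero, zero_mul, add_zero] at this
      rw [← this, add_comm]
      refine congrArg₂ _ (by simp) (sum_congr rfl fun k _ => ?_)
      push_cast
      ring
    calc P a * P (b + 1) = (X - b * (b + 1)) * (P a * P b) := by rw [hP]; ring
      _ = ∑ k ∈ range (b + 1), linCoeff a b k * P (a + (k + 1)) +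
          ∑ k ∈ range (b + 1), ((a : ℤ) + k - b) * (a + k + b + 1) * linCoeff a b k *
            P (a + k) := by
        rw [ih, mul_sum, ← sum_add_distrib]
        refine sum_congr rfl fun k _ => ?_
        rw [← add_assoc, hP]
        push_cast
        ring
      _ = _ := by
        rw [key, sum_range_succ' _ (b + 1), linCoeff_succ_zero, add_zero, add_left_comm,
          ← sum_add_distrib, add_comm]
        congr 1
        refine sum_congr rfl fun k hk => ?_
        rw [linCoeff_succ_succ a b k (by simpa [Nat.lt_succ_iff] using hk)]
        ring

end Linearization

lemma linCoeff_self_mul {m k : ℕ} (hk : k ≤ m) :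
    linCoeff m m k * ((m + k).factorial : ℤ) ^ 2 = (m.factorial : ℤ) ^ 4 * sqCoeff m k := by
  have h1 := Nat.factorial_mul_descFactorial (show m - k ≤ m + m by omega)
  have h2 := Nat.factorial_mul_descFactorial (show m - k ≤ m by omega)
  have h3 := Nat.add_choose_mul_factorial_mul_factorial m m
  have h4 := Nat.add_choose_mul_factorial_mul_factorial m k
  rw [show m + m - (m - k) = m + k by omega] at h1
  rw [show m - (m - k) = k by omega] at h2
  have hk0 : (k.factorial : ℤ) ≠ 0 := by exact_mod_cast k.factorial_ne_zero
  zify at h1 h2 h3 h4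
  simp only [linCoeff, sqCoeff, legendreCoeff, Nat.centralBinom_eq_two_mul_choose, two_mul]
  apply mul_left_cancel₀ hk0
  linear_combination (m.choose k : ℤ) * ((m + k).factorial * k.factorial *
      m.descFactorial (m - k) * h1 + (m + k).factorial * (m + m).factorial * h2 -
      m.factorial * (m + k).factorial * h3 -
      (m + m).choose m * m.factorial ^ 3 * h4)

lemma legendreCoeff_sq (n m : ℕ) :
    legendreCoeff n m ^ 2 = ∑ k ∈ range (m + 1), sqCoeff m k * legendreCoeff n (m + k) := by
  have hlin := linearization (X := n * (n + 1))
    (P := fun k => (k.factorial : ℤ) ^ 2 * legendreCoeff n k)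
    (by simp [legendreCoeff]) (fun k => by
      rw [Nat.factorial_succ]
      push_cast
      linear_combination (k.factorial : ℤ) ^ 2 * sq_mul_legendreCoeff_succ_right n k) m m
  have hm : (m.factorial : ℤ) ^ 4 ≠ 0 := by
    exact_mod_cast pow_ne_zero 4 m.factorial_ne_zero
  apply mul_left_cancel₀ hm
  rw [mul_sum]
  trans ((m.factorial : ℤ) ^ 2 * legendreCoeff n m) * ((m.factorial : ℤ) ^ 2 * legendreCoeff n m)
  · ring
  rw [hlin]
  refine sum_congr rfl fun k hk => ?_
  have := linCoeff_self_mul (m := m) (k := k) (by simpa [Nat.lt_succ_iff] using hk)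
  linear_combination legendreCoeff n (m + k) * this

lemma apery_eq {n N : ℕ} (h : n < N) :
    apery n = ∑ m ∈ range N, ∑ k ∈ range (m + 1), sqCoeff m k * legendreCoeff n (m + k) := by
  simp_rw [← legendreCoeff_sq]
  have : apery n = ∑ m ∈ range (n + 1), legendreCoeff n m ^ 2 := by
    simp [apery, legendreCoeff, mul_pow]
  rw [this]
  refine sum_subset (range_mono h) fun m _ hm => ?_
  rw [legendreCoeff_eq_zero (by simpa [Nat.lt_succ_iff] using hm)]
  simp

lemma sum_cube_legendreCoeff (n i : ℕ) :
    ∑ k ∈ range n, (2 * (k : ℤ) + 1) ^ 3 * (-1) ^ k * legendreCoeff k i =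
      -(-1) ^ n * ((n - i) * legendreCoeff n i) * (4 * n ^ 2 - 4 * i - 3) := by
  induction n with
  | zero =>
    rcases i with _ | i
    · simp
    · simp [legendreCoeff]
  | succ n ih =>
    rw [sum_range_succ, ih]
    push_cast
    rw [mul_legendreCoeff_succ_left]
    ring

lemma sum_cube_apery_eq (n : ℕ) :
    ∑ k ∈ range n, (2 * (k : ℤ) + 1) ^ 3 * (-1) ^ k * apery k =
      ∑ m ∈ range n, ∑ k ∈ range (m + 1), sqCoeff m k *
        (-(-1) ^ n * ((n - (m + k : ℕ)) * legendreCoeff n (m + k)) *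
          (4 * n ^ 2 - 4 * (m + k : ℕ) - 3)) := by
  have h : ∀ k ∈ range n, (2 * (k : ℤ) + 1) ^ 3 * (-1) ^ k * apery k =
      ∑ m ∈ range n, ∑ j ∈ range (m + 1), sqCoeff m j *
        ((2 * (k : ℤ) + 1) ^ 3 * (-1) ^ k * legendreCoeff k (m + j)) := by
    intro k hk
    rw [apery_eq (mem_range.1 hk), mul_sum]
    refine sum_congr rfl fun m _ => ?_
    rw [mul_sum]
    exact sum_congr rfl fun j _ => by ring
  rw [sum_congr rfl h, sum_comm]
  refine sum_congr rfl fun m _ => ?_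
  rw [sum_comm]
  refine sum_congr rfl fun j _ => ?_
  rw [← mul_sum, sum_cube_legendreCoeff]

lemma sum_neg_one_pow_mul_legendreCoeff (m : ℕ) :
    ∑ k ∈ range (m + 1), (-1) ^ k * legendreCoeff m k = (-1) ^ m := by
  have h := Polynomial.shiftedLegendre_eval_symm m (1 : ℤ)
  rw [sub_self, Polynomial.aeval_def, Polynomial.aeval_def] at h
  simp only [Polynomial.shiftedLegendre, Polynomial.eval₂_finsetSum, Polynomial.eval₂_mul,
    Polynomial.eval₂_C, Polynomial.eval₂_pow, Polynomial.eval₂_X, one_pow, mul_one,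
    Algebra.algebraMap_self, RingHom.id_apply] at h
  rw [sum_range_succ' (fun k : ℕ => (-1 : ℤ) ^ k * (m.choose k) * ((m + k).choose m) * 0 ^ k)] at h
  simp only [zero_pow (Nat.succ_ne_zero _), mul_zero, sum_const_zero] at h
  simp only [pow_zero, Nat.choose_zero_right, add_zero, Nat.choose_self, Nat.cast_one, mul_one,
    zero_add] at h
  rw [← h]
  refine sum_congr rfl fun k _ => ?_
  rw [legendreCoeff, Nat.choose_symm_add, mul_assoc]

lemma sum_neg_one_pow_mul_sub_legendreCoeff (m N : ℕ) :
    ∑ k ∈ range N, (-1) ^ k * ((m : ℤ) * (m + 1) - k) * legendreCoeff m k =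
      -(-1) ^ N * N ^ 2 * legendreCoeff m N := by
  induction N with
  | zero => simp
  | succ N ih =>
    have := sq_mul_legendreCoeff_succ_right m N
    rw [sum_range_succ, ih]
    push_cast
    linear_combination -(-1) ^ N * this

lemma sum_neg_one_pow_mul_linear_legendreCoeff (m : ℕ) :
    ∑ k ∈ range (m + 1), (-1) ^ k * (4 * ((m : ℤ) + k) + 3) * legendreCoeff m k =
      (-1) ^ m * (4 * m ^ 2 + 8 * m + 3) := by
  have h1 := sum_neg_one_pow_mul_legendreCoeff m
  have h2 := sum_neg_one_pow_mul_sub_legendreCoeff m (m + 1)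
  rw [legendreCoeff_eq_zero (Nat.lt_succ_self m), mul_zero] at h2
  have h3 : ∑ k ∈ range (m + 1), (-1) ^ k * (4 * ((m : ℤ) + k) + 3) * legendreCoeff m k =
      (4 * m ^ 2 + 8 * m + 3) * ∑ k ∈ range (m + 1), (-1) ^ k * legendreCoeff m k -
      4 * ∑ k ∈ range (m + 1), (-1) ^ k * ((m : ℤ) * (m + 1) - k) * legendreCoeff m k := by
    rw [mul_sum, mul_sum, ← sum_sub_distrib]
    exact sum_congr rfl fun k _ => by ring
  rw [h3, h1, h2]
  ring

lemma sum_quadratic_mul_centralBinom (n : ℕ) :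
    3 * ∑ m ∈ range n, (4 * (m : ℤ) ^ 2 + 8 * m + 3) * m.centralBinom =
      4 * n ^ 2 * n.centralBinom + ∑ m ∈ range n, (m.centralBinom : ℤ) := by
  induction n with
  | zero => simp
  | succ n ih =>
    have h : ((n : ℤ) + 1) * (n + 1).centralBinom = 2 * (2 * n + 1) * n.centralBinom := by
      exact_mod_cast Nat.succ_mul_centralBinom_succ n
    rw [sum_range_succ, mul_add, ih, sum_range_succ]
    push_cast
    linear_combination -4 * ((n : ℤ) + 1) * h

section Character

lemma chi_add_chi_add_chi (k : ℕ) : chi k + chi (k + 1) + chi (k + 2) = 0 := by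
  have : k % 3 = 0 ∨ k % 3 = 1 ∨ k % 3 = 2 := by omega
  rcases this with h | h | h <;> simp [chi, Nat.add_mod, h]

lemma sum_choose_mul_chi (n s : ℕ) :
    ∑ k ∈ range (n + 1), (n.choose k : ℤ) * chi (k + s) = (-1) ^ n * chi (2 * n + s) := by
  induction n generalizing s with
  | zero => simp
  | succ n ih =>
    have h : ∑ k ∈ range (n + 1 + 1), ((n + 1).choose k : ℤ) * chi (k + s) =
        ∑ k ∈ range (n + 1), (n.choose k : ℤ) * chi (k + (s + 1)) +
        ∑ k ∈ range (n + 1), (n.choose k : ℤ) * chi (k + s) := by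
      have h1 := sum_range_succ (fun k => (n.choose k : ℤ) * chi (k + s)) (n + 1)
      rw [sum_range_succ', Nat.choose_succ_self] at h1
      rw [sum_range_succ']
      simp only [Nat.choose_succ_succ', Nat.choose_zero_right, Nat.cast_add, add_mul,
        sum_add_distrib, Nat.cast_zero, zero_mul, add_zero, Nat.cast_one, one_mul,
        zero_add] at h1 ⊢
      rw [← h1]
      have h2 : ∀ k, k + 1 + s = k + (s + 1) := fun k => by ring
      simp only [h2]
      ring
    have h3 := chi_add_chi_add_chi (2 * n + s)
    rw [h, ih, ih, show 2 * (n + 1) + s = 2 * n + s + 2 by ring,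
      show 2 * n + (s + 1) = 2 * n + s + 1 by ring]
    linear_combination (-1) ^ n * h3

lemma sum_chi_mul_second_difference (c : ℕ → ℤ) (N : ℕ) :
    ∑ k ∈ range N, chi (k + 1) * (c (k + 2) + 2 * c (k + 1) + c k) =
      ∑ k ∈ range N, chi (k + 1) * c (k + 1) + c 0 + chi N * c (N + 1) - chi (N + 1) * c N := by
  induction N with
  | zero => simp [chi]
  | succ N ih =>
    have := chi_add_chi_add_chi N
    rw [sum_range_succ, ih, sum_range_succ]
    linear_combination c (N + 1) * this

lemma choose_two_add (n k : ℕ) : ((n + 2).choose (k + 2) : ℤ) =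
    n.choose (k + 2) + 2 * n.choose (k + 1) + n.choose k := by
  simp only [Nat.choose_succ_succ']
  push_cast
  ring

lemma sum_centralBinom (n : ℕ) :
    ∑ m ∈ range n, (m.centralBinom : ℤ) =
      ∑ k ∈ range n, chi (k + 1) * (2 * n).choose (n + (k + 1)) := by
  induction n with
  | zero => simp
  | succ n ih =>
    have h := sum_chi_mul_second_difference (fun k => ((2 * n).choose (n + k) : ℤ)) (n + 1)
    simp only [add_zero] at h
    rw [Nat.choose_eq_zero_of_lt (show 2 * n < n + (n + 1 + 1) by omega),
      Nat.choose_eq_zero_of_lt (show 2 * n < n + (n + 1) by omega), sum_range_succ _ n,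
      sum_range_succ (fun k => chi (k + 1) * ((2 * n).choose (n + (k + 1)) : ℤ)) n,
      Nat.choose_eq_zero_of_lt (show 2 * n < n + (n + 1) by omega), ← ih] at h
    rw [sum_range_succ, Nat.centralBinom_eq_two_mul_choose n, sum_range_succ _ n]
    have h2 : ∀ k, ((2 * (n + 1)).choose (n + 1 + (k + 1)) : ℤ) =
        (2 * n).choose (n + (k + 2)) + 2 * (2 * n).choose (n + (k + 1)) +
          (2 * n).choose (n + k) := fun k => by
      rw [show 2 * (n + 1) = 2 * n + 2 by ring, show n + 1 + (k + 1) = n + k + 2 by ring,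
        choose_two_add]
      rfl
    simp only [h2]
    rw [Nat.choose_eq_zero_of_lt (show 2 * n < n + (n + 1) by omega),
      Nat.choose_eq_zero_of_lt (show 2 * n < n + (n + 2) by omega)]
    simp only [Nat.cast_zero, mul_zero, add_zero, sub_zero] at h
    rw [← h, Nat.choose_eq_zero_of_lt (show 2 * n < n + (n + 2) by omega)]
    simp
end Character

lemma chi_eq_legendreSym (n : ℕ) : chi n = legendreSym 3 n := by
  rw [legendreSym.mod]
  have : n % 3 = 0 ∨ n % 3 = 1 ∨ n % 3 = 2 := by omega
  rw [show ((n : ℤ) % (3 : ℕ)) = ((n % 3 : ℕ) : ℤ) by push_cast; rfl]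
  rcases this with h | h | h <;> rw [chi, h] <;> decide

lemma chi_two_mul (n : ℕ) : chi (2 * n) = -chi n := by
  have : n % 3 = 0 ∨ n % 3 = 1 ∨ n % 3 = 2 := by omega
  rcases this with h | h | h <;> simp [chi, Nat.mul_mod, h]

section Congruences

variable {p : ℕ}

lemma sq_dvd_choose_two_mul_sub (hp : p.Prime) {k : ℕ} (hk : k < p) :
    (p : ℤ) ^ 2 ∣ (2 * p).choose (p + k) - 2 * p.choose k := by
  obtain ⟨s, hs⟩ : ∃ s, p = k + (s + 1) := ⟨p - k - 1, by omega⟩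
  have h1 : (2 * p).choose (p + k) = (p + p).choose (s + 1) := by
    rw [two_mul]
    exact Nat.choose_symm_of_eq_add (by omega)
  have h2 : p.choose k = p.choose (s + 1) := Nat.choose_symm_of_eq_add (by omega)
  rw [h1, h2, Nat.add_choose_eq, Nat.sum_antidiagonal_eq_sum_range_succ_mk, sum_range_succ,
    sum_range_succ']
  simp only [Nat.sub_self, Nat.choose_zero_right, Nat.sub_zero, one_mul, mul_one]
  push_cast
  rw [show ∀ a b : ℤ, a + b + b - 2 * b = a by intros; ring]
  refine dvd_sum fun i hi => ?_
  have hi := mem_range.1 hi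
  rw [sq]
  exact_mod_cast mul_dvd_mul (hp.dvd_choose_self (by omega) (by omega))
    (hp.dvd_choose_self (by omega) (by omega))

lemma sq_dvd_sum_centralBinom_sub_chi (hp : p.Prime) (hp2 : p ≠ 2) :
    (p : ℤ) ^ 2 ∣ ∑ m ∈ range p, (m.centralBinom : ℤ) - chi p := by
  have h1 := sum_choose_mul_chi p 0
  rw [(hp.odd_of_ne_two hp2).neg_one_pow, sum_range_succ'] at h1
  simp only [add_zero, chi_two_mul, show chi 0 = 0 from rfl, mul_zero, neg_mul, one_mul,
    neg_neg] at h1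
  have h2 : ∑ m ∈ range p, (m.centralBinom : ℤ) - chi p = ∑ k ∈ range (p - 1),
      chi (k + 1) * (((2 * p).choose (p + (k + 1)) : ℤ) - 2 * p.choose (k + 1)) := by
    have h3 := sum_range_succ (fun k : ℕ =>
      chi (k + 1) * (((2 * p).choose (p + (k + 1)) : ℤ) - 2 * p.choose (k + 1))) (p - 1)
    rw [Nat.sub_add_cancel hp.one_le, ← two_mul p, Nat.choose_self, Nat.choose_self] at h3
    have h4 : ∑ k ∈ range p,
        chi (k + 1) * (((2 * p).choose (p + (k + 1)) : ℤ) - 2 * p.choose (k + 1)) =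
        ∑ m ∈ range p, (m.centralBinom : ℤ) - 2 * chi p := by
      rw [sum_centralBinom, ← h1, mul_sum, ← sum_sub_distrib]
      exact sum_congr rfl fun k _ => by ring
    push_cast at h3
    linear_combination h3 - h4
  rw [h2]
  refine dvd_sum fun k hk => Dvd.dvd.mul_left ?_ _
  exact sq_dvd_choose_two_mul_sub hp (by have := mem_range.1 hk; omega)

lemma cube_dvd_sub_mul_legendreCoeff_sub (hp : p.Prime) {i : ℕ} (hi : i < p) :
    (p : ℤ) ^ 3 ∣ (p - i) * legendreCoeff p i - p * (-1) ^ i := by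
  induction i with
  | zero => simp [legendreCoeff]
  | succ i ih =>
    have ih := ih (by omega)
    have hcop : IsCoprime ((p : ℤ) ^ 3) (((i : ℤ) + 1) ^ 2) := by
      refine IsCoprime.pow ?_
      exact_mod_cast Nat.isCoprime_iff_coprime.2
        ((Nat.Prime.coprime_iff_not_dvd hp).2 (Nat.not_dvd_of_pos_of_lt i.succ_pos hi))
    apply hcop.dvd_of_dvd_mul_left
    obtain ⟨c, hc⟩ := ih
    have h := sq_mul_legendreCoeff_succ_right p i
    refine ⟨(p : ℤ) ^ 2 * c + (-1) ^ i - (i + 1) ^ 2 * c, ?_⟩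
    push_cast
    linear_combination ((p : ℤ) - (i + 1)) * h + ((p : ℤ) ^ 2 - (i + 1) ^ 2) * hc

lemma sq_dvd_sqCoeff (hp : p.Prime) {m k : ℕ} (hm : m < p) (hk : k ≤ m) (h : p ≤ m + k) :
    (p : ℤ) ^ 2 ∣ sqCoeff m k := by
  have h1 : p ∣ m.centralBinom := by
    rw [Nat.centralBinom_eq_two_mul_choose, two_mul]
    exact hp.dvd_choose_add hm hm (by omega)
  have h2 : p ∣ (m + k).choose k := by
    rw [← Nat.choose_symm_add]
    exact hp.dvd_choose_add hm (by omega) h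
  rw [sqCoeff, legendreCoeff, sq]
  exact mul_dvd_mul (by exact_mod_cast h1) (Dvd.dvd.mul_left (by exact_mod_cast h2) _)

lemma cube_dvd_sqCoeff_mul (hp : p.Prime) {m k : ℕ} (hm : m < p) (hk : k ≤ m) :
    (p : ℤ) ^ 3 ∣ sqCoeff m k *
      ((p - (m + k : ℕ)) * legendreCoeff p (m + k) - p * (-1) ^ (m + k)) := by
  rcases lt_or_ge (m + k) p with h | h
  · exact Dvd.dvd.mul_left (cube_dvd_sub_mul_legendreCoeff_sub hp h) _
  · have h0 : ((p : ℤ) - (m + k : ℕ)) * legendreCoeff p (m + k) = 0 := by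
      rcases h.eq_or_lt with h | h
      · simp [← h]
      · rw [legendreCoeff_eq_zero h, mul_zero]
    rw [h0, zero_sub, pow_succ]
    exact mul_dvd_mul (sq_dvd_sqCoeff hp hm hk h)
      ((Dvd.intro _ rfl).neg_right)

lemma cube_dvd_sum_cube_apery_add (hp : p.Prime) (hp2 : p ≠ 2) :
    (p : ℤ) ^ 3 ∣ ∑ k ∈ range p, (2 * (k : ℤ) + 1) ^ 3 * (-1) ^ k * apery k +
      p * ∑ m ∈ range p, (4 * (m : ℤ) ^ 2 + 8 * m + 3) * m.centralBinom := by
  have h : ∀ m ∈ range p, (4 * (m : ℤ) ^ 2 + 8 * m + 3) * m.centralBinom =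
      ∑ k ∈ range (m + 1), sqCoeff m k * ((-1) ^ (m + k) * (4 * (m + k : ℕ) + 3)) := by
    intro m _
    have h1 : ((-1 : ℤ) ^ m) * (-1) ^ m = 1 := by rw [← mul_pow]; simp
    trans m.centralBinom * (-1) ^ m * ((-1) ^ m * (4 * (m : ℤ) ^ 2 + 8 * m + 3))
    · linear_combination -(4 * (m : ℤ) ^ 2 + 8 * m + 3) * m.centralBinom * h1
    · rw [← sum_neg_one_pow_mul_linear_legendreCoeff, mul_sum]
      refine sum_congr rfl fun k _ => ?_
      rw [sqCoeff]
      push_cast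
      ring
  rw [sum_congr rfl h, sum_cube_apery_eq, (hp.odd_of_ne_two hp2).neg_one_pow, mul_sum,
    ← sum_add_distrib]
  refine dvd_sum fun m hm => ?_
  rw [mul_sum, ← sum_add_distrib]
  refine dvd_sum fun k hk => ?_
  obtain ⟨c, hc⟩ := cube_dvd_sqCoeff_mul hp (mem_range.1 hm)
    (Nat.lt_succ_iff.1 (mem_range.1 hk))
  refine ⟨c * (4 * p ^ 2 - 4 * (m + k : ℕ) - 3) + 4 * sqCoeff m k * (-1) ^ (m + k), ?_⟩
  linear_combination (4 * (p : ℤ) ^ 2 - 4 * (m + k : ℕ) - 3) * hc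

theorem cube_dvd_three_mul_sum_cube_apery_add (hp : p.Prime) (hp2 : p ≠ 2) :
    (p : ℤ) ^ 3 ∣ 3 * ∑ k ∈ range p, (2 * (k : ℤ) + 1) ^ 3 * (-1) ^ k * apery k +
      p * chi p := by
  obtain ⟨a, ha⟩ := cube_dvd_sum_cube_apery_add hp hp2
  obtain ⟨b, hb⟩ := sq_dvd_sum_centralBinom_sub_chi hp hp2
  have hc := sum_quadratic_mul_centralBinom p
  refine ⟨3 * a - 4 * p.centralBinom - b, ?_⟩
  linear_combination 3 * ha - (p : ℤ) * hc - (p : ℤ) * hb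

end Congruences

lemma ratCongr_of_dvd_mul_sub {p m d : ℕ} (hp : p.Prime) (hd : ¬p ∣ d) {a b : ℚ} {z : ℤ}
    (hz : (d : ℚ) * (a - b) = z) (h : (p : ℤ) ^ m ∣ z) : ratCongr p m a b := by
  have := Fact.mk hp
  rcases eq_or_ne a b with hab | hab
  · exact Or.inl hab
  · right
    have hd0 : (d : ℚ) ≠ 0 := by
      rintro h0
      exact hd (by rw [Nat.cast_eq_zero.1 h0]; exact dvd_zero p)
    have hab0 := sub_ne_zero.2 hab
    have hz0 : z ≠ 0 := by
      rintro rfl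
      exact mul_ne_zero hd0 hab0 (by simpa using hz)
    have h1 : padicValRat p (a - b) = padicValInt p z := by
      rw [← padicValRat.of_int, ← hz, padicValRat.mul hd0 hab0, padicValRat.of_nat,
        padicValNat.eq_zero_of_not_dvd hd]
      simp
    rw [h1]
    exact_mod_cast ((padicValInt_dvd_iff m z).1 h).resolve_left hz0

end Apery

theorem sum_cube_apery (p : ℕ) (hp : p.Prime) (hp3 : 3 < p) :
    ratCongr p 3
      (∑ k ∈ Finset.range p, (2 * (k : ℚ) + 1) ^ 3 * (-1 : ℚ) ^ k * (apery k : ℚ))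
      (-((p : ℚ) / 3) * (legendreSym 3 p : ℚ)) := by
  refine Apery.ratCongr_of_dvd_mul_sub hp (Nat.not_dvd_of_pos_of_lt three_pos hp3) ?_
    (Apery.cube_dvd_three_mul_sum_cube_apery_add hp (by omega))
  rw [Apery.chi_eq_legendreSym]
  push_cast
  ring
end
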